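/- arXiv:1103.6184 — 2 statements merged into one kernel-verified Lean document; each statement's English description precedes it below -/
import Mathlib

section
/- Let n ≥ 2, α ∈ ℝ, and let Σ be a domain of class C² in S^{n−1} with Σ ≠ S^{n−1}. Then μ_D(C_Σ;α) > 0; that is, there exists C > 0 such that ∫_{C_Σ} |x|^α |Δu|² dx ≥ C ∫_{C_Σ} |x|^{α−4} |u|² dx for every u ∈ C²_c(C_Σ). -/
open MeasureTheory Metric Set Filter
open scoped RealInnerProductSpace

noncomputable section

/-- The Euclidean Laplacian of `u : ℝⁿ → ℝ` at a point. -/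
def lap {n : ℕ} (u : EuclideanSpace ℝ (Fin n) → ℝ) (x : EuclideanSpace ℝ (Fin n)) : ℝ :=
  ∑ i : Fin n, iteratedFDeriv ℝ 2 u x ![EuclideanSpace.single i 1, EuclideanSpace.single i 1]

/-- The Laplace–Beltrami operator on the unit sphere, computed via the
`0`-homogeneous extension: for a `0`-homogeneous function the Euclidean Laplacian
restricted to the unit sphere is exactly the Laplace–Beltrami operator. -/
def sphLap {n : ℕ} (φ : EuclideanSpace ℝ (Fin n) → ℝ) (σ : EuclideanSpace ℝ (Fin n)) : ℝ :=
  lap (fun x => φ (‖x‖⁻¹ • x)) σ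

/-- Squared norm of the spherical gradient, via the `0`-homogeneous extension. -/
def sphGradNormSq {n : ℕ} (φ : EuclideanSpace ℝ (Fin n) → ℝ) (σ : EuclideanSpace ℝ (Fin n)) : ℝ :=
  ‖fderiv ℝ (fun x => φ (‖x‖⁻¹ • x)) σ‖ ^ 2

/-- The open cone `C_Σ = {rσ : r > 0, σ ∈ Σ}` over a subset of the unit sphere. -/
def coneOf {n : ℕ} (S : Set (EuclideanSpace ℝ (Fin n))) : Set (EuclideanSpace ℝ (Fin n)) :=
  {x | x ≠ 0 ∧ ‖x‖⁻¹ • x ∈ S}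

/-- The canonical surface measure `dσ` on the unit sphere of `ℝⁿ`, as a measure on `ℝⁿ`. -/
def sphMeasure (n : ℕ) : Measure (EuclideanSpace ℝ (Fin n)) :=
  Measure.map Subtype.val
    ((volume : Measure (EuclideanSpace ℝ (Fin n))).toSphere)

/-- A (Dirichlet) eigenfunction of the Laplace–Beltrami operator on `S ⊆ 𝕊^{n-1}`
relative to the eigenvalue `lam`. -/
def IsEigenfun {n : ℕ} (S : Set (EuclideanSpace ℝ (Fin n))) (lam : ℝ)
    (φ : EuclideanSpace ℝ (Fin n) → ℝ) : Prop :=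
  ContinuousOn (fun x => φ (‖x‖⁻¹ • x)) (coneOf (closure S)) ∧
  ContDiffOn ℝ 2 (fun x => φ (‖x‖⁻¹ • x)) (coneOf S) ∧
  (∀ σ ∈ closure S \ S, φ σ = 0) ∧
  (∃ σ ∈ S, φ σ ≠ 0) ∧
  (∀ σ ∈ S, - sphLap φ σ = lam * φ σ)

/-- The Dirichlet spectrum `Λ(Σ)` of the Laplace–Beltrami operator on `S`. -/
def spec {n : ℕ} (S : Set (EuclideanSpace ℝ (Fin n))) : Set ℝ :=
  {lam | ∃ φ, IsEigenfun S lam φ}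

/-- `S` is a domain in the unit sphere `𝕊^{n-1}`: a relatively open connected
nonempty subset. -/
def IsSphDomain {n : ℕ} (S : Set (EuclideanSpace ℝ (Fin n))) : Prop :=
  S ⊆ Metric.sphere (0 : EuclideanSpace ℝ (Fin n)) 1 ∧
  IsOpen (Subtype.val ⁻¹' S : Set (Metric.sphere (0 : EuclideanSpace ℝ (Fin n)) 1)) ∧
  IsConnected S

/-- `S` is a domain of class `C²` in the unit sphere: a domain such that the cone
over it admits local `C²` defining functions away from the origin. -/
def IsC2SphDomain {n : ℕ} (S : Set (EuclideanSpace ℝ (Fin n))) : Prop :=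
  IsSphDomain S ∧
  ∀ x ∈ frontier (coneOf S) \ {0}, ∃ (U : Set (EuclideanSpace ℝ (Fin n)))
    (f : EuclideanSpace ℝ (Fin n) → ℝ), IsOpen U ∧ x ∈ U ∧ ContDiff ℝ 2 f ∧
    fderiv ℝ f x ≠ 0 ∧ coneOf S ∩ U = {y ∈ U | f y < 0}

/-- `γ_{n,α} = ((n-2)/2)² - ((α-2)/2)²`. -/
def gam (n : ℕ) (α : ℝ) : ℝ := (((n : ℝ) - 2) / 2) ^ 2 - ((α - 2) / 2) ^ 2

/-- `γ̄_{n,α} = ((n-2)/2)² + ((α-2)/2)²`. -/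
def gbar (n : ℕ) (α : ℝ) : ℝ := (((n : ℝ) - 2) / 2) ^ 2 + ((α - 2) / 2) ^ 2

/-- The class `C²_c(Ω̄ ∖ {0})` of Navier test functions: `C²` up to the closure of
`Ω`, vanishing on `∂Ω` and in a neighborhood of `0` and of `∞`. -/
def NavierAdm {n : ℕ} (Ω : Set (EuclideanSpace ℝ (Fin n)))
    (u : EuclideanSpace ℝ (Fin n) → ℝ) : Prop :=
  ContDiffOn ℝ 2 u (closure Ω) ∧
  (∀ x ∈ frontier Ω, u x = 0) ∧
  (∃ ε > 0, ∀ x : EuclideanSpace ℝ (Fin n), ‖x‖ < ε → u x = 0) ∧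
  (∃ R : ℝ, ∀ x : EuclideanSpace ℝ (Fin n), R < ‖x‖ → u x = 0)

/-- The class `C²_c(Ω)` of Dirichlet test functions: globally `C²` with compact
support contained in `Ω`. -/
def DirichletAdm {n : ℕ} (Ω : Set (EuclideanSpace ℝ (Fin n)))
    (u : EuclideanSpace ℝ (Fin n) → ℝ) : Prop :=
  ContDiff ℝ 2 u ∧ HasCompactSupport u ∧ tsupport u ⊆ Ω

/-- The best Rellich constant `μ_N(Ω;α)` under Navier boundary conditions. -/
def muN {n : ℕ} (Ω : Set (EuclideanSpace ℝ (Fin n))) (α : ℝ) : ℝ :=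
  sInf {q : ℝ | ∃ u, NavierAdm Ω u ∧ (∃ x ∈ Ω, u x ≠ 0) ∧
    q = (∫ x in Ω, ‖x‖ ^ α * (lap u x) ^ 2) / (∫ x in Ω, ‖x‖ ^ (α - 4) * (u x) ^ 2)}

/-- The best Rellich constant `μ_D(Ω;α)` under Dirichlet boundary conditions. -/
def muD {n : ℕ} (Ω : Set (EuclideanSpace ℝ (Fin n))) (α : ℝ) : ℝ :=
  sInf {q : ℝ | ∃ u, DirichletAdm Ω u ∧ (∃ x ∈ Ω, u x ≠ 0) ∧
    q = (∫ x in Ω, ‖x‖ ^ α * (lap u x) ^ 2) / (∫ x in Ω, ‖x‖ ^ (α - 4) * (u x) ^ 2)}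

/-- The surrogate of `H² ∩ H¹₀(Σ)`: functions whose `0`-homogeneous extension is
`C²` up to the closure of the cone, vanishing on the relative boundary of `S`. -/
def NavAdmS {n : ℕ} (S : Set (EuclideanSpace ℝ (Fin n)))
    (φ : EuclideanSpace ℝ (Fin n) → ℝ) : Prop :=
  ContDiffOn ℝ 2 (fun x => φ (‖x‖⁻¹ • x)) (coneOf (closure S)) ∧
  (∀ σ ∈ closure S \ S, φ σ = 0)

/-- The surrogate of `H²₀(Σ)`: as `NavAdmS`, with in addition vanishing gradient
on the relative boundary of `S`. -/
def DirAdmS {n : ℕ} (S : Set (EuclideanSpace ℝ (Fin n)))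
    (φ : EuclideanSpace ℝ (Fin n) → ℝ) : Prop :=
  NavAdmS S φ ∧
  ∀ σ ∈ closure S \ S,
    fderivWithin ℝ (fun x => φ (‖x‖⁻¹ • x)) (coneOf (closure S)) σ = 0

/-- The Rayleigh-type quotient `∫_Σ |Lφ|² dσ / ∫_Σ |φ|² dσ` with
`Lφ = -Δ_σ φ + γ φ`. -/
def sphQuot {n : ℕ} (S : Set (EuclideanSpace ℝ (Fin n))) (γ : ℝ)
    (φ : EuclideanSpace ℝ (Fin n) → ℝ) : ℝ :=
  (∫ σ in S, (- sphLap φ σ + γ * φ σ) ^ 2 ∂(sphMeasure n)) /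
    (∫ σ in S, (φ σ) ^ 2 ∂(sphMeasure n))

/-- Partial derivative `w_s` of a function on the cylinder `ℝ × 𝕊^{n-1}`. -/
def ws {n : ℕ} (w : ℝ × EuclideanSpace ℝ (Fin n) → ℝ)
    (p : ℝ × EuclideanSpace ℝ (Fin n)) : ℝ :=
  deriv (fun t => w (t, p.2)) p.1

/-- Second partial derivative `w_ss` of a function on the cylinder. -/
def wss {n : ℕ} (w : ℝ × EuclideanSpace ℝ (Fin n) → ℝ)
    (p : ℝ × EuclideanSpace ℝ (Fin n)) : ℝ :=
  deriv (fun t => ws w (t, p.2)) p.1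

end

noncomputable section

open scoped ContDiff Topology

section Helpers

variable {n : ℕ}

local notation "EE" => EuclideanSpace ℝ (Fin n)

/-- Partial derivative. -/
def dd (i : Fin n) (f : EuclideanSpace ℝ (Fin n) → ℝ) (x : EuclideanSpace ℝ (Fin n)) : ℝ :=
  fderiv ℝ f x (EuclideanSpace.single i 1)

/-- Sum of second partial derivatives. -/
def lapD (f : EuclideanSpace ℝ (Fin n) → ℝ) (x : EuclideanSpace ℝ (Fin n)) : ℝ :=
  ∑ i : Fin n, dd i (dd i f) x

lemma dd_add {i : Fin n} {f g : EE → ℝ} {x : EE} (hf : DifferentiableAt ℝ f x)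
    (hg : DifferentiableAt ℝ g x) : dd i (fun y => f y + g y) x = dd i f x + dd i g x := by
  unfold dd; rw [fderiv_fun_add hf hg]; rfl

lemma dd_sub {i : Fin n} {f g : EE → ℝ} {x : EE} (hf : DifferentiableAt ℝ f x)
    (hg : DifferentiableAt ℝ g x) : dd i (fun y => f y - g y) x = dd i f x - dd i g x := by
  unfold dd; rw [fderiv_fun_sub hf hg]; rfl

lemma dd_mul {i : Fin n} {f g : EE → ℝ} {x : EE} (hf : DifferentiableAt ℝ f x)
    (hg : DifferentiableAt ℝ g x) :
    dd i (fun y => f y * g y) x = dd i f x * g x + f x * dd i g x := by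
  unfold dd; rw [fderiv_fun_mul hf hg]; simp; ring

lemma dd_cmul {i : Fin n} {g : EE → ℝ} {x : EE} (c : ℝ) (hg : DifferentiableAt ℝ g x) :
    dd i (fun y => c * g y) x = c * dd i g x := by
  unfold dd; rw [fderiv_const_mul hg]; rfl

lemma dd_sq {i : Fin n} {g : EE → ℝ} {x : EE} (hg : DifferentiableAt ℝ g x) :
    dd i (fun y => g y ^ 2) x = 2 * g x * dd i g x := by
  simp only [pow_two]
  rw [dd_mul hg hg]; ring

lemma dd_exp {i : Fin n} {g : EE → ℝ} {x : EE} (hg : DifferentiableAt ℝ g x) :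
    dd i (fun y => Real.exp (g y)) x = Real.exp (g x) * dd i g x := by
  unfold dd; rw [fderiv_exp hg]; rfl

lemma dd_sum {i : Fin n} {ι : Type*} {s : Finset ι} {f : ι → EE → ℝ} {x : EE}
    (hf : ∀ j ∈ s, DifferentiableAt ℝ (f j) x) :
    dd i (fun y => ∑ j ∈ s, f j y) x = ∑ j ∈ s, dd i (f j) x := by
  unfold dd; rw [fderiv_fun_sum hf]; simp

lemma dd_congr {i : Fin n} {f g : EE → ℝ} {x : EE} (h : f =ᶠ[𝓝 x] g) : dd i f x = dd i g x := by
  unfold dd; rw [h.fderiv_eq]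

lemma dd_congrOn {i : Fin n} {f g : EE → ℝ} {G : Set EE} (hG : IsOpen G) (h : ∀ x ∈ G, f x = g x)
    {x : EE} (hx : x ∈ G) : dd i f x = dd i g x :=
  dd_congr (by filter_upwards [hG.mem_nhds hx] with y hy using h y hy)

lemma lap_eq {f : EE → ℝ} {x : EE} (hf : ContDiffAt ℝ 2 f x) : lap f x = lapD f x := by
  unfold lap lapD dd
  have h1 : DifferentiableAt ℝ (fderiv ℝ f) x :=
    (hf.fderiv_right (m := 1) (by norm_num)).differentiableAt (by norm_num)
  refine Finset.sum_congr rfl fun i _ => ?_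
  rw [iteratedFDeriv_two_apply, fderiv_clm_apply h1 (by fun_prop)]
  simp

lemma dd_symm {f : EE → ℝ} {x : EE} (hf : ContDiffAt ℝ 2 f x) (i j : Fin n) :
    dd i (dd j f) x = dd j (dd i f) x := by
  have h1 : DifferentiableAt ℝ (fderiv ℝ f) x :=
    (hf.fderiv_right (m := 1) (by norm_num)).differentiableAt (by norm_num)
  have hs := hf.isSymmSndFDerivAt (by simp)
  unfold dd
  rw [fderiv_clm_apply h1 (by fun_prop), fderiv_clm_apply h1 (by fun_prop)]
  simp
  exact hs _ _

lemma dd_smooth {f : EE → ℝ} {G : Set EE} (hG : IsOpen G) (hf : ContDiffOn ℝ ∞ f G) (i : Fin n) :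
    ContDiffOn ℝ ∞ (dd i f) G := by
  have := hf.fderiv_of_isOpen (m := ∞) hG (by simp)
  exact this.clm_apply contDiffOn_const

lemma lapD_smooth {f : EE → ℝ} {G : Set EE} (hG : IsOpen G) (hf : ContDiffOn ℝ ∞ f G) :
    ContDiffOn ℝ ∞ (lapD f) G := by
  unfold lapD
  exact ContDiffOn.sum fun i _ => dd_smooth hG (dd_smooth hG hf i) i

lemma sm_diff {f : EE → ℝ} {G : Set EE} (hG : IsOpen G) (hf : ContDiffOn ℝ ∞ f G) {x : EE}
    (hx : x ∈ G) : DifferentiableAt ℝ f x :=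
  (hf.contDiffAt (hG.mem_nhds hx)).differentiableAt (by simp)

lemma dd_contDiff {f : EE → ℝ} (hf : ContDiff ℝ 2 f) (i : Fin n) : ContDiff ℝ 1 (dd i f) :=
  (hf.fderiv_right (m := 1) (by norm_num)).clm_apply contDiff_const

lemma dd_zero_of_notMem {f : EE → ℝ} {i : Fin n} {x : EE} (hx : x ∉ tsupport f) : dd i f x = 0 := by
  unfold dd; rw [fderiv_of_notMem_tsupport ℝ hx]; rfl

lemma integral_dd {f : EE → ℝ} (hf : ContDiff ℝ 1 f) (hc : HasCompactSupport f) (i : Fin n) :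
    ∫ x, dd i f x = 0 := by
  have hcd : Continuous (dd i f) := (hf.continuous_fderiv (by norm_num)).clm_apply continuous_const
  have hcs : HasCompactSupport (dd i f) := hc.fderiv_apply (𝕜 := ℝ) _
  have := integral_mul_fderiv_eq_neg_fderiv_mul_of_integrable (μ := (volume : Measure EE))
    (f := fun _ : EE => (1 : ℝ)) (g := f) (v := EuclideanSpace.single i 1)
    (by simp) (by simp only [one_mul]; exact hcd.integrable_of_hasCompactSupport hcs)
    (by simpa using hf.continuous.integrable_of_hasCompactSupport hc)
    (by intros; fun_prop) (fun x _ => hf.differentiable (by norm_num) x)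
  simpa [dd] using this

/-- Homogeneity lemma. -/
lemma dd_hom {f : EE → ℝ} {G : Set EE} (hG : IsOpen G) (hf : ContDiffOn ℝ ∞ f G)
    {d : ℤ} {c : ℝ → ℝ}
    (hh : ∀ t : ℝ, 0 < t → ∀ x ∈ G, f (t • x) = t ^ d * f x + c t) (i : Fin n) :
    ∀ t : ℝ, 0 < t → ∀ x ∈ G, dd i f (t • x) = t ^ (d - 1) * dd i f x := by
  intro t ht x hx
  have h1 : fderiv ℝ (fun y => f (t • y)) x = t • fderiv ℝ f (t • x) := fderiv_comp_smul _
  have h2 : fderiv ℝ (fun y => f (t • y)) x = t ^ d • fderiv ℝ f x := by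
    have : (fun y => f (t • y)) =ᶠ[𝓝 x] fun y => t ^ d * f y + c t := by
      filter_upwards [hG.mem_nhds hx] with y hy using hh t ht y hy
    rw [this.fderiv_eq, fderiv_add_const, fderiv_const_mul (sm_diff hG hf hx)]
  rw [h1] at h2
  have h3 := congrArg (fun L => L (EuclideanSpace.single i 1)) h2
  simp only [smul_apply, smul_eq_mul] at h3
  unfold dd
  rw [zpow_sub_one₀ ht.ne']
  field_simp
  linarith

lemma carleman_alg (v k w : ℝ) (vi p ki kii : Fin n → ℝ) (V P : Fin n → Fin n → ℝ)
    (hV : ∀ i j, V i j = V j i)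
    (h1 : 0 ≤ 4 * ∑ i, ∑ j, P i j * vi i * vi j + 2 * (k - ∑ i, P i i) * ∑ i, vi i ^ 2)
    (h2 : w ≤ 4 * ∑ i, ∑ j, P i j * p i * p j - 2 * (k - ∑ i, P i i) * ∑ i, p i ^ 2
      - ∑ i, kii i - (k - ∑ i, P i i) ^ 2) :
    ∑ i, (-4 * (V i i * (∑ j, p j * vi j) + vi i * ∑ j, (P i j * vi j + p j * V i j))
      + 2 * (P i i * (∑ j, vi j ^ 2) + p i * ∑ j, 2 * vi j * V i j)
      - 2 * ((ki i * v + k * vi i) * vi i + k * v * V i i)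
      + (kii i * v ^ 2 + ki i * (2 * v * vi i))
      - 2 * (((∑ j, 2 * p j * P i j) * p i + (∑ j, p j ^ 2) * P i i) * v ^ 2
        + (∑ j, p j ^ 2) * p i * (2 * v * vi i))) + w * v ^ 2
      ≤ (∑ i, V i i - 2 * ∑ i, p i * vi i + (∑ i, p i ^ 2 - ∑ i, P i i) * v) ^ 2 := by
  have e1 : ∑ i, vi i * ∑ j, p j * V i j = ∑ i, p i * ∑ j, vi j * V i j := by
    simp only [Finset.mul_sum]
    rw [Finset.sum_comm]
    refine Finset.sum_congr rfl fun i _ => Finset.sum_congr rfl fun j _ => ?_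
    rw [hV]; ring
  have e2 : ∑ i, ∑ j, P i j * vi i * vi j = ∑ i, vi i * ∑ j, P i j * vi j := by
    simp only [Finset.mul_sum]
    refine Finset.sum_congr rfl fun i _ => Finset.sum_congr rfl fun j _ => ?_
    ring
  have e3 : ∑ i, ∑ j, P i j * p i * p j = ∑ i, p i * ∑ j, p j * P i j := by
    simp only [Finset.mul_sum]
    refine Finset.sum_congr rfl fun i _ => Finset.sum_congr rfl fun j _ => ?_
    ring
  rw [e2] at h1
  rw [e3] at h2
  set S1 := ∑ j, p j * vi j with hS1
  set Nv := ∑ j, vi j ^ 2 with hNv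
  set N := ∑ j, p j ^ 2 with hN
  set h := ∑ i, P i i with hh
  set T := ∑ i, V i i with hT
  set a : Fin n → ℝ := fun i => ∑ j, P i j * vi j with ha
  set b : Fin n → ℝ := fun i => ∑ j, p j * V i j with hb
  set c : Fin n → ℝ := fun i => ∑ j, vi j * V i j with hc
  set d : Fin n → ℝ := fun i => ∑ j, p j * P i j with hd
  have key : ∑ i, (-4 * (V i i * S1 + vi i * ∑ j, (P i j * vi j + p j * V i j))
      + 2 * (P i i * Nv + p i * ∑ j, 2 * vi j * V i j)
      - 2 * ((ki i * v + k * vi i) * vi i + k * v * V i i)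
      + (kii i * v ^ 2 + ki i * (2 * v * vi i))
      - 2 * (((∑ j, 2 * p j * P i j) * p i + N * P i i) * v ^ 2
        + N * p i * (2 * v * vi i)))
      = -4 * (T * S1 + ∑ i, vi i * a i + ∑ i, vi i * b i) + 2 * (h * Nv + 2 * ∑ i, p i * c i)
        - 2 * (k * Nv + k * v * T) + (∑ i, kii i) * v ^ 2
        - 2 * ((2 * ∑ i, p i * d i + N * h) * v ^ 2 + N * 2 * v * S1) := by
    have f1 : ∀ i, ∑ j, (P i j * vi j + p j * V i j) = a i + b i :=
      fun i => Finset.sum_add_distrib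
    have f2 : ∀ i, ∑ j, 2 * vi j * V i j = 2 * c i := by
      intro i; simp only [hc, Finset.mul_sum, mul_assoc]
    have f3 : ∀ i, ∑ j, 2 * p j * P i j = 2 * d i := by
      intro i; simp only [hd, Finset.mul_sum, mul_assoc]
    have f4 : ∀ i ∈ (Finset.univ : Finset (Fin n)),
      (-4 * (V i i * S1 + vi i * ∑ j, (P i j * vi j + p j * V i j))
      + 2 * (P i i * Nv + p i * ∑ j, 2 * vi j * V i j)
      - 2 * ((ki i * v + k * vi i) * vi i + k * v * V i i)
      + (kii i * v ^ 2 + ki i * (2 * v * vi i))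
      - 2 * (((∑ j, 2 * p j * P i j) * p i + N * P i i) * v ^ 2
        + N * p i * (2 * v * vi i)))
      = (-4 * S1 - 2 * k * v) * V i i + (-4) * (vi i * a i) + (-4) * (vi i * b i)
        + (2 * Nv - 2 * N * v ^ 2) * P i i + 4 * (p i * c i) + (-2 * k) * (vi i ^ 2)
        + v ^ 2 * kii i + (-4 * v ^ 2) * (p i * d i) + (-4 * N * v) * (p i * vi i) := by
      intro i _
      rw [f1, f2, f3]; ring
    rw [Finset.sum_congr rfl f4]
    simp only [Finset.sum_add_distrib, ← Finset.mul_sum]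
    rw [← hT, ← hh, ← hNv, ← hS1]
    ring
  rw [key]
  have e1' : ∑ i, vi i * b i = ∑ i, p i * c i := e1
  have h1' : 0 ≤ 4 * ∑ i, vi i * a i + 2 * (k - h) * Nv := h1
  have h2' : w ≤ 4 * ∑ i, p i * d i - 2 * (k - h) * N - ∑ i, kii i - (k - h) ^ 2 := h2
  rw [e1']
  have h3 := mul_le_mul_of_nonneg_right h2' (sq_nonneg v)
  nlinarith [sq_nonneg (T + N * v + (k - h) * v), sq_nonneg (2 * S1 + h * v)]

lemma cd_of_tsupport {f : EE → ℝ} {m : ℕ} (h : ∀ x ∈ tsupport f, ContDiffAt ℝ m f x) :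
    ContDiff ℝ m f := by
  refine contDiff_iff_contDiffAt.2 fun x => ?_
  by_cases hx : x ∈ tsupport f
  · exact h x hx
  · have : f =ᶠ[𝓝 x] fun _ => 0 := notMem_tsupport_iff_eventuallyEq.1 hx
    exact contDiffAt_const.congr_of_eventuallyEq this

lemma carleman {G C : Set EE} (hG : IsOpen G) (hC : C ⊆ G) {Φ k w : EE → ℝ}
    (hΦ : ContDiffOn ℝ ∞ Φ G) (hk : ContDiffOn ℝ ∞ k G) (hw : ContinuousOn w G)
    (h1 : ∀ x ∈ C, ∀ ξ : Fin n → ℝ, 0 ≤ 4 * ∑ i, ∑ j, dd i (dd j Φ) x * ξ i * ξ j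
      + 2 * (k x - lapD Φ x) * ∑ i, ξ i ^ 2)
    (h2 : ∀ x ∈ C, w x ≤ 4 * ∑ i, ∑ j, dd i (dd j Φ) x * dd i Φ x * dd j Φ x
      - 2 * (k x - lapD Φ x) * ∑ i, dd i Φ x ^ 2 - lapD k x - (k x - lapD Φ x) ^ 2)
    {u : EE → ℝ} (hu : ContDiff ℝ 2 u) (hcs : HasCompactSupport u) (hsub : tsupport u ⊆ C) :
    ∫ x, w x * (Real.exp (Φ x) * u x) ^ 2 ≤ ∫ x, (Real.exp (Φ x) * lap u x) ^ 2 := by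
  set v : EE → ℝ := fun x => Real.exp (Φ x) * u x with hvdef
  have hsubG : tsupport u ⊆ G := hsub.trans hC
  have hvt : tsupport v ⊆ tsupport u := closure_mono (by
    intro x hx hx0
    apply hx
    simp [hvdef, hx0])
  have hvc : HasCompactSupport v := hcs.mono' ((subset_tsupport v).trans hvt)
  have hv : ContDiff ℝ 2 v := by
    refine cd_of_tsupport (m := 2) fun x hx => ?_
    have hxG := hsubG (hvt hx)
    have : ContDiffAt ℝ 2 Φ x := (hΦ.contDiffAt (hG.mem_nhds hxG)).of_le
      ENat.LEInfty.out
    exact this.exp.mul hu.contDiffAt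
  have hv1 : ∀ i, ContDiff ℝ 1 (dd i v) := dd_contDiff hv
  -- the vector field
  set Z : Fin n → EE → ℝ := fun i x =>
    (-4) * (dd i v x * ∑ j, dd j Φ x * dd j v x) + 2 * (dd i Φ x * ∑ j, dd j v x ^ 2)
    - 2 * ((k x * v x) * dd i v x) + dd i k x * v x ^ 2
    - 2 * (((∑ j, dd j Φ x ^ 2) * dd i Φ x) * v x ^ 2) with hZ
  have hZ0 : ∀ i, ∀ x, x ∉ tsupport v → Z i x = 0 := by
    intro i x hx
    have a1 : ∀ j, dd j v x = 0 := fun j => dd_zero_of_notMem hx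
    have a2 : v x = 0 := image_eq_zero_of_notMem_tsupport hx
    simp [hZ, a1, a2]
  have hZt : ∀ i, tsupport (Z i) ⊆ tsupport v := fun i =>
    closure_minimal (fun x hx => by by_contra h; exact hx (hZ0 i x h)) isClosed_closure
  have hsm : ∀ {f : EE → ℝ}, ContDiffOn ℝ ∞ f G → ∀ x ∈ G, ContDiffAt ℝ 1 f x := fun hf x hx =>
    (hf.contDiffAt (hG.mem_nhds hx)).of_le (by exact_mod_cast le_top)
  have hZ1 : ∀ i, ContDiff ℝ 1 (Z i) := by
    intro i
    refine cd_of_tsupport (m := 1) fun x hx => ?_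
    have hxG := hsubG (hvt (hZt i hx))
    have b1 : ∀ j, ContDiffAt ℝ 1 (dd j Φ) x := fun j => hsm (dd_smooth hG hΦ j) x hxG
    have b2 : ∀ j, ContDiffAt ℝ 1 (dd j v) x := fun j => (hv1 j).contDiffAt
    have b3 : ContDiffAt ℝ 1 k x := hsm hk x hxG
    have b4 : ContDiffAt ℝ 1 (dd i k) x := hsm (dd_smooth hG hk i) x hxG
    have b5 : ContDiffAt ℝ 1 v x := hv.contDiffAt.of_le (by norm_num)
    have b6 : ContDiffAt ℝ 1 (fun x => ∑ j, dd j Φ x * dd j v x) x :=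
      ContDiffAt.sum fun j _ => (b1 j).mul (b2 j)
    have b7 : ContDiffAt ℝ 1 (fun x => ∑ j, dd j v x ^ 2) x :=
      ContDiffAt.sum fun j _ => (b2 j).pow 2
    have b8 : ContDiffAt ℝ 1 (fun x => ∑ j, dd j Φ x ^ 2) x :=
      ContDiffAt.sum fun j _ => (b1 j).pow 2
    exact ((((contDiffAt_const.mul ((b2 i).mul b6)).add (contDiffAt_const.mul ((b1 i).mul b7))).sub
      (contDiffAt_const.mul ((b3.mul b5).mul (b2 i)))).add (b4.mul (b5.pow 2))).sub
      (contDiffAt_const.mul ((b8.mul (b1 i)).mul (b5.pow 2)))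
  have hZc : ∀ i, HasCompactSupport (Z i) := fun i => hvc.mono' ((subset_tsupport _).trans (hZt i))
  -- conjugated Laplacian
  have hlap : ∀ x ∈ G, Real.exp (Φ x) * lap u x = lapD v x - 2 * ∑ i, dd i Φ x * dd i v x
      + (∑ i, dd i Φ x ^ 2 - lapD Φ x) * v x := by
    intro x hx
    have dΦ : ∀ y ∈ G, DifferentiableAt ℝ Φ y := fun y hy => sm_diff hG hΦ hy
    have du : ∀ y, DifferentiableAt ℝ u y := fun y => hu.differentiable (by norm_num) y
    have hvi : ∀ i, ∀ y ∈ G, dd i v y = Real.exp (Φ y) * (dd i u y + dd i Φ y * u y) := by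
      intro i y hy
      rw [hvdef, dd_mul (dΦ y hy).exp (du y), dd_exp (dΦ y hy)]; ring
    have hvii : ∀ i, dd i (dd i v) x = Real.exp (Φ x) * (dd i (dd i u) x
        + 2 * (dd i Φ x * dd i u x) + dd i (dd i Φ) x * u x + dd i Φ x ^ 2 * u x) := by
      intro i
      have c1 : DifferentiableAt ℝ (dd i u) x := (dd_contDiff hu i).differentiable (by norm_num) x
      have c2 : DifferentiableAt ℝ (dd i Φ) x := sm_diff hG (dd_smooth hG hΦ i) hx
      rw [dd_congrOn hG (hvi i) hx, dd_mul (dΦ x hx).exp (c1.fun_add (c2.fun_mul (du x))),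
        dd_exp (dΦ x hx), dd_add c1 (c2.fun_mul (du x)), dd_mul c2 (du x)]
      ring
    rw [lap_eq hu.contDiffAt]
    unfold lapD
    simp only [hvii, hvi _ x hx]
    simp only [hvdef, sub_mul, Finset.mul_sum, Finset.sum_mul, ← Finset.sum_add_distrib,
      ← Finset.sum_sub_distrib]
    refine Finset.sum_congr rfl fun i _ => ?_
    ring
  -- divergence
  have hdiv : ∀ x ∈ G, ∀ i, dd i (Z i) x =
      (-4 * (dd i (dd i v) x * (∑ j, dd j Φ x * dd j v x)
        + dd i v x * ∑ j, (dd i (dd j Φ) x * dd j v x + dd j Φ x * dd i (dd j v) x))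
      + 2 * (dd i (dd i Φ) x * (∑ j, dd j v x ^ 2) + dd i Φ x * ∑ j, 2 * dd j v x * dd i (dd j v) x)
      - 2 * ((dd i k x * v x + k x * dd i v x) * dd i v x + k x * v x * dd i (dd i v) x)
      + (dd i (dd i k) x * v x ^ 2 + dd i k x * (2 * v x * dd i v x))
      - 2 * (((∑ j, 2 * dd j Φ x * dd i (dd j Φ) x) * dd i Φ x
        + (∑ j, dd j Φ x ^ 2) * dd i (dd i Φ) x) * v x ^ 2
        + (∑ j, dd j Φ x ^ 2) * dd i Φ x * (2 * v x * dd i v x))) := by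
    intro x hx i
    have b1 : ∀ j, DifferentiableAt ℝ (dd j Φ) x := fun j => sm_diff hG (dd_smooth hG hΦ j) hx
    have b2 : ∀ j, DifferentiableAt ℝ (dd j v) x := fun j => (hv1 j).differentiable (by norm_num) x
    have b3 : DifferentiableAt ℝ k x := sm_diff hG hk hx
    have b4 : DifferentiableAt ℝ (dd i k) x := sm_diff hG (dd_smooth hG hk i) hx
    have b5 : DifferentiableAt ℝ v x := hv.differentiable (by norm_num) x
    have b6 : DifferentiableAt ℝ (fun x => ∑ j, dd j Φ x * dd j v x) x :=
      DifferentiableAt.fun_sum fun j _ => (b1 j).fun_mul (b2 j)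
    have b7 : DifferentiableAt ℝ (fun x => ∑ j, dd j v x ^ 2) x :=
      DifferentiableAt.fun_sum fun j _ => (b2 j).fun_pow 2
    have b8 : DifferentiableAt ℝ (fun x => ∑ j, dd j Φ x ^ 2) x :=
      DifferentiableAt.fun_sum fun j _ => (b1 j).fun_pow 2
    have t1 := (b2 i).fun_mul b6
    have t2 := (b1 i).fun_mul b7
    have t3 := (b3.fun_mul b5).fun_mul (b2 i)
    have t4 := b4.fun_mul (b5.fun_pow 2)
    have t5 := (b8.fun_mul (b1 i)).fun_mul (b5.fun_pow 2)
    have t1' := t1.const_mul (-4)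
    have t2' := t2.const_mul 2
    have t3' := t3.const_mul 2
    have t5' := t5.const_mul 2
    simp only [hZ]
    rw [dd_sub (((t1'.fun_add t2').fun_sub t3').fun_add t4) t5', dd_add ((t1'.fun_add t2').fun_sub t3') t4,
      dd_sub (t1'.fun_add t2') t3', dd_add t1' t2', dd_cmul _ t1, dd_cmul _ t2, dd_cmul _ t3,
      dd_cmul _ t5, dd_mul (b2 i) b6, dd_mul (b1 i) b7, dd_mul (b3.fun_mul b5) (b2 i),
      dd_mul b3 b5, dd_mul b4 (b5.fun_pow 2), dd_mul (b8.fun_mul (b1 i)) (b5.fun_pow 2), dd_mul b8 (b1 i),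
      dd_sq b5, dd_sum (fun j _ => (b1 j).fun_mul (b2 j)), dd_sum (fun j _ => (b2 j).fun_pow 2),
      dd_sum (fun j _ => (b1 j).fun_pow 2)]
    simp only [dd_sq (b1 _), dd_sq (b2 _), dd_mul (b1 _) (b2 _)]
  -- pointwise inequality
  have hpt : ∀ x, ∑ i, dd i (Z i) x + w x * v x ^ 2 ≤ (Real.exp (Φ x) * lap u x) ^ 2 := by
    intro x
    by_cases hx : x ∈ tsupport u
    · have hxC := hsub hx
      have hxG := hsubG hx
      rw [hlap x hxG, Finset.sum_congr rfl fun i _ => hdiv x hxG i]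
      exact carleman_alg (v x) (k x) (w x) (fun i => dd i v x) (fun i => dd i Φ x)
        (fun i => dd i k x) (fun i => dd i (dd i k) x) (fun i j => dd i (dd j v) x)
        (fun i j => dd i (dd j Φ) x) (fun i j => dd_symm hv.contDiffAt i j)
        (h1 x hxC _) (h2 x hxC)
    · have hxv : x ∉ tsupport v := fun h => hx (hvt h)
      have a1 : ∀ i, dd i (Z i) x = 0 := fun i => dd_zero_of_notMem fun h => hxv (hZt i h)
      have a2 : v x = 0 := image_eq_zero_of_notMem_tsupport hxv
      simp only [a1, a2, Finset.sum_const_zero]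
      nlinarith [sq_nonneg (Real.exp (Φ x) * lap u x)]
  -- integrate
  have hcont : ∀ {f : EE → ℝ}, tsupport f ⊆ tsupport u → (∀ x ∈ G, ContinuousAt f x) →
      Integrable f := by
    intro f hf hfc
    have : Continuous f := continuous_of_tsupport fun x hx => hfc x (hsubG (hf hx))
    exact this.integrable_of_hasCompactSupport (hcs.mono' ((subset_tsupport _).trans hf))
  have i1 : ∀ i, Integrable (dd i (Z i)) := by
    intro i
    have hcd : Continuous (dd i (Z i)) :=
      ((hZ1 i).continuous_fderiv (by norm_num)).clm_apply continuous_const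
    exact hcd.integrable_of_hasCompactSupport ((hZc i).fderiv_apply (𝕜 := ℝ) _)
  have i2 : Integrable (fun x => w x * v x ^ 2) := by
    refine hcont ?_ fun x hx => ?_
    · refine (closure_mono ?_).trans hvt
      intro x hx hx0
      apply hx
      simp [hx0]
    · exact (hw.continuousAt (hG.mem_nhds hx)).mul (hv.continuous.continuousAt.pow 2)
  have i3 : Integrable (fun x => (Real.exp (Φ x) * lap u x) ^ 2) := by
    have hl : lap u = lapD u := funext fun x => lap_eq hu.contDiffAt
    refine hcont ?_ fun x hx => ?_
    · refine closure_minimal ?_ isClosed_closure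
      intro x hx
      by_contra h
      apply hx
      have : lap u x = 0 := by
        rw [hl]
        refine Finset.sum_eq_zero fun i _ => dd_zero_of_notMem fun h' => h ?_
        exact tsupport_fderiv_apply_subset ℝ _ h'
      simp [this]
    · have : Continuous (lapD u) := by
        unfold lapD
        exact continuous_finsetSum _ fun i _ =>
          ((dd_contDiff hu i).continuous_fderiv (by norm_num)).clm_apply continuous_const
      rw [hl]
      exact (((sm_diff hG hΦ hx).continuousAt.rexp).mul this.continuousAt).pow 2
  have hIntg := integral_mono ((integrable_finsetSum Finset.univ fun i _ => i1 i).add i2) i3 hpt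
  have e1 : ∫ x, (∑ i, dd i (Z i) x + w x * v x ^ 2) = ∫ x, w x * v x ^ 2 := by
    rw [integral_add (integrable_finsetSum Finset.univ fun i _ => i1 i) i2,
      integral_finsetSum _ fun i _ => i1 i]
    simp [integral_dd (hZ1 _) (hZc _)]
  rw [← e1]
  exact hIntg

lemma quad_bdd {K : Set EE} (hK : IsCompact K) {A : Fin n → Fin n → EE → ℝ}
    (hA : ∀ i j, ContinuousOn (A i j) K) :
    ∃ M, 0 ≤ M ∧ ∀ x ∈ K, ∀ ξ : Fin n → ℝ, |∑ i, ∑ j, A i j x * ξ i * ξ j| ≤ M * ∑ i, ξ i ^ 2 := by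
  choose B hB using fun i j => hK.exists_bound_of_continuousOn (hA i j)
  refine ⟨∑ i, ∑ j, |B i j|, Finset.sum_nonneg fun i _ => Finset.sum_nonneg fun j _ => abs_nonneg _,
    fun x hx ξ => ?_⟩
  rw [Finset.sum_mul]
  refine (Finset.abs_sum_le_sum_abs _ _).trans (Finset.sum_le_sum fun i _ => ?_)
  rw [Finset.sum_mul]
  refine (Finset.abs_sum_le_sum_abs _ _).trans (Finset.sum_le_sum fun j _ => ?_)
  rw [mul_assoc, abs_mul]
  have h1 : |A i j x| ≤ |B i j| := (hB i j x hx).trans (le_abs_self _)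
  have hi : ξ i ^ 2 ≤ ∑ i, ξ i ^ 2 :=
    Finset.single_le_sum (f := fun i => ξ i ^ 2) (fun i _ => sq_nonneg _) (Finset.mem_univ i)
  have hj : ξ j ^ 2 ≤ ∑ i, ξ i ^ 2 :=
    Finset.single_le_sum (f := fun i => ξ i ^ 2) (fun i _ => sq_nonneg _) (Finset.mem_univ j)
  have h2 : |ξ i * ξ j| ≤ ∑ i, ξ i ^ 2 := by
    rw [abs_le]; constructor <;> nlinarith [sq_nonneg (ξ i - ξ j), sq_nonneg (ξ i + ξ j)]
  exact mul_le_mul h1 h2 (abs_nonneg _) (abs_nonneg _)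

lemma dd_lin {G : Set EE} (hG : IsOpen G) {f g : EE → ℝ} (hf : ContDiffOn ℝ ∞ f G)
    (hg : ContDiffOn ℝ ∞ g G) (τ : ℝ) (i : Fin n) :
    ∀ x ∈ G, dd i (fun y => f y + τ * g y) x = dd i f x + τ * dd i g x := by
  intro x hx
  rw [dd_add (sm_diff hG hf hx) ((sm_diff hG hg hx).const_mul τ), dd_cmul _ (sm_diff hG hg hx)]

lemma dd2_lin {G : Set EE} (hG : IsOpen G) {f g : EE → ℝ} (hf : ContDiffOn ℝ ∞ f G)
    (hg : ContDiffOn ℝ ∞ g G) (τ : ℝ) (i j : Fin n) :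
    ∀ x ∈ G, dd i (dd j (fun y => f y + τ * g y)) x = dd i (dd j f) x + τ * dd i (dd j g) x := by
  intro x hx
  rw [dd_congrOn hG (dd_lin hG hf hg τ j) hx,
    dd_lin hG (dd_smooth hG hf j) (dd_smooth hG hg j) τ i x hx]

lemma lapD_lin {G : Set EE} (hG : IsOpen G) {f g : EE → ℝ} (hf : ContDiffOn ℝ ∞ f G)
    (hg : ContDiffOn ℝ ∞ g G) (τ : ℝ) :
    ∀ x ∈ G, lapD (fun y => f y + τ * g y) x = lapD f x + τ * lapD g x := by
  intro x hx
  unfold lapD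
  simp only [dd2_lin hG hf hg τ _ _ x hx, Finset.sum_add_distrib, Finset.mul_sum]

lemma dd_expc {G : Set EE} (hG : IsOpen G) {ψ : EE → ℝ} (hψ : ContDiffOn ℝ ∞ ψ G) (l : ℝ)
    (i : Fin n) : ∀ x ∈ G, dd i (fun y => Real.exp (l * ψ y)) x
      = Real.exp (l * ψ x) * (l * dd i ψ x) := by
  intro x hx
  have h := sm_diff hG hψ hx
  rw [dd_exp (h.const_mul l), dd_cmul _ h]

lemma dd2_expc {G : Set EE} (hG : IsOpen G) {ψ : EE → ℝ} (hψ : ContDiffOn ℝ ∞ ψ G) (l : ℝ)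
    (i j : Fin n) : ∀ x ∈ G, dd i (dd j (fun y => Real.exp (l * ψ y))) x
      = Real.exp (l * ψ x) * l * (dd i (dd j ψ) x + l * (dd i ψ x * dd j ψ x)) := by
  intro x hx
  have h := sm_diff hG hψ hx
  have h2 := sm_diff hG (dd_smooth hG hψ j) hx
  rw [dd_congrOn hG (dd_expc hG hψ l j) hx, dd_mul (h.const_mul l).exp (h2.const_mul l),
    dd_exp (h.const_mul l), dd_cmul _ h, dd_cmul _ h2]
  ring

/-- Choice of the parameters on the compact cross-section. -/
lemma weight_compact {G K : Set EE} (hG : IsOpen G) (hK : IsCompact K) (hKG : K ⊆ G)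
    (hK1 : ∀ x ∈ K, ‖x‖ = 1) (h0 : (0 : EE) ∉ G) {L ψ : EE → ℝ} (hL : ContDiffOn ℝ ∞ L G)
    (hψ : ContDiffOn ℝ ∞ ψ G) (hd : ∀ x ∈ K, ∃ i, dd i ψ x ≠ 0) :
    ∃ l τ a b c : ℝ, 0 < τ ∧ 0 < l ∧ 0 < c ∧
      ∀ Φ k : EE → ℝ, (Φ = fun x => L x + τ * Real.exp (l * ψ x)) →
      (k = fun x => lapD Φ x + (a + b * Real.exp (l * ψ x)) * (‖x‖ ^ 2)⁻¹) → ∀ x ∈ K,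
      (∀ ξ : Fin n → ℝ, 0 ≤ 4 * ∑ i, ∑ j, dd i (dd j Φ) x * ξ i * ξ j
        + 2 * (k x - lapD Φ x) * ∑ i, ξ i ^ 2) ∧
      c ≤ 4 * ∑ i, ∑ j, dd i (dd j Φ) x * dd i Φ x * dd j Φ x
        - 2 * (k x - lapD Φ x) * ∑ i, dd i Φ x ^ 2 - lapD k x - (k x - lapD Φ x) ^ 2 := by
  obtain ⟨M0, hM0, hM0'⟩ := quad_bdd hK (A := fun i j => dd i (dd j L))
    fun i j => (dd_smooth hG (dd_smooth hG hL j) i).continuousOn.mono hKG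
  obtain ⟨M, hM, hM'⟩ := quad_bdd hK (A := fun i j => dd i (dd j ψ))
    fun i j => (dd_smooth hG (dd_smooth hG hψ j) i).continuousOn.mono hKG
  have hgc : ContinuousOn (fun x => ∑ i, dd i ψ x ^ 2) K :=
    continuousOn_finsetSum _ fun i _ => ((dd_smooth hG hψ i).continuousOn.mono hKG).pow 2
  have hgpos : ∀ x ∈ K, 0 < ∑ i, dd i ψ x ^ 2 := by
    intro x hx
    obtain ⟨i, hi⟩ := hd x hx
    exact Finset.sum_pos' (fun i _ => sq_nonneg _) ⟨i, Finset.mem_univ i, by positivity⟩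
  obtain ⟨g0, hg0, hg⟩ := hK.exists_forall_le' hgc hgpos
  set l := (2 * M + 1) / g0 with hl
  have hlpos : 0 < l := by positivity
  set e : EE → ℝ := fun x => Real.exp (l * ψ x) with he
  have hes : ContDiffOn ℝ ∞ e G := (contDiffOn_const.mul hψ).exp
  have hnorm : ContDiffOn ℝ ∞ (fun x : EE => (‖x‖ ^ 2)⁻¹) G := by
    refine ContDiffOn.inv (contDiff_norm_sq ℝ).contDiffOn fun x hx => ?_
    have : x ≠ 0 := fun h => h0 (h ▸ hx)
    positivity
  set q0 : EE → ℝ := fun x => 2 * M0 * (‖x‖ ^ 2)⁻¹ with hq0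
  set q1 : EE → ℝ := fun x => 2 * l * M * e x * (‖x‖ ^ 2)⁻¹ with hq1
  have hq0s : ContDiffOn ℝ ∞ q0 G := contDiffOn_const.mul hnorm
  have hq1s : ContDiffOn ℝ ∞ q1 G := (contDiffOn_const.mul hes).mul hnorm
  set k0 : EE → ℝ := fun x => lapD L x + q0 x with hk0
  set k1 : EE → ℝ := fun x => lapD e x + q1 x with hk1
  have hk0s : ContDiffOn ℝ ∞ k0 G := (lapD_smooth hG hL).add hq0s
  have hk1s : ContDiffOn ℝ ∞ k1 G := (lapD_smooth hG hes).add hq1s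
  set F : ℝ → EE → ℝ := fun s x =>
    4 * ∑ i, ∑ j, (s * dd i (dd j L) x + dd i (dd j e) x) * (s * dd i L x + dd i e x)
      * (s * dd j L x + dd j e x) - 2 * (s * q0 x + q1 x) * ∑ i, (s * dd i L x + dd i e x) ^ 2
      - s ^ 2 * (s * lapD k0 x + lapD k1 x) - s * (s * q0 x + q1 x) ^ 2 with hF
  have hFc : ∀ s, ∀ x ∈ G, ContinuousAt (fun z : ℝ × EE => F z.1 z.2) (s, x) := by
    intro s x hx
    have cc : ∀ {f : EE → ℝ}, ContDiffOn ℝ ∞ f G →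
        ContinuousAt (fun z : ℝ × EE => f z.2) (s, x) := fun hf =>
      ContinuousAt.comp' (f := fun z : ℝ × EE => z.2) (x := (s, x))
        (hf.continuousOn.continuousAt (hG.mem_nhds hx)) continuousAt_snd
    have cs : ContinuousAt (fun z : ℝ × EE => z.1) (s, x) := continuousAt_fst
    have c1 : ∀ i, ContinuousAt (fun z : ℝ × EE => z.1 * dd i L z.2 + dd i e z.2) (s, x) :=
      fun i => (cs.mul (cc (dd_smooth hG hL i))).add (cc (dd_smooth hG hes i))
    have c2 : ∀ i j, ContinuousAt (fun z : ℝ × EE => z.1 * dd i (dd j L) z.2 + dd i (dd j e) z.2)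
        (s, x) := fun i j => (cs.mul (cc (dd_smooth hG (dd_smooth hG hL j) i))).add
          (cc (dd_smooth hG (dd_smooth hG hes j) i))
    have c3 : ContinuousAt (fun z : ℝ × EE => z.1 * q0 z.2 + q1 z.2) (s, x) :=
      (cs.mul (cc hq0s)).add (cc hq1s)
    have c4 : ContinuousAt (fun z : ℝ × EE => z.1 * lapD k0 z.2 + lapD k1 z.2) (s, x) :=
      (cs.mul (cc (lapD_smooth hG hk0s))).add (cc (lapD_smooth hG hk1s))
    have c5 : ContinuousAt (fun z : ℝ × EE => ∑ i, ∑ j,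
        (z.1 * dd i (dd j L) z.2 + dd i (dd j e) z.2) * (z.1 * dd i L z.2 + dd i e z.2)
        * (z.1 * dd j L z.2 + dd j e z.2)) (s, x) :=
      tendsto_finsetSum _ fun i _ => tendsto_finsetSum _ fun j _ => ((c2 i j).mul (c1 i)).mul (c1 j)
    have c6 : ContinuousAt (fun z : ℝ × EE => ∑ i, (z.1 * dd i L z.2 + dd i e z.2) ^ 2) (s, x) :=
      tendsto_finsetSum _ fun i _ => (c1 i).pow 2
    exact (((c5.const_mul 4).sub ((c3.const_mul 2).mul c6)).sub ((cs.pow 2).mul c4)).sub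
      (cs.mul (c3.pow 2))
  have hquad1 : ∀ x ∈ K, ∀ ξ : Fin n → ℝ, ∑ i, ∑ j, dd i (dd j e) x * ξ i * ξ j
      = e x * l * (∑ i, ∑ j, dd i (dd j ψ) x * ξ i * ξ j + l * (∑ i, dd i ψ x * ξ i) ^ 2) := by
    intro x hx ξ
    have : ∀ i j, dd i (dd j e) x = e x * l * (dd i (dd j ψ) x + l * (dd i ψ x * dd j ψ x)) :=
      fun i j => dd2_expc hG hψ l i j x (hKG hx)
    simp only [this]
    rw [pow_two, Finset.sum_mul_sum]
    simp only [Finset.mul_sum, ← Finset.sum_add_distrib]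
    exact Finset.sum_congr rfl fun i _ => Finset.sum_congr rfl fun j _ => by ring
  have hF0 : ∀ x ∈ K, 0 < F 0 x := by
    intro x hx
    have hde : ∀ i, dd i e x = e x * (l * dd i ψ x) := fun i => dd_expc hG hψ l i x (hKG hx)
    have hep : 0 < e x := Real.exp_pos _
    have hq1x : q1 x = 2 * l * M * e x := by simp [hq1, hK1 x hx]
    simp only [hF, zero_mul, zero_add, ne_eq, OfNat.ofNat_ne_zero, not_false_eq_true, zero_pow,
      sub_zero]
    rw [hquad1 x hx, hq1x]
    set g := ∑ i, dd i ψ x ^ 2 with hgdef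
    have hgx : g0 ≤ g := hg x hx
    have r1 : ∑ i, dd i e x ^ 2 = (e x * l) ^ 2 * g := by
      rw [hgdef, Finset.mul_sum]
      exact Finset.sum_congr rfl fun i _ => by rw [hde]; ring
    have r2 : ∑ i, dd i ψ x * dd i e x = e x * l * g := by
      rw [hgdef, Finset.mul_sum]
      exact Finset.sum_congr rfl fun i _ => by rw [hde]; ring
    have r3 := (abs_le.1 (hM' x hx fun i => dd i e x)).1
    rw [r1] at r3 ⊢
    rw [r2]
    have hgp : 0 < g := hg0.trans_le hgx
    have hlg : 2 * M + 1 ≤ l * g := by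
      have : l * g0 = 2 * M + 1 := by rw [hl]; field_simp
      nlinarith
    have hel : 0 < e x * l := mul_pos hep hlpos
    set Q := ∑ i, ∑ j, dd i (dd j ψ) x * dd i e x * dd j e x with hQ
    have s1 : 0 < (e x * l) ^ 3 * g := by positivity
    have s2 : 4 * ((e x * l) ^ 3 * g) * 1 ≤ 4 * ((e x * l) ^ 3 * g) * (l * g - 2 * M) :=
      mul_le_mul_of_nonneg_left (by linarith) (by positivity)
    have s3 := mul_le_mul_of_nonneg_left r3 hel.le
    nlinarith
  have hev : ∀ᶠ s in 𝓝 (0 : ℝ), ∀ x ∈ K, 0 < F s x :=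
    hK.eventually_forall_of_forall_eventually fun x hx =>
      (hFc 0 x (hKG hx)).eventually (lt_mem_nhds (hF0 x hx))
  have hev2 : ∀ᶠ s in 𝓝[>] (0 : ℝ), (∀ x ∈ K, 0 < F s x) ∧ 0 < s :=
    (hev.filter_mono nhdsWithin_le_nhds).and self_mem_nhdsWithin
  obtain ⟨s, hsF, hs⟩ := hev2.exists
  have hFsc : ContinuousOn (F s) K := fun x hx => by
    have h1 : ContinuousAt (fun y : EE => (s, y)) x := by fun_prop
    exact (ContinuousAt.comp (f := fun y : EE => (s, y)) (hFc s x (hKG hx)) h1).continuousWithinAt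
  obtain ⟨c, hc, hcF⟩ := hK.exists_forall_le' hFsc hsF
  refine ⟨l, s⁻¹, 2 * M0, s⁻¹ * (2 * l * M), s⁻¹ ^ 3 * c, by positivity, hlpos, by positivity, ?_⟩
  set τ := s⁻¹ with hτ
  have hτp : 0 < τ := by positivity
  have hsτ : s = τ⁻¹ := by rw [hτ, inv_inv]
  intro Φ k hΦ hk x hx
  have hxG := hKG hx
  have hΦ1 : ∀ i, dd i Φ x = dd i L x + τ * dd i e x := by
    intro i; rw [hΦ]; exact dd_lin hG hL hes τ i x hxG
  have hΦ2 : ∀ i j, dd i (dd j Φ) x = dd i (dd j L) x + τ * dd i (dd j e) x := by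
    intro i j; rw [hΦ]; exact dd2_lin hG hL hes τ i j x hxG
  have hkk : ∀ y ∈ G, k y = k0 y + τ * k1 y := by
    intro y hy
    have := lapD_lin hG hL hes τ y hy
    rw [hk]
    simp only [hΦ, hk0, hk1, hq0, hq1]
    rw [this]; simp only [he]; ring
  have hk2 : lapD k x = lapD k0 x + τ * lapD k1 x := by
    rw [← lapD_lin hG hk0s hk1s τ x hxG]
    unfold lapD
    refine Finset.sum_congr rfl fun i _ => ?_
    exact dd_congrOn hG (fun y hy => dd_congrOn hG hkk hy) hxG
  have hq : k x - lapD Φ x = q0 x + τ * q1 x := by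
    rw [hk]; simp only [hq0, hq1, he]; ring
  have hep : 0 < e x := Real.exp_pos _
  have hq1x : q1 x = 2 * l * M * e x := by simp [hq1, hK1 x hx]
  have hq0x : q0 x = 2 * M0 := by simp [hq0, hK1 x hx]
  constructor
  · intro ξ
    have t1 : ∑ i, ∑ j, dd i (dd j Φ) x * ξ i * ξ j = ∑ i, ∑ j, dd i (dd j L) x * ξ i * ξ j
        + τ * ∑ i, ∑ j, dd i (dd j e) x * ξ i * ξ j := by
      simp only [hΦ2, Finset.mul_sum, ← Finset.sum_add_distrib]
      exact Finset.sum_congr rfl fun i _ => Finset.sum_congr rfl fun j _ => by ring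
    rw [t1, hq, hquad1 x hx, hq1x, hq0x]
    have r3 := (abs_le.1 (hM' x hx ξ)).1
    have r4 := (abs_le.1 (hM0' x hx ξ)).1
    have u1 : 0 ≤ τ * (e x * l) := by positivity
    have u2 := mul_le_mul_of_nonneg_left r3 u1
    have u3 : 0 ≤ τ * (e x * l) * (l * (∑ i, dd i ψ x * ξ i) ^ 2) := by positivity
    nlinarith
  · have hfx := hcF x hx
    have t2 : τ ^ 3 * F s x = 4 * ∑ i, ∑ j, dd i (dd j Φ) x * dd i Φ x * dd j Φ x
        - 2 * (k x - lapD Φ x) * ∑ i, dd i Φ x ^ 2 - lapD k x - (k x - lapD Φ x) ^ 2 := by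
      rw [hq, hk2]
      have v1 : ∀ a b : ℝ, a + τ * b = τ * (s * a + b) := by
        intro a b; rw [hsτ]; field_simp
      have v2 : ∑ i, ∑ j, dd i (dd j Φ) x * dd i Φ x * dd j Φ x = τ ^ 3 * ∑ i, ∑ j,
          (s * dd i (dd j L) x + dd i (dd j e) x) * (s * dd i L x + dd i e x)
          * (s * dd j L x + dd j e x) := by
        simp only [Finset.mul_sum]
        refine Finset.sum_congr rfl fun i _ => Finset.sum_congr rfl fun j _ => ?_
        rw [hΦ1, hΦ1, hΦ2, v1, v1, v1]; ring
      have v3 : ∑ i, dd i Φ x ^ 2 = τ ^ 2 * ∑ i, (s * dd i L x + dd i e x) ^ 2 := by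
        simp only [Finset.mul_sum]
        refine Finset.sum_congr rfl fun i _ => ?_
        rw [hΦ1, v1]; ring
      rw [v2, v3, v1 (q0 x), v1 (lapD k0 x)]
      simp only [hF]
      have v4 : τ * s = 1 := by rw [hsτ]; field_simp
      linear_combination (-(τ * s + 1) * τ * (s * lapD k0 x + lapD k1 x)
        - τ ^ 2 * (s * q0 x + q1 x) ^ 2) * v4
    rw [← t2]
    exact mul_le_mul_of_nonneg_left hfx (by positivity)


lemma hom_ext {G : Set EE} (hG : IsOpen G) {Φ k : EE → ℝ} (hΦ : ContDiffOn ℝ ∞ Φ G)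
    (hk : ContDiffOn ℝ ∞ k G) {cc : ℝ → ℝ}
    (hΦh : ∀ t : ℝ, 0 < t → ∀ x ∈ G, Φ (t • x) = Φ x + cc t)
    {m : EE → ℝ} (hkm : ∀ x, k x = lapD Φ x + m x)
    (hm : ∀ t : ℝ, 0 < t → ∀ x ∈ G, m (t • x) = t⁻¹ ^ 2 * m x) {t : ℝ} (ht : 0 < t)
    {y : EE} (hy : y ∈ G) {c : ℝ}
    (h1 : ∀ ξ : Fin n → ℝ, 0 ≤ 4 * ∑ i, ∑ j, dd i (dd j Φ) y * ξ i * ξ j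
        + 2 * (k y - lapD Φ y) * ∑ i, ξ i ^ 2)
    (h2 : c ≤ 4 * ∑ i, ∑ j, dd i (dd j Φ) y * dd i Φ y * dd j Φ y
        - 2 * (k y - lapD Φ y) * ∑ i, dd i Φ y ^ 2 - lapD k y - (k y - lapD Φ y) ^ 2) :
    (∀ ξ : Fin n → ℝ, 0 ≤ 4 * ∑ i, ∑ j, dd i (dd j Φ) (t • y) * ξ i * ξ j
        + 2 * (k (t • y) - lapD Φ (t • y)) * ∑ i, ξ i ^ 2) ∧
    c * t⁻¹ ^ 4 ≤ 4 * ∑ i, ∑ j, dd i (dd j Φ) (t • y) * dd i Φ (t • y) * dd j Φ (t • y)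
        - 2 * (k (t • y) - lapD Φ (t • y)) * ∑ i, dd i Φ (t • y) ^ 2 - lapD k (t • y)
        - (k (t • y) - lapD Φ (t • y)) ^ 2 := by
  have a1 : ∀ i, ∀ t : ℝ, 0 < t → ∀ x ∈ G, dd i Φ (t • x) = t ^ (-1 : ℤ) * dd i Φ x := by
    intro i
    have := dd_hom (d := 0) (c := cc) hG hΦ (by simpa using hΦh) i
    simpa using this
  have a2 : ∀ i j, ∀ t : ℝ, 0 < t → ∀ x ∈ G,
      dd i (dd j Φ) (t • x) = t ^ (-2 : ℤ) * dd i (dd j Φ) x := by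
    intro i j
    have := dd_hom (d := -1) (c := fun _ => 0) hG (dd_smooth hG hΦ j) (by simpa using a1 j) i
    norm_num at this
    exact this
  have a3 : ∀ t : ℝ, 0 < t → ∀ x ∈ G, lapD Φ (t • x) = t ^ (-2 : ℤ) * lapD Φ x := by
    intro t ht x hx
    simp only [lapD, Finset.mul_sum]
    exact Finset.sum_congr rfl fun i _ => a2 i i t ht x hx
  have a4 : ∀ t : ℝ, 0 < t → ∀ x ∈ G, k (t • x) = t ^ (-2 : ℤ) * k x := by
    intro t ht x hx
    rw [hkm, hkm, a3 t ht x hx, hm t ht x hx, zpow_neg, inv_pow]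
    norm_cast
    ring
  have a5 : ∀ i, ∀ t : ℝ, 0 < t → ∀ x ∈ G, dd i k (t • x) = t ^ (-3 : ℤ) * dd i k x := by
    intro i
    have := dd_hom (d := -2) (c := fun _ => 0) hG hk (by simpa using a4) i
    norm_num at this
    exact this
  have a6 : ∀ i, ∀ t : ℝ, 0 < t → ∀ x ∈ G,
      dd i (dd i k) (t • x) = t ^ (-4 : ℤ) * dd i (dd i k) x := by
    intro i
    have := dd_hom (d := -3) (c := fun _ => 0) hG (dd_smooth hG hk i) (by simpa using a5 i) i
    norm_num at this
    exact this
  have z1 : t ^ (-1 : ℤ) = t⁻¹ := by simp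
  have z2 : t ^ (-2 : ℤ) = t⁻¹ ^ 2 := by rw [zpow_neg, inv_pow]; norm_cast
  have z4 : t ^ (-4 : ℤ) = t⁻¹ ^ 4 := by rw [zpow_neg, inv_pow]; norm_cast
  have b1 : ∀ i, dd i Φ (t • y) = t⁻¹ * dd i Φ y := fun i => by rw [a1 i t ht y hy, z1]
  have b2 : ∀ i j, dd i (dd j Φ) (t • y) = t⁻¹ ^ 2 * dd i (dd j Φ) y :=
    fun i j => by rw [a2 i j t ht y hy, z2]
  have b3 : lapD Φ (t • y) = t⁻¹ ^ 2 * lapD Φ y := by rw [a3 t ht y hy, z2]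
  have b4 : k (t • y) = t⁻¹ ^ 2 * k y := by rw [a4 t ht y hy, z2]
  have b6 : lapD k (t • y) = t⁻¹ ^ 4 * lapD k y := by
    simp only [lapD, Finset.mul_sum]
    exact Finset.sum_congr rfl fun i _ => by rw [a6 i t ht y hy, z4]
  have hs : 0 ≤ t⁻¹ := by positivity
  generalize t⁻¹ = s at *
  constructor
  · intro ξ
    have e1 : ∑ i, ∑ j, dd i (dd j Φ) (t • y) * ξ i * ξ j
        = s ^ 2 * ∑ i, ∑ j, dd i (dd j Φ) y * ξ i * ξ j := by
      simp only [Finset.mul_sum]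
      refine Finset.sum_congr rfl fun i _ => Finset.sum_congr rfl fun j _ => ?_
      rw [b2]; ring
    rw [e1, b3, b4]
    have := mul_nonneg (pow_nonneg hs 2) (h1 ξ)
    linarith
  · have e1 : ∑ i, ∑ j, dd i (dd j Φ) (t • y) * dd i Φ (t • y) * dd j Φ (t • y)
        = s ^ 4 * ∑ i, ∑ j, dd i (dd j Φ) y * dd i Φ y * dd j Φ y := by
      simp only [Finset.mul_sum]
      refine Finset.sum_congr rfl fun i _ => Finset.sum_congr rfl fun j _ => ?_
      rw [b2, b1, b1]; ring
    have e2 : ∑ i, dd i Φ (t • y) ^ 2 = s ^ 2 * ∑ i, dd i Φ y ^ 2 := by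
      simp only [Finset.mul_sum]
      refine Finset.sum_congr rfl fun i _ => ?_
      rw [b1]; ring
    rw [e1, e2, b3, b4, b6]
    have := mul_le_mul_of_nonneg_left h2 (pow_nonneg hs 4)
    linarith

/-- Weighted inequality for cones admitting a nondegenerate 0-homogeneous function. -/
lemma rellich_of_weight {G K : Set EE} (hG : IsOpen G)
    (hGc : ∀ t : ℝ, 0 < t → ∀ x ∈ G, t • x ∈ G) (hK : IsCompact K) (hKG : K ⊆ G)
    (hK1 : ∀ x ∈ K, ‖x‖ = 1) (h0 : (0 : EE) ∉ G) {ψ : EE → ℝ}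
    (hψ : ContDiffOn ℝ ∞ ψ G) (hψh : ∀ t : ℝ, 0 < t → ∀ x ∈ G, ψ (t • x) = ψ x)
    (hd : ∀ x ∈ K, ∃ i, dd i ψ x ≠ 0) (α : ℝ) :
    ∃ C > 0, ∀ u : EE → ℝ, ContDiff ℝ 2 u → HasCompactSupport u → tsupport u ⊆ coneOf K →
      C * (∫ x, ‖x‖ ^ (α - 4) * (u x) ^ 2) ≤ ∫ x, ‖x‖ ^ α * (lap u x) ^ 2 := by
  have hne : ∀ x ∈ G, x ≠ 0 := fun x hx h => h0 (h ▸ hx)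
  have hL : ContDiffOn ℝ ∞ (fun x : EE => α / 2 * Real.log ‖x‖) G := by
    refine contDiffOn_const.mul (ContDiffOn.log ?_ fun x hx => norm_ne_zero_iff.2 (hne x hx))
    exact contDiffOn_id.norm ℝ hne
  obtain ⟨l, τ, a, b, c, hτ, hl, hc, H⟩ := weight_compact hG hK hKG hK1 h0 hL hψ hd
  set Φ : EE → ℝ := fun x => α / 2 * Real.log ‖x‖ + τ * Real.exp (l * ψ x) with hΦd
  set k : EE → ℝ := fun x => lapD Φ x + (a + b * Real.exp (l * ψ x)) * (‖x‖ ^ 2)⁻¹ with hkd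
  have H' := H Φ k rfl rfl
  have hexp : ContDiffOn ℝ ∞ (fun x => Real.exp (l * ψ x)) G := (contDiffOn_const.mul hψ).exp
  have hΦ : ContDiffOn ℝ ∞ Φ G := hL.add (contDiffOn_const.mul hexp)
  have hk : ContDiffOn ℝ ∞ k G := by
    refine (lapD_smooth hG hΦ).add ((contDiffOn_const.add (contDiffOn_const.mul hexp)).mul ?_)
    refine ContDiffOn.inv ((contDiffOn_id.norm ℝ hne).pow 2) fun x hx => ?_
    exact pow_ne_zero 2 (norm_ne_zero_iff.2 (hne x hx))
  have hCy : ∀ x ∈ coneOf K, 0 < ‖x‖ ∧ ‖x‖⁻¹ • x ∈ K ∧ ‖x‖ • (‖x‖⁻¹ • x) = x := by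
    intro x hx
    have h := norm_pos_iff.2 hx.1
    exact ⟨h, hx.2, by rw [smul_smul, mul_inv_cancel₀ h.ne', one_smul]⟩
  have hCG : coneOf K ⊆ G := by
    intro x hx
    obtain ⟨h, h', h''⟩ := hCy x hx
    rw [← h'']
    exact hGc _ h _ (hKG h')
  have key : ∀ x ∈ coneOf K, (∀ ξ : Fin n → ℝ, 0 ≤ 4 * ∑ i, ∑ j, dd i (dd j Φ) x * ξ i * ξ j
        + 2 * (k x - lapD Φ x) * ∑ i, ξ i ^ 2) ∧
      c * ‖x‖⁻¹ ^ 4 ≤ 4 * ∑ i, ∑ j, dd i (dd j Φ) x * dd i Φ x * dd j Φ x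
        - 2 * (k x - lapD Φ x) * ∑ i, dd i Φ x ^ 2 - lapD k x - (k x - lapD Φ x) ^ 2 := by
    intro x hx
    obtain ⟨h, h', h''⟩ := hCy x hx
    obtain ⟨p1, p2⟩ := H' _ h'
    have := hom_ext hG hΦ hk (cc := fun t => α / 2 * Real.log t)
      (m := fun x => (a + b * Real.exp (l * ψ x)) * (‖x‖ ^ 2)⁻¹) ?_ (fun x => rfl) ?_ h (hKG h') p1 p2
    · rwa [h''] at this
    · intro t ht y hy
      simp only [hΦd]
      rw [hψh t ht y hy, norm_smul, Real.norm_of_nonneg ht.le,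
        Real.log_mul ht.ne' (norm_ne_zero_iff.2 (hne y hy))]
      ring
    · intro t ht y hy
      have := norm_ne_zero_iff.2 (hne y hy)
      simp only [hψh t ht y hy, norm_smul, Real.norm_of_nonneg ht.le]
      field_simp
  obtain ⟨R, hR⟩ := hK.exists_bound_of_continuousOn (hψ.continuousOn.mono hKG)
  have hψR : ∀ x ∈ coneOf K, ψ x ≤ R := by
    intro x hx
    obtain ⟨h, h', h''⟩ := hCy x hx
    rw [← h'', hψh _ h _ (hKG h')]
    exact (le_abs_self _).trans (hR _ h')
  set D := Real.exp (2 * (τ * Real.exp (l * R))) with hD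
  have hDp : 0 < D := Real.exp_pos _
  refine ⟨c / D, by positivity, fun u hu hcs hsub => ?_⟩
  have hw : ContinuousOn (fun x : EE => c * ‖x‖⁻¹ ^ 4) G := by
    refine continuousOn_const.mul (ContinuousOn.pow (ContinuousOn.inv₀ continuous_norm.continuousOn
      fun x hx => norm_ne_zero_iff.2 (hne x hx)) 4)
  have carl := carleman hG hCG hΦ hk hw (fun x hx => (key x hx).1) (fun x hx => (key x hx).2)
    hu hcs hsub
  have hlc : Continuous (lap u) := by
    have : lap u = lapD u := funext fun x => lap_eq hu.contDiffAt
    rw [this]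
    unfold lapD
    refine continuous_finsetSum _ fun i _ => ?_
    exact ((dd_contDiff hu i).continuous_fderiv (by norm_num)).clm_apply continuous_const
  have hl0 : ∀ x, x ∉ tsupport u → lap u x = 0 := by
    intro x hx
    rw [lap_eq hu.contDiffAt]
    refine Finset.sum_eq_zero fun i _ => dd_zero_of_notMem fun h => hx ?_
    have : tsupport (dd i u) ⊆ tsupport u := by
      refine closure_minimal (fun y hy => ?_) (isClosed_tsupport u)
      by_contra hcon
      exact hy (dd_zero_of_notMem hcon)
    exact this h
  have hu0 : ∀ x, x ∉ tsupport u → u x = 0 := fun x hx => image_eq_zero_of_notMem_tsupport hx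
  have eΦ : ∀ x ∈ coneOf K, Real.exp (Φ x) ^ 2
      = ‖x‖ ^ α * Real.exp (2 * (τ * Real.exp (l * ψ x))) := by
    intro x hx
    obtain ⟨h, -, -⟩ := hCy x hx
    rw [Real.rpow_def_of_pos h, ← Real.exp_add, ← Real.exp_nat_mul]
    congr 1
    simp only [hΦd]; push_cast; ring
  have hge : ∀ x, 1 ≤ Real.exp (2 * (τ * Real.exp (l * ψ x))) := fun x =>
    Real.one_le_exp (by positivity)
  have hle : ∀ x ∈ coneOf K, Real.exp (2 * (τ * Real.exp (l * ψ x))) ≤ D := by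
    intro x hx
    have := hψR x hx
    rw [hD]
    gcongr
  -- pointwise comparison
  have q1 : ∀ x, c * (‖x‖ ^ (α - 4) * u x ^ 2) ≤ c * ‖x‖⁻¹ ^ 4 * (Real.exp (Φ x) * u x) ^ 2 := by
    intro x
    by_cases hx : x ∈ tsupport u
    · have hx' := hsub hx
      obtain ⟨h, -, -⟩ := hCy x hx'
      rw [mul_pow, eΦ x hx', Real.rpow_sub h, inv_pow]
      have e4 : ‖x‖ ^ (4 : ℝ) = ‖x‖ ^ 4 := by norm_cast
      rw [e4, div_eq_mul_inv]
      have : 0 ≤ c * (‖x‖ ^ α * (‖x‖ ^ 4)⁻¹ * u x ^ 2) := by positivity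
      nlinarith [mul_le_mul_of_nonneg_left (hge x) this]
    · simp [hu0 x hx]
  have q2 : ∀ x, (Real.exp (Φ x) * lap u x) ^ 2 ≤ D * (‖x‖ ^ α * lap u x ^ 2) := by
    intro x
    by_cases hx : x ∈ tsupport u
    · have hx' := hsub hx
      rw [mul_pow, eΦ x hx']
      have : 0 ≤ ‖x‖ ^ α * lap u x ^ 2 := by positivity
      nlinarith [mul_le_mul_of_nonneg_left (hle x hx') this]
    · simp [hl0 x hx]
  have hIntg : ∀ f g : EE → ℝ, ContinuousOn f G → Continuous g → (∀ x, x ∉ tsupport u → g x = 0) →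
      Integrable (fun x => f x * g x ^ 2) := by
    intro f g hf hg hg0
    have hts : tsupport (fun x => f x * g x ^ 2) ⊆ tsupport u := by
      refine closure_minimal (fun y hy => ?_) (isClosed_tsupport u)
      by_contra hcon
      exact hy (by simp [hg0 y hcon])
    refine Continuous.integrable_of_hasCompactSupport ?_ ?_
    · rw [continuous_iff_continuousAt]
      intro x
      by_cases hx : x ∈ tsupport u
      · exact (hf.continuousAt (hG.mem_nhds (hCG (hsub hx)))).mul (hg.continuousAt.pow 2)
      · have : (fun x => f x * g x ^ 2) =ᶠ[𝓝 x] fun _ => 0 := by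
          filter_upwards [(isClosed_tsupport u).isOpen_compl.mem_nhds hx] with y hy
          simp [hg0 y hy]
        exact this.continuousAt
    · exact hcs.of_isClosed_subset (isClosed_tsupport _) hts
  have hnorm : ∀ β : ℝ, ContinuousOn (fun x : EE => ‖x‖ ^ β) G := fun β =>
    continuous_norm.continuousOn.rpow_const fun x hx => Or.inl (norm_ne_zero_iff.2 (hne x hx))
  have hE : ContinuousOn (fun x : EE => Real.exp (Φ x) ^ 2) G := hΦ.continuousOn.rexp.pow 2
  have i1 := integral_mono ((hIntg _ _ (hnorm (α - 4)) hu.continuous hu0).const_mul c)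
    (by
      have := hIntg _ _ (hw.mul hE) hu.continuous hu0
      refine this.congr (Filter.Eventually.of_forall fun x => ?_)
      simp only [Pi.mul_apply]; ring) q1
  have i2 := integral_mono
    (by
      have := hIntg _ _ hE hlc hl0
      refine this.congr (Filter.Eventually.of_forall fun x => ?_)
      simp only []; ring)
    ((hIntg _ _ (hnorm α) hlc hl0).const_mul D) q2
  rw [integral_const_mul] at i1 i2
  have := (i1.trans carl).trans i2
  rw [div_mul_eq_mul_div, div_le_iff₀ hDp]
  linarith

lemma exists_dd_ne {f : EE → ℝ} {x w : EE} (h : fderiv ℝ f x w ≠ 0) : ∃ i, dd i f x ≠ 0 := by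
  by_contra hcon
  push Not at hcon
  apply h
  have hw : w = ∑ i, w i • EuclideanSpace.single i (1 : ℝ) := by
    ext j
    simp [Finset.sum_apply, Pi.single_apply]
  rw [hw, map_sum]
  refine Finset.sum_eq_zero fun i _ => ?_
  rw [map_smul]
  have := hcon i
  unfold dd at this
  rw [this, smul_zero]

lemma exists_perp (hn : 2 ≤ n) (p : EE) : ∃ e : EE, ‖e‖ = 1 ∧ ⟪e, p⟫ = 0 := by
  have h1 : (ℝ ∙ p)ᗮ ≠ ⊥ := by
    intro h
    rw [Submodule.orthogonal_eq_bot_iff] at h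
    have h2 := finrank_span_le_card (R := ℝ) ({p} : Set EE)
    rw [h, finrank_top, finrank_euclideanSpace_fin] at h2
    simp at h2
    omega
  obtain ⟨v, hv, hv0⟩ := Submodule.exists_mem_ne_zero_of_ne_bot h1
  refine ⟨‖v‖⁻¹ • v, ?_, ?_⟩
  · rw [norm_smul, norm_inv, norm_norm, inv_mul_cancel₀ (norm_ne_zero_iff.2 hv0)]
  · rw [Submodule.mem_orthogonal_singleton_iff_inner_left] at hv
    rw [inner_smul_left, hv, mul_zero]

lemma rellich_missing_point (hn : 2 ≤ n) {K : Set EE} (hK : IsCompact K)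
    (hK1 : ∀ x ∈ K, ‖x‖ = 1) {p : EE} (hp : ‖p‖ = 1) (hpK : p ∉ K) (α : ℝ) :
    ∃ C > 0, ∀ u : EE → ℝ, ContDiff ℝ 2 u → HasCompactSupport u → tsupport u ⊆ coneOf K →
      C * (∫ x, ‖x‖ ^ (α - 4) * (u x) ^ 2) ≤ ∫ x, ‖x‖ ^ α * (lap u x) ^ 2 := by
  obtain ⟨e, he, hep⟩ := exists_perp hn p
  set G : Set EE := {x | ⟪p, x⟫ < ‖x‖} with hGd
  have hG : IsOpen G := isOpen_lt (by fun_prop) (by fun_prop)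
  have h0 : (0 : EE) ∉ G := by simp [hGd]
  have hne : ∀ x ∈ G, x ≠ 0 := fun x hx h => h0 (h ▸ hx)
  have hden : ∀ x ∈ G, ‖x‖ - ⟪p, x⟫ ≠ 0 := fun x hx => (sub_pos.2 hx).ne'
  have hns : ContDiffOn ℝ ∞ (fun x : EE => ‖x‖) G := contDiffOn_id.norm ℝ hne
  have hKG : K ⊆ G := by
    intro x hx
    have h1 := hK1 x hx
    rcases lt_or_eq_of_le (real_inner_le_norm p x) with h | h
    · simpa [hGd, hp] using h
    · exfalso
      rw [hp, h1, one_mul] at h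
      have := (inner_eq_one_iff_of_norm_eq_one (𝕜 := ℝ) hp h1).1 h
      exact hpK (this ▸ hx)
  refine rellich_of_weight (G := G) (K := K) (ψ := fun x => ⟪e, x⟫ / (‖x‖ - ⟪p, x⟫)) hG ?_ hK hKG hK1
    h0 ?_ ?_ ?_ α
  · intro t ht x hx
    simp only [hGd, mem_ofPred_eq, inner_smul_right, norm_smul, Real.norm_of_nonneg ht.le]
    exact mul_lt_mul_of_pos_left hx ht
  · refine ContDiffOn.div ?_ (hns.sub ?_) hden
    · exact (contDiff_const.inner ℝ contDiff_id).contDiffOn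
    · exact (contDiff_const.inner ℝ contDiff_id).contDiffOn
  · intro t ht x hx
    simp only [inner_smul_right, norm_smul, Real.norm_of_nonneg ht.le]
    rw [← mul_sub, mul_div_mul_left _ _ ht.ne']
  · intro x hxK
    have hx := hKG hxK
    have hx1 := hK1 x hxK
    have hl := hden x hx
    apply exists_dd_ne (w := (‖x‖ - ⟪p, x⟫) • e + ⟪e, x⟫ • p)
    have d1 : HasFDerivAt (fun x : EE => ⟪e, x⟫) (innerSL ℝ e) x := (innerSL ℝ e).hasFDerivAt
    have d2 : HasFDerivAt (fun x : EE => ⟪p, x⟫) (innerSL ℝ p) x := (innerSL ℝ p).hasFDerivAt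
    have d3 : HasFDerivAt (fun x : EE => ‖x‖) (‖x‖⁻¹ • innerSL ℝ x) x := by
      have h := (hasStrictFDerivAt_norm_sq x).hasFDerivAt.sqrt (by simp [hx1])
      simp only [Real.sqrt_sq (norm_nonneg _)] at h
      have e1 : (‖x‖⁻¹ • innerSL ℝ x : EE →L[ℝ] ℝ) = (1 / (2 * ‖x‖)) • 2 • innerSL ℝ x := by
        rw [hx1, ← Nat.cast_smul_eq_nsmul ℝ 2, smul_smul]
        norm_num
      rw [e1]
      exact h
    have d4 := d3.fun_sub d2
    have hψd : DifferentiableAt ℝ (fun x : EE => ⟪e, x⟫ / (‖x‖ - ⟪p, x⟫)) x :=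
      by
        simp only [div_eq_mul_inv]
        exact d1.differentiableAt.fun_mul (d4.differentiableAt.fun_inv hl)
    have d5 := hψd.hasFDerivAt.fun_mul d4
    have ev : (fun y : EE => ⟪e, y⟫ / (‖y‖ - ⟪p, y⟫) * (‖y‖ - ⟪p, y⟫)) =ᶠ[𝓝 x]
        fun y => ⟪e, y⟫ := by
      filter_upwards [hG.mem_nhds hx] with y hy
      exact div_mul_cancel₀ _ (hden y hy)
    have d6 := (d5.congr_of_eventuallyEq ev.symm).unique d1
    have d7 := congrArg (fun T => T ((‖x‖ - ⟪p, x⟫) • e + ⟪e, x⟫ • p)) d6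
    intro h7
    have hpe : ⟪p, e⟫ = 0 := by rw [real_inner_comm]; exact hep
    simp only [add_apply, smul_apply, sub_apply, innerSL_apply_apply, h7] at d7
    simp only [inner_add_right, inner_smul_right, hep, hpe,
      real_inner_self_eq_norm_sq, he, hp, hx1, smul_eq_mul, real_inner_comm e x,
      real_inner_comm p x] at d7
    rw [hx1] at hl
    apply hl
    linear_combination -d7

lemma cone_open {S : Set EE} (hS : IsSphDomain S) : IsOpen (coneOf S) := by
  obtain ⟨V, hV, hVS⟩ := isOpen_induced_iff.1 hS.2.1
  have h : coneOf S = {x : EE | x ≠ 0} ∩ (fun x : EE => ‖x‖⁻¹ • x) ⁻¹' V := by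
    ext x
    refine and_congr_right fun hx => ?_
    have hs : ‖x‖⁻¹ • x ∈ sphere (0 : EE) 1 := by
      rw [mem_sphere_zero_iff_norm, norm_smul, norm_inv, norm_norm,
        inv_mul_cancel₀ (norm_ne_zero_iff.2 hx)]
    have := Set.ext_iff.1 hVS ⟨_, hs⟩
    exact this.symm
  rw [h]
  refine ContinuousOn.isOpen_inter_preimage ?_ isOpen_ne hV
  exact (continuous_norm.continuousOn.inv₀ fun x hx => norm_ne_zero_iff.2 hx).smul continuousOn_id

lemma smul_mem_cone {S : Set EE} (hS : S ⊆ sphere (0 : EE) 1) {t : ℝ} (ht : 0 < t) {σ : EE}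
    (hσ : σ ∈ S) : t • σ ∈ coneOf S := by
  have h1 : ‖σ‖ = 1 := by simpa using hS hσ
  have h0 : σ ≠ 0 := fun h => by simp [h] at h1
  refine ⟨smul_ne_zero ht.ne' h0, ?_⟩
  rw [norm_smul, h1, mul_one, Real.norm_of_nonneg ht.le, smul_smul, inv_mul_cancel₀ ht.ne',
    one_smul]
  exact hσ

lemma exists_missing {S : Set EE} (hS : IsC2SphDomain S) (hne : S ≠ sphere (0 : EE) 1) :
    ∃ p : EE, ‖p‖ = 1 ∧ p ∉ closure S := by
  by_contra hcon
  push Not at hcon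
  obtain ⟨⟨hsub, -, -⟩, hC2⟩ := hS
  obtain ⟨z, hz, hzS⟩ : ∃ z ∈ sphere (0 : EE) 1, z ∉ S := by
    by_contra h
    push Not at h
    exact hne (hsub.antisymm h)
  have hz1 : ‖z‖ = 1 := by simpa using hz
  have hz0 : z ≠ 0 := fun h => by simp [h] at hz1
  have hcl : ∀ y : EE, y ≠ 0 → y ∈ closure (coneOf S) := by
    intro y hy
    have hyn := norm_pos_iff.2 hy
    have h1 : ‖y‖⁻¹ • y ∈ closure S := hcon _ (by
      rw [norm_smul, norm_inv, norm_norm, inv_mul_cancel₀ hyn.ne'])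
    have h2 := map_mem_closure (f := fun σ : EE => ‖y‖ • σ) (t := coneOf S) (by fun_prop) h1
      (fun σ hσ => smul_mem_cone hsub hyn hσ)
    simpa [smul_smul, mul_inv_cancel₀ hyn.ne'] using h2
  have hzc : z ∉ coneOf S := by
    intro h
    have := h.2
    rw [hz1, inv_one, one_smul] at this
    exact hzS this
  have hzf : z ∈ frontier (coneOf S) \ {0} :=
    ⟨⟨hcl z hz0, fun h => hzc (interior_subset h)⟩, hz0⟩
  obtain ⟨U, f, hU, hzU, hf, hdf, hUf⟩ := hC2 z hzf
  have hle : ∀ y ∈ U, y ≠ 0 → f y ≤ 0 := by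
    intro y hy hy0
    by_contra hlt
    push Not at hlt
    have hW : IsOpen (U ∩ {x | 0 < f x}) := hU.inter (isOpen_lt continuous_const hf.continuous)
    obtain ⟨x, ⟨hxU, hxf⟩, hxC⟩ := mem_closure_iff.1 (hcl y hy0) _ hW ⟨hy, hlt⟩
    have : x ∈ {y ∈ U | f y < 0} := hUf ▸ ⟨hxC, hxU⟩
    exact absurd this.2 (not_lt.2 (le_of_lt hxf))
  have hge : 0 ≤ f z := by
    by_contra hlt
    push Not at hlt
    have : z ∈ coneOf S ∩ U := hUf.symm ▸ ⟨hzU, hlt⟩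
    exact hzc this.1
  have hmax : IsLocalMax f z := by
    filter_upwards [hU.mem_nhds hzU, isOpen_ne.mem_nhds hz0] with y hy hy0
    exact (hle y hy hy0).trans hge
  exact hdf hmax.fderiv_eq_zero

lemma setInt_eq {S : Set EE} {u : EE → ℝ} (hu : DirichletAdm (coneOf S) u) (α : ℝ) :
    (∫ x in coneOf S, ‖x‖ ^ (α - 4) * (u x) ^ 2) = (∫ x, ‖x‖ ^ (α - 4) * (u x) ^ 2) ∧
    (∫ x in coneOf S, ‖x‖ ^ α * (lap u x) ^ 2) = ∫ x, ‖x‖ ^ α * (lap u x) ^ 2 := by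
  obtain ⟨h1, h2, h3⟩ := hu
  constructor
  · refine setIntegral_eq_integral_of_forall_compl_eq_zero fun x hx => ?_
    rw [image_eq_zero_of_notMem_tsupport fun h => hx (h3 h)]
    simp
  · refine setIntegral_eq_integral_of_forall_compl_eq_zero fun x hx => ?_
    have : lap u x = 0 := by
      rw [lap_eq h1.contDiffAt]
      refine Finset.sum_eq_zero fun i _ => dd_zero_of_notMem fun h => hx (h3 ?_)
      have : tsupport (dd i u) ⊆ tsupport u := by
        refine closure_minimal (fun y hy => ?_) (isClosed_tsupport u)
        by_contra hcon
        exact hy (dd_zero_of_notMem hcon)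
      exact this h
    simp [this]

lemma den_pos {S : Set EE} {u : EE → ℝ} (hu : DirichletAdm (coneOf S) u)
    (hx : ∃ x ∈ coneOf S, u x ≠ 0) (α : ℝ) : 0 < ∫ x, ‖x‖ ^ (α - 4) * (u x) ^ 2 := by
  obtain ⟨h1, h2, h3⟩ := hu
  obtain ⟨x, hxS, hxu⟩ := hx
  refine Continuous.integral_pos_of_hasCompactSupport_nonneg_nonzero (x := x) ?_ ?_ ?_ ?_
  · rw [continuous_iff_continuousAt]
    intro y
    by_cases hy : y ∈ tsupport u
    · have hy0 := (h3 hy).1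
      exact (continuous_norm.continuousAt.rpow_const (Or.inl (norm_ne_zero_iff.2 hy0))).mul
        (h1.continuous.continuousAt.pow 2)
    · have : (fun x => ‖x‖ ^ (α - 4) * (u x) ^ 2) =ᶠ[𝓝 y] fun _ => 0 := by
        filter_upwards [(isClosed_tsupport u).isOpen_compl.mem_nhds hy] with v hv
        simp [image_eq_zero_of_notMem_tsupport hv]
      exact this.continuousAt
  · refine h2.of_isClosed_subset (isClosed_tsupport _)
      (closure_minimal (fun y hy => ?_) (isClosed_tsupport u))
    by_contra hcon
    exact hy (by simp [image_eq_zero_of_notMem_tsupport hcon])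
  · intro y
    simp only [Pi.zero_apply]
    positivity
  · have := norm_pos_iff.2 hxS.1
    positivity

lemma exists_adm {S : Set EE} (hS : IsSphDomain S) :
    ∃ u, DirichletAdm (coneOf S) u ∧ ∃ x ∈ coneOf S, u x ≠ 0 := by
  obtain ⟨σ, hσ⟩ := hS.2.2.nonempty
  have hx := smul_mem_cone hS.1 one_pos hσ
  obtain ⟨ε, hε, hb⟩ := Metric.nhds_basis_closedBall.mem_iff.1 ((cone_open hS).mem_nhds hx)
  let f : ContDiffBump ((1 : ℝ) • σ) := ⟨ε / 2, ε, by positivity, by linarith⟩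
  refine ⟨f, ⟨f.contDiff, f.hasCompactSupport, ?_⟩, _, hx, ?_⟩
  · rw [f.tsupport_eq]
    exact hb
  · exact (f.pos_of_mem_ball (mem_ball_self hε)).ne'

end Helpers

/-- Corollary 1 of the paper: on a proper cone the Dirichlet
Rellich constant is positive. -/
theorem rellich_cone_dirichlet_pos {n : ℕ} (hn : 2 ≤ n) (α : ℝ)
    (S : Set (EuclideanSpace ℝ (Fin n))) (hS : IsC2SphDomain S)
    (hne : S ≠ Metric.sphere (0 : EuclideanSpace ℝ (Fin n)) 1) :
    0 < muD (coneOf S) α ∧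
    ∃ C > 0, ∀ u : EuclideanSpace ℝ (Fin n) → ℝ, DirichletAdm (coneOf S) u →
      C * (∫ x in coneOf S, ‖x‖ ^ (α - 4) * (u x) ^ 2) ≤
        ∫ x in coneOf S, ‖x‖ ^ α * (lap u x) ^ 2 := by
  obtain ⟨p, hp, hpS⟩ := exists_missing hS hne
  have hSc : closure S ⊆ Metric.sphere (0 : EuclideanSpace ℝ (Fin n)) 1 :=
    closure_minimal hS.1.1 Metric.isClosed_sphere
  have hK : IsCompact (closure S) :=
    (isCompact_sphere (0 : EuclideanSpace ℝ (Fin n)) 1).of_isClosed_subset isClosed_closure hSc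
  obtain ⟨C, hC, H⟩ := rellich_missing_point hn hK (fun x hx => by simpa using hSc hx) hp hpS α
  have H' : ∀ u : EuclideanSpace ℝ (Fin n) → ℝ, DirichletAdm (coneOf S) u →
      C * (∫ x in coneOf S, ‖x‖ ^ (α - 4) * (u x) ^ 2) ≤
        ∫ x in coneOf S, ‖x‖ ^ α * (lap u x) ^ 2 := by
    intro u hu
    rw [(setInt_eq hu α).1, (setInt_eq hu α).2]
    exact H u hu.1 hu.2.1 fun x hx => ⟨(hu.2.2 hx).1, subset_closure (hu.2.2 hx).2⟩
  refine ⟨lt_of_lt_of_le hC ?_, C, hC, H'⟩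
  refine le_csInf ?_ ?_
  · obtain ⟨u, hu, hx⟩ := exists_adm hS.1
    exact ⟨_, u, hu, hx, rfl⟩
  · rintro q ⟨u, hu, hx, rfl⟩
    have hpos := den_pos hu hx α
    rw [← (setInt_eq hu α).1] at hpos
    rw [le_div_iff₀ hpos]
    exact H' u hu

end
end

section
/- Let n ≥ 2, α ∈ ℝ, and let Σ be a domain of class C² in S^{n−1}. If μ_N(C_Σ;α) > 0, then the infimum μ_N(C_Σ;α) is not attained by any nonzero element of the Hilbert space N²(C_Σ;α) obtained by completing C²_c(C̄_Σ∖{0}) with respect to the norm ‖u‖ := (∫_{C_Σ} |x|^α |Δu|² dx)^{1/2}; likewise, if μ_D(C_Σ;α) > 0, then μ_D(C_Σ;α) is not attained in the completion D²(C_Σ;α) of C²_c(C_Σ) with respect to the same norm. -/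
open MeasureTheory Metric Set Filter
open scoped RealInnerProductSpace

noncomputable section
open scoped RealInnerProductSpace

/-- Euclidean space. -/
abbrev Eu (n : ℕ) := EuclideanSpace ℝ (Fin n)

/-- Derivative along the linear vector field `x ↦ B x`. -/
def Dd {n : ℕ} (B : Eu n →L[ℝ] Eu n) (f : Eu n → ℝ) (x : Eu n) : ℝ := fderiv ℝ f x (B x)

/-- Euler derivative. -/
def Ed {n : ℕ} (f : Eu n → ℝ) : Eu n → ℝ := Dd (ContinuousLinearMap.id ℝ (Eu n)) f

/-- Generator of rotation in the `i, j` plane. -/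
def rot {n : ℕ} (i j : Fin n) : Eu n →L[ℝ] Eu n :=
  (EuclideanSpace.proj (𝕜 := ℝ) i : Eu n →L[ℝ] ℝ).smulRight (EuclideanSpace.single j (1:ℝ)) -
  (EuclideanSpace.proj (𝕜 := ℝ) j : Eu n →L[ℝ] ℝ).smulRight (EuclideanSpace.single i (1:ℝ))

/-- Spherical Laplacian. -/
def Sg {n : ℕ} (f : Eu n → ℝ) (x : Eu n) : ℝ :=
  (1/2) * ∑ i : Fin n, ∑ j : Fin n, Dd (rot i j) (Dd (rot i j) f) x

variable {n : ℕ}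

lemma rot_apply (i j : Fin n) (x : Eu n) :
    rot i j x = x i • EuclideanSpace.single j (1:ℝ) - x j • EuclideanSpace.single i (1:ℝ) := by
  simp [rot]

lemma inner_rot (i j : Fin n) (x : Eu n) : inner ℝ x (rot i j x) = 0 := by
  rw [rot_apply, inner_sub_right, inner_smul_right, inner_smul_right]
  simp [EuclideanSpace.inner_single_right]
  ring

lemma Dd_contDiffOn {Ω : Set (Eu n)} (hΩ : IsOpen Ω) {f : Eu n → ℝ} {k m : WithTop ℕ∞} (hkm : m + 1 ≤ k)
    (hf : ContDiffOn ℝ k f Ω) (B : Eu n →L[ℝ] Eu n) : ContDiffOn ℝ m (Dd B f) Ω := by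
  have h1 := hf.fderiv_of_isOpen hΩ hkm
  exact h1.clm_apply B.contDiff.contDiffOn

lemma Dd_Dd {f : Eu n → ℝ} {x : Eu n} (hf : ContDiffAt ℝ 2 f x) (B C : Eu n →L[ℝ] Eu n) :
    Dd C (Dd B f) x = fderiv ℝ (fderiv ℝ f) x (C x) (B x) + fderiv ℝ f x (B (C x)) := by
  have h1 : DifferentiableAt ℝ (fderiv ℝ f) x :=
    (hf.fderiv_right (m := 1) (by norm_num)).differentiableAt (by norm_num)
  have h2 : HasFDerivAt (fun y => fderiv ℝ f y (B y)) _ x :=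
    h1.hasFDerivAt.clm_apply B.hasFDerivAt
  unfold Dd
  rw [h2.fderiv]
  simp [add_comm]

lemma lap_formula {f : Eu n → ℝ} {x : Eu n} (hf : ContDiffAt ℝ 2 f x) :
    ‖x‖ ^ 2 * lap f x = Ed (Ed f) x + ((n:ℝ) - 2) * Ed f x + Sg f x := by
  have hsym : ∀ a b, fderiv ℝ (fderiv ℝ f) x a b = fderiv ℝ (fderiv ℝ f) x b a := by
    have := hf.isSymmSndFDerivAt (by simp)
    exact fun a b => this a b
  set H := fderiv ℝ (fderiv ℝ f) x with hH
  set g := fderiv ℝ f x with hg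
  have hx : x = ∑ i, x i • EuclideanSpace.single i (1:ℝ) := by
    ext k; simp [Finset.sum_apply, Pi.single_apply]
  have hE2 : Ed (Ed f) x = H x x + g x := by
    unfold Ed; rw [Dd_Dd hf]; simp [hH, hg]
  have hE1 : Ed f x = g x := by simp [Ed, Dd, hg]
  have hlap : lap f x = ∑ i, H (EuclideanSpace.single i 1) (EuclideanSpace.single i 1) := by
    unfold lap; simp [iteratedFDeriv_two_apply, hH]
  have hn : ‖x‖^2 = ∑ i, x i ^ 2 := EuclideanSpace.real_norm_sq_eq x
  have hHx : H x x = ∑ i, ∑ j, x i * x j * H (EuclideanSpace.single i 1) (EuclideanSpace.single j 1) := by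
    conv_lhs => rw [hx]
    simp only [map_sum, Finset.sum_apply, map_smul, ContinuousLinearMap.sum_apply, smul_apply, smul_eq_mul, Finset.mul_sum, mul_assoc]
    exact Finset.sum_congr rfl fun i _ => Finset.sum_congr rfl fun j _ => by rw [hsym]
  have hgx : g x = ∑ i, x i * g (EuclideanSpace.single i 1) := by
    conv_lhs => rw [hx]
    simp [map_sum]
  have hR : ∀ i j, Dd (rot i j) (Dd (rot i j) f) x =
      (x i^2 * H (EuclideanSpace.single j 1) (EuclideanSpace.single j 1)
      - 2 * (x i * x j * H (EuclideanSpace.single i 1) (EuclideanSpace.single j 1))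
      + x j^2 * H (EuclideanSpace.single i 1) (EuclideanSpace.single i 1))
      + ((if i = j then x i * g (EuclideanSpace.single i 1) else 0) * 2
        - x j * g (EuclideanSpace.single j 1) - x i * g (EuclideanSpace.single i 1)) := by
    intro i j
    rw [Dd_Dd hf, ← hH, ← hg, rot_apply, rot_apply]
    have := hsym (EuclideanSpace.single j 1) (EuclideanSpace.single i 1)
    simp only [map_sub, map_smul, sub_apply, smul_apply, smul_eq_mul, this]
    by_cases hij : i = j
    · subst hij; simp; ring
    · have hij' : ¬ j = i := fun h => hij h.symm
      simp [hij, hij']; ring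
  unfold Sg
  simp only [hR]
  generalize hp : (fun i => x i * g (EuclideanSpace.single i 1)) = p at hgx
  have hp' : ∀ i, x i * g (EuclideanSpace.single i 1) = p i := fun i => congrFun hp i
  simp only [hp'] at hgx ⊢
  rw [hE2, hE1, hlap, hn]
  simp only [Finset.sum_add_distrib, Finset.sum_sub_distrib, ← Finset.sum_mul, ← Finset.mul_sum,
    Finset.sum_ite_eq, Finset.mem_univ, if_true, Finset.sum_const, Finset.card_univ, Fintype.card_fin, nsmul_eq_mul]
  rw [← hHx, ← hgx]
  ring
end

noncomputable section
open scoped RealInnerProductSpace Pointwise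
variable {n : ℕ}

/-- Open cones not containing the origin. -/
structure OC (Ω : Set (Eu n)) : Prop where
  op : IsOpen Ω
  smul : ∀ c : ℝ, 0 < c → ∀ x ∈ Ω, c • x ∈ Ω
  zero : (0 : Eu n) ∉ Ω

lemma OC.ne {Ω : Set (Eu n)} (h : OC Ω) {x : Eu n} (hx : x ∈ Ω) : x ≠ 0 := fun h0 => h.zero (h0 ▸ hx)

lemma coneOf_OC {S : Set (Eu n)} (hS : IsSphDomain S) : OC (coneOf S) := by
  refine ⟨?_, ?_, ?_⟩
  · obtain ⟨h1, h2, -⟩ := hS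
    obtain ⟨V, hV, hVS⟩ := isOpen_induced_iff.1 h2
    have : coneOf S = {x : Eu n | x ≠ 0} ∩ (fun x : Eu n => ‖x‖⁻¹ • x) ⁻¹' V := by
      ext x
      simp only [coneOf, Set.mem_ofPred_eq, mem_inter_iff, mem_preimage]
      refine and_congr_right fun hx => ?_
      have hs : ‖x‖⁻¹ • x ∈ Metric.sphere (0 : Eu n) 1 := by
        simp [norm_smul, hx]
      have := Set.ext_iff.1 hVS ⟨_, hs⟩
      simpa using this.symm
    rw [this]
    refine ContinuousOn.isOpen_inter_preimage ?_ isOpen_ne hV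
    exact (continuous_norm.continuousOn.inv₀ (fun x hx => norm_ne_zero_iff.2 hx)).smul continuousOn_id
  · rintro c hc x ⟨hx, hxS⟩
    refine ⟨smul_ne_zero hc.ne' hx, ?_⟩
    rw [norm_smul, smul_smul, Real.norm_of_nonneg hc.le]
    have : (c * ‖x‖)⁻¹ * c = ‖x‖⁻¹ := by field_simp
    rwa [this]
  · exact fun h => h.1 rfl

lemma Dd_congr {Ω : Set (Eu n)} (hΩ : IsOpen Ω) {f g : Eu n → ℝ} (h : EqOn f g Ω) (B : Eu n →L[ℝ] Eu n) :
    EqOn (Dd B f) (Dd B g) Ω := by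
  intro x hx
  unfold Dd
  rw [(h.eventuallyEq_of_mem (hΩ.mem_nhds hx)).fderiv_eq]

lemma Dd_mul {f g : Eu n → ℝ} {x : Eu n} (hf : DifferentiableAt ℝ f x) (hg : DifferentiableAt ℝ g x)
    (B : Eu n →L[ℝ] Eu n) : Dd B (fun y => f y * g y) x = f x * Dd B g x + g x * Dd B f x := by
  unfold Dd
  rw [fderiv_fun_mul hf hg]; simp

lemma Dd_add {f g : Eu n → ℝ} {x : Eu n} (hf : DifferentiableAt ℝ f x) (hg : DifferentiableAt ℝ g x)
    (B : Eu n →L[ℝ] Eu n) : Dd B (fun y => f y + g y) x = Dd B f x + Dd B g x := by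
  unfold Dd
  rw [fderiv_fun_add hf hg]; simp

lemma Dd_const_mul {f : Eu n → ℝ} {x : Eu n} (hf : DifferentiableAt ℝ f x) (c : ℝ)
    (B : Eu n →L[ℝ] Eu n) : Dd B (fun y => c * f y) x = c * Dd B f x := by
  unfold Dd
  rw [fderiv_const_mul hf]; simp

lemma Dd_sub {f g : Eu n → ℝ} {x : Eu n} (hf : DifferentiableAt ℝ f x) (hg : DifferentiableAt ℝ g x)
    (B : Eu n →L[ℝ] Eu n) : Dd B (fun y => f y - g y) x = Dd B f x - Dd B g x := by
  unfold Dd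
  rw [fderiv_fun_sub hf hg]; simp

lemma hasFDerivAt_rp (m : ℝ) {x : Eu n} (hx : x ≠ 0) :
    HasFDerivAt (fun y : Eu n => ‖y‖ ^ m) ((m * ‖x‖ ^ (m - 2)) • innerSL ℝ x) x := by
  have hx' : 0 < ‖x‖ := norm_pos_iff.2 hx
  have h1 : HasFDerivAt (fun y : Eu n => ‖y‖ ^ 2) (2 • innerSL ℝ x) x := (hasStrictFDerivAt_norm_sq x).hasFDerivAt
  have h2 := h1.rpow_const (p := m / 2) (Or.inl (by positivity))
  have e : (fun y : Eu n => (‖y‖ ^ 2) ^ (m/2)) = fun y : Eu n => ‖y‖ ^ m := by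
    funext y
    rw [← Real.rpow_natCast, ← Real.rpow_mul (norm_nonneg _)]; congr 1; push_cast; ring
  rw [e] at h2
  have e2 : (m / 2 * (‖x‖ ^ 2) ^ (m / 2 - 1)) • (2 : ℕ) • innerSL ℝ x = (m * ‖x‖ ^ (m - 2)) • innerSL ℝ x := by
    rw [← Real.rpow_natCast, ← Real.rpow_mul (norm_nonneg _)]
    have : ((2:ℕ):ℝ) * (m/2-1) = m - 2 := by push_cast; ring
    rw [this, ← Nat.cast_smul_eq_nsmul ℝ, smul_smul]
    congr 1; push_cast; ring
  rw [e2] at h2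
  exact h2

lemma contDiffAt_rp (m : ℝ) {x : Eu n} (hx : x ≠ 0) {k : WithTop ℕ∞} :
    ContDiffAt ℝ k (fun y : Eu n => ‖y‖ ^ m) x :=
  (contDiffAt_norm ℝ hx).rpow_const_of_ne (norm_ne_zero_iff.2 hx)

lemma Ed_rp (m : ℝ) {x : Eu n} (hx : x ≠ 0) : Ed (fun y : Eu n => ‖y‖ ^ m) x = m * ‖x‖ ^ m := by
  unfold Ed Dd
  rw [(hasFDerivAt_rp m hx).fderiv]
  have hx' : 0 < ‖x‖ := norm_pos_iff.2 hx
  have : ‖x‖ ^ m = ‖x‖ ^ (m-2) * ‖x‖ ^ 2 := by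
    rw [← Real.rpow_natCast, ← Real.rpow_add hx']; congr 1; push_cast; ring
  simp [this]; ring

lemma rot_rp (m : ℝ) {x : Eu n} (hx : x ≠ 0) (i j : Fin n) : Dd (rot i j) (fun y : Eu n => ‖y‖ ^ m) x = 0 := by
  unfold Dd
  rw [(hasFDerivAt_rp m hx).fderiv]
  simp [inner_rot]

lemma Ed_rp_mul (m : ℝ) {x : Eu n} (hx : x ≠ 0) {w : Eu n → ℝ} (hw : DifferentiableAt ℝ w x) :
    Ed (fun y : Eu n => ‖y‖ ^ m * w y) x = ‖x‖ ^ m * (Ed w x + m * w x) := by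
  have := Ed_rp m hx
  unfold Ed at *
  rw [Dd_mul (hasFDerivAt_rp m hx).differentiableAt hw, this]; ring

lemma rot_rp_mul (m : ℝ) {x : Eu n} (hx : x ≠ 0) {w : Eu n → ℝ} (hw : DifferentiableAt ℝ w x) (i j : Fin n) :
    Dd (rot i j) (fun y : Eu n => ‖y‖ ^ m * w y) x = ‖x‖ ^ m * Dd (rot i j) w x := by
  rw [Dd_mul (hasFDerivAt_rp m hx).differentiableAt hw, rot_rp m hx]; ring

lemma C2_diff {Ω : Set (Eu n)} (hΩ : IsOpen Ω) {w : Eu n → ℝ} (hw : ContDiffOn ℝ 2 w Ω) {x : Eu n} (hx : x ∈ Ω) :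
    DifferentiableAt ℝ w x := (hw.contDiffAt (hΩ.mem_nhds hx)).differentiableAt (by norm_num)

lemma C1_diff {Ω : Set (Eu n)} (hΩ : IsOpen Ω) {w : Eu n → ℝ} (hw : ContDiffOn ℝ 1 w Ω) {x : Eu n} (hx : x ∈ Ω) :
    DifferentiableAt ℝ w x := (hw.contDiffAt (hΩ.mem_nhds hx)).differentiableAt (by norm_num)

lemma Dd_C1 {Ω : Set (Eu n)} (hΩ : IsOpen Ω) {w : Eu n → ℝ} (hw : ContDiffOn ℝ 2 w Ω) (B : Eu n →L[ℝ] Eu n) :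
    ContDiffOn ℝ 1 (Dd B w) Ω := Dd_contDiffOn hΩ (by norm_num) hw B

lemma lap_rp_mul {Ω : Set (Eu n)} (hΩ : OC Ω) {w : Eu n → ℝ} (hw : ContDiffOn ℝ 2 w Ω) (m : ℝ) {x : Eu n}
    (hx : x ∈ Ω) : ‖x‖^2 * lap (fun y : Eu n => ‖y‖ ^ (-m) * w y) x = ‖x‖ ^ (-m) *
      (Ed (Ed w) x + ((n:ℝ) - 2 - 2 * m) * Ed w x + (m^2 - ((n:ℝ)-2) * m) * w x + Sg w x) := by
  have hc : ContDiffAt ℝ 2 (fun y : Eu n => ‖y‖ ^ (-m) * w y) x :=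
    (contDiffAt_rp (-m) (hΩ.ne hx)).mul (hw.contDiffAt (hΩ.op.mem_nhds hx))
  rw [lap_formula hc]
  have e1 : EqOn (Ed (fun y : Eu n => ‖y‖ ^ (-m) * w y)) (fun x => ‖x‖ ^ (-m) * (Ed w x + (-m) * w x)) Ω :=
    fun y hy => Ed_rp_mul (-m) (hΩ.ne hy) (C2_diff hΩ.op hw hy)
  have hE : DifferentiableAt ℝ (Ed w) x := C1_diff hΩ.op (Dd_C1 hΩ.op hw _) hx
  have hd : DifferentiableAt ℝ w x := C2_diff hΩ.op hw hx
  have e2 : Ed (Ed (fun y : Eu n => ‖y‖ ^ (-m) * w y)) x = ‖x‖ ^ (-m) * ((Ed (Ed w) x + (-m) * Ed w x)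
      + (-m) * (Ed w x + (-m) * w x)) := by
    have := Dd_congr hΩ.op e1 (ContinuousLinearMap.id ℝ (Eu n)) hx
    change Ed _ x = Ed _ x at this
    rw [this, Ed_rp_mul (-m) (hΩ.ne hx) (w := fun x => Ed w x + (-m) * w x) (hE.add (hd.const_mul (-m)))]
    congr 2
    unfold Ed at *
    rw [Dd_add hE (hd.const_mul (-m)), Dd_const_mul hd]
  have e3 : Sg (fun y : Eu n => ‖y‖ ^ (-m) * w y) x = ‖x‖ ^ (-m) * Sg w x := by
    unfold Sg
    rw [mul_left_comm (‖x‖ ^ (-m))]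
    congr 1
    rw [Finset.mul_sum]
    refine Finset.sum_congr rfl fun i _ => ?_
    rw [Finset.mul_sum]
    refine Finset.sum_congr rfl fun j _ => ?_
    have r1 : EqOn (Dd (rot i j) (fun y : Eu n => ‖y‖ ^ (-m) * w y)) (fun x => ‖x‖ ^ (-m) * Dd (rot i j) w x) Ω :=
      fun y hy => rot_rp_mul (-m) (hΩ.ne hy) (C2_diff hΩ.op hw hy) i j
    rw [Dd_congr hΩ.op r1 (rot i j) hx, rot_rp_mul (-m) (hΩ.ne hx) (C1_diff hΩ.op (Dd_C1 hΩ.op hw _) hx)]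
  rw [e2, e1 hx, e3]
  ring

/-- The radial stretching. -/
def Psi (x : Eu n) : Eu n := ‖x‖ ^ (-(1/2) : ℝ) • x

lemma norm_Psi {x : Eu n} (hx : x ≠ 0) : ‖Psi x‖ = ‖x‖ ^ ((1/2) : ℝ) := by
  have hx' : 0 < ‖x‖ := norm_pos_iff.2 hx
  rw [Psi, norm_smul, Real.norm_of_nonneg (by positivity)]
  nth_rw 2 [← Real.rpow_one ‖x‖]
  rw [← Real.rpow_add hx']; norm_num

lemma Psi_mem {Ω : Set (Eu n)} (hΩ : OC Ω) {x : Eu n} (hx : x ∈ Ω) : Psi x ∈ Ω :=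
  hΩ.smul _ (Real.rpow_pos_of_pos (norm_pos_iff.2 (hΩ.ne hx)) _) _ hx

/-- Derivative of `Psi`. -/
def dPsi (x : Eu n) : Eu n →L[ℝ] Eu n :=
  ‖x‖ ^ (-(1/2) : ℝ) • ContinuousLinearMap.id ℝ (Eu n) +
    (((-(1/2)) * ‖x‖ ^ ((-(1/2) : ℝ) - 2)) • innerSL ℝ x).smulRight x

lemma hasFDerivAt_Psi {x : Eu n} (hx : x ≠ 0) : HasFDerivAt (Psi : Eu n → Eu n) (dPsi x) x :=
  (hasFDerivAt_rp (-(1/2)) hx).smul (hasFDerivAt_id x)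

lemma dPsi_self {x : Eu n} (hx : x ≠ 0) : dPsi x x = (1/2 : ℝ) • Psi x := by
  have hx' : 0 < ‖x‖ := norm_pos_iff.2 hx
  have : ‖x‖ ^ (-(1/2):ℝ) = ‖x‖ ^ (-(1/2)-2:ℝ) * ‖x‖ ^ 2 := by
    rw [← Real.rpow_natCast, ← Real.rpow_add hx']; congr 1; push_cast; ring
  simp only [dPsi, Psi, add_apply, smul_apply, ContinuousLinearMap.id_apply, ContinuousLinearMap.smulRight_apply, innerSL_apply_apply,
    real_inner_self_eq_norm_sq, smul_smul, ← add_smul, smul_eq_mul]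
  congr 1
  rw [this]; ring

lemma dPsi_rot (x : Eu n) (i j : Fin n) : dPsi x (rot i j x) = rot i j (Psi x) := by
  simp [dPsi, Psi, inner_rot]

lemma Ed_Psi {w : Eu n → ℝ} {x : Eu n} (hx : x ≠ 0) (hw : DifferentiableAt ℝ w (Psi x)) :
    Ed (fun y => w (Psi y)) x = (1/2) * Ed w (Psi x) := by
  have := (hw.hasFDerivAt.comp x (hasFDerivAt_Psi hx)).fderiv
  unfold Ed Dd
  change fderiv ℝ (w ∘ Psi) x _ = _
  rw [this]
  simp only [ContinuousLinearMap.comp_apply, ContinuousLinearMap.id_apply, dPsi_self hx, map_smul, smul_eq_mul]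

lemma rot_Psi {w : Eu n → ℝ} {x : Eu n} (hx : x ≠ 0) (hw : DifferentiableAt ℝ w (Psi x)) (i j : Fin n) :
    Dd (rot i j) (fun y => w (Psi y)) x = Dd (rot i j) w (Psi x) := by
  have := (hw.hasFDerivAt.comp x (hasFDerivAt_Psi hx)).fderiv
  unfold Dd
  change fderiv ℝ (w ∘ Psi) x _ = _
  rw [this]
  simp only [ContinuousLinearMap.comp_apply, dPsi_rot]

lemma contDiffAt_Psi {x : Eu n} (hx : x ≠ 0) {k : WithTop ℕ∞} : ContDiffAt ℝ k (Psi : Eu n → Eu n) x :=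
  (contDiffAt_rp _ hx).smul contDiffAt_id

lemma second_Psi {Ω : Set (Eu n)} (hΩ : OC Ω) {w : Eu n → ℝ} (hw : ContDiffOn ℝ 2 w Ω) {x : Eu n}
    (hx : x ∈ Ω) : Ed (Ed (fun y => w (Psi y))) x = (1/4) * Ed (Ed w) (Psi x) ∧
      Ed (fun y => w (Psi y)) x = (1/2) * Ed w (Psi x) ∧ Sg (fun y => w (Psi y)) x = Sg w (Psi x) := by
  refine ⟨?_, Ed_Psi (hΩ.ne hx) (C2_diff hΩ.op hw (Psi_mem hΩ hx)), ?_⟩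
  · have e1 : EqOn (Ed (fun y => w (Psi y))) (fun x => (1/2) * Ed w (Psi x)) Ω :=
      fun y hy => Ed_Psi (hΩ.ne hy) (C2_diff hΩ.op hw (Psi_mem hΩ hy))
    have := Dd_congr hΩ.op e1 (ContinuousLinearMap.id ℝ (Eu n)) hx
    change Ed _ x = Ed _ x at this
    have hd : DifferentiableAt ℝ (Ed w) (Psi x) := C1_diff hΩ.op (Dd_C1 hΩ.op hw _) (Psi_mem hΩ hx)
    rw [this]
    have h2 : Ed (fun x => (1/2) * Ed w (Psi x)) x = (1/2) * Ed (fun x => Ed w (Psi x)) x :=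
      Dd_const_mul (hd.comp x (hasFDerivAt_Psi (hΩ.ne hx)).differentiableAt) _ _
    rw [h2, Ed_Psi (hΩ.ne hx) hd]; ring
  · unfold Sg
    congr 1
    refine Finset.sum_congr rfl fun i _ => Finset.sum_congr rfl fun j _ => ?_
    have r1 : EqOn (Dd (rot i j) (fun y => w (Psi y))) (fun x => Dd (rot i j) w (Psi x)) Ω :=
      fun y hy => rot_Psi (hΩ.ne hy) (C2_diff hΩ.op hw (Psi_mem hΩ hy)) i j
    rw [Dd_congr hΩ.op r1 (rot i j) hx, rot_Psi (hΩ.ne hx) (C1_diff hΩ.op (Dd_C1 hΩ.op hw _) (Psi_mem hΩ hx))]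

lemma det_dPsi {x : Eu n} (hx : x ≠ 0) : (dPsi x).det = (1/2) * (‖x‖ ^ (-(1/2):ℝ)) ^ n := by
  have hx' : 0 < ‖x‖ := norm_pos_iff.2 hx
  have e : ((dPsi x : Eu n →L[ℝ] Eu n) : Eu n →ₗ[ℝ] Eu n) = (‖x‖ ^ (-(1/2):ℝ)) •
      (LinearMap.transvection ((((-(1/2)) * (‖x‖^2)⁻¹) • innerSL ℝ x : Eu n →L[ℝ] ℝ) : Eu n →ₗ[ℝ] ℝ) x) := by
    ext1 y
    have : ‖x‖ ^ (-(1/2)-2:ℝ) = ‖x‖ ^ (-(1/2):ℝ) * (‖x‖ ^ 2)⁻¹ := by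
      rw [← Real.rpow_natCast, ← Real.rpow_neg hx'.le, ← Real.rpow_add hx']; congr 1
    simp only [dPsi, LinearMap.transvection.apply, LinearMap.smul_apply, ContinuousLinearMap.coe_coe, add_apply, smul_apply,
      ContinuousLinearMap.id_apply, ContinuousLinearMap.smulRight_apply, this, smul_add, smul_smul, smul_eq_mul]
    congr 2
    ring
  rw [ContinuousLinearMap.det, e, LinearMap.det_smul, LinearMap.transvection.det]
  simp
  field_simp
  norm_num

lemma Psi_injOn {Ω : Set (Eu n)} (hΩ : OC Ω) : InjOn (Psi : Eu n → Eu n) Ω := by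
  intro x hx y hy h
  have hn : ‖x‖ = ‖y‖ := by
    have := congrArg norm h
    rw [norm_Psi (hΩ.ne hx), norm_Psi (hΩ.ne hy)] at this
    exact (Real.rpow_left_inj (norm_nonneg _) (norm_nonneg _) (by norm_num)).1 this
  unfold Psi at h
  rw [hn] at h
  have hy' : 0 < ‖y‖ := norm_pos_iff.2 (hΩ.ne hy)
  exact smul_right_injective _ (Real.rpow_pos_of_pos hy' _).ne' h

lemma Psi_inv {x : Eu n} (hx : x ≠ 0) : Psi (‖x‖ • x) = x := by
  have hx' : 0 < ‖x‖ := norm_pos_iff.2 hx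
  rw [Psi, norm_smul, smul_smul, norm_norm, ← sq]
  have : (‖x‖ ^ 2) ^ (-(1/2):ℝ) = ‖x‖⁻¹ := by
    rw [← Real.rpow_natCast, ← Real.rpow_mul hx'.le]; norm_num
    rw [Real.rpow_neg_one]
  rw [this, inv_mul_cancel₀ hx'.ne', one_smul]

lemma Psi_image {Ω : Set (Eu n)} (hΩ : OC Ω) : (Psi : Eu n → Eu n) '' Ω = Ω := by
  ext y; constructor
  · rintro ⟨x, hx, rfl⟩; exact Psi_mem hΩ hx
  · intro hy
    exact ⟨_, hΩ.smul _ (norm_pos_iff.2 (hΩ.ne hy)) _ hy, Psi_inv (hΩ.ne hy)⟩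

/-- Scale-invariant integral over the cone. -/
def I (Ω : Set (Eu n)) (f : Eu n → ℝ) : ℝ := ∫ x in Ω, ‖x‖ ^ (-(n:ℝ)) * f x

lemma I_Psi {Ω : Set (Eu n)} (hΩ : OC Ω) (f : Eu n → ℝ) : I Ω (fun x => f (Psi x)) = 2 * I Ω f := by
  have h := integral_image_eq_integral_abs_det_fderiv_smul volume hΩ.op.measurableSet
    (fun x hx => (hasFDerivAt_Psi (hΩ.ne hx)).hasFDerivWithinAt) (Psi_injOn hΩ)
    (fun x => ‖x‖ ^ (-(n:ℝ)) * f x)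
  rw [Psi_image hΩ] at h
  unfold I
  rw [h, ← integral_const_mul]
  refine setIntegral_congr_fun hΩ.op.measurableSet fun x hx => ?_
  have hx' : 0 < ‖x‖ := norm_pos_iff.2 (hΩ.ne hx)
  simp only [smul_eq_mul]
  rw [det_dPsi (hΩ.ne hx), abs_of_pos (by positivity), norm_Psi (hΩ.ne hx), ← Real.rpow_natCast, ← Real.rpow_mul hx'.le, ← Real.rpow_mul hx'.le]
  have : ‖x‖ ^ (-(n:ℝ)) = ‖x‖ ^ (-(1/2) * (n:ℝ)) * ‖x‖ ^ (1/2 * -(n:ℝ)) := by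
    rw [← Real.rpow_add hx']; congr 1; ring
  rw [this]; ring

lemma I_congr {Ω : Set (Eu n)} (hΩ : OC Ω) {f g : Eu n → ℝ} (h : EqOn f g Ω) : I Ω f = I Ω g :=
  setIntegral_congr_fun hΩ.op.measurableSet fun x hx => by simp only [h hx]

lemma I_smul {Ω : Set (Eu n)} (hΩ : OC Ω) (f : Eu n → ℝ) {c : ℝ} (hc : 0 < c) : I Ω (fun x => f (c • x)) = I Ω f := by
  have h := Measure.setIntegral_comp_smul_of_pos volume (fun x : Eu n => ‖x‖ ^ (-(n:ℝ)) * f x) Ω hc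
  have hs : c • Ω = Ω := by
    ext y; constructor
    · rintro ⟨x, hx, rfl⟩; exact hΩ.smul c hc x hx
    · intro hy; exact ⟨c⁻¹ • y, hΩ.smul _ (inv_pos.2 hc) _ hy, by simp [smul_smul, hc.ne']⟩
  rw [hs] at h
  unfold I
  have h2 : ∫ x in Ω, ‖c • x‖ ^ (-(n:ℝ)) * f (c • x) = (c^n)⁻¹ * ∫ x in Ω, ‖x‖ ^ (-(n:ℝ)) * f (c • x) := by
    rw [← integral_const_mul]
    refine setIntegral_congr_fun hΩ.op.measurableSet fun x hx => ?_
    simp only [norm_smul]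
    rw [Real.mul_rpow (norm_nonneg _) (norm_nonneg _), Real.norm_of_nonneg hc.le, Real.rpow_neg hc.le, Real.rpow_natCast, mul_assoc]
  rw [h2] at h
  simp only [finrank_euclideanSpace, Fintype.card_fin, smul_eq_mul] at h
  exact mul_left_cancel₀ (by positivity) h
end

noncomputable section
open scoped RealInnerProductSpace Pointwise
variable {n : ℕ} {Ω : Set (Eu n)}

/-- Continuous, bounded, supported in an annulus. -/
structure Tame (Ω : Set (Eu n)) (f : Eu n → ℝ) : Prop where
  cont : ContinuousOn f Ω
  ex : ∃ ε > 0, ∃ R C : ℝ, ∀ x ∈ Ω, |f x| ≤ C ∧ (f x ≠ 0 → ε ≤ ‖x‖ ∧ ‖x‖ ≤ R)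

/-- Continuous and bounded. -/
structure BC (Ω : Set (Eu n)) (f : Eu n → ℝ) : Prop where
  cont : ContinuousOn f Ω
  ex : ∃ C : ℝ, ∀ x ∈ Ω, |f x| ≤ C

lemma Tame.bc {f : Eu n → ℝ} (hf : Tame Ω f) : BC Ω f := by
  obtain ⟨ε, _, R, C, h⟩ := hf.ex
  exact ⟨hf.cont, C, fun x hx => (h x hx).1⟩

lemma BC.one : BC Ω (fun _ => (1:ℝ)) := ⟨continuousOn_const, 1, fun x _ => by simp⟩

lemma Tame.mul_bc {f g : Eu n → ℝ} (hf : Tame Ω f) (hg : BC Ω g) : Tame Ω (fun x => f x * g x) := by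
  obtain ⟨ε, hε, R, C, h⟩ := hf.ex
  obtain ⟨D, hD⟩ := hg.ex
  refine ⟨hf.cont.mul hg.cont, ε, hε, R, C * D, fun x hx => ⟨?_, fun h0 => (h x hx).2 (left_ne_zero_of_mul h0)⟩⟩
  rw [abs_mul]
  exact mul_le_mul (h x hx).1 (hD x hx) (abs_nonneg _) ((abs_nonneg _).trans (h x hx).1)

lemma Tame.mul {f g : Eu n → ℝ} (hf : Tame Ω f) (hg : Tame Ω g) : Tame Ω (fun x => f x * g x) := hf.mul_bc hg.bc

lemma Tame.sq {f : Eu n → ℝ} (hf : Tame Ω f) : Tame Ω (fun x => f x ^ 2) := by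
  simpa only [pow_two] using hf.mul hf

lemma Tame.const_mul {f : Eu n → ℝ} (hf : Tame Ω f) (c : ℝ) : Tame Ω (fun x => c * f x) := by
  have := hf.mul_bc (g := fun _ => c) ⟨continuousOn_const, |c|, fun x _ => le_rfl⟩
  simpa only [mul_comm] using this

lemma Tame.add {f g : Eu n → ℝ} (hf : Tame Ω f) (hg : Tame Ω g) : Tame Ω (fun x => f x + g x) := by
  obtain ⟨ε, hε, R, C, h⟩ := hf.ex
  obtain ⟨ε', hε', R', C', h'⟩ := hg.ex
  refine ⟨hf.cont.add hg.cont, min ε ε', lt_min hε hε', max R R', C + C', fun x hx => ⟨?_, fun h0 => ?_⟩⟩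
  · exact (abs_add_le _ _).trans (add_le_add (h x hx).1 (h' x hx).1)
  · by_cases h1 : f x = 0
    · have h2 : g x ≠ 0 := fun h2 => h0 (by simp [h1, h2])
      exact ⟨(min_le_right _ _).trans ((h' x hx).2 h2).1, ((h' x hx).2 h2).2.trans (le_max_right _ _)⟩
    · exact ⟨(min_le_left _ _).trans ((h x hx).2 h1).1, ((h x hx).2 h1).2.trans (le_max_left _ _)⟩

lemma Tame.sub {f g : Eu n → ℝ} (hf : Tame Ω f) (hg : Tame Ω g) : Tame Ω (fun x => f x - g x) := by
  have := hf.add (hg.const_mul (-1))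
  simpa [sub_eq_add_neg] using this

lemma Tame.zero : Tame Ω (fun _ => (0:ℝ)) := ⟨continuousOn_const, 1, one_pos, 0, 0, fun x _ => by simp⟩

lemma Tame.sum {ι : Type*} (s : Finset ι) {f : ι → Eu n → ℝ} (hf : ∀ i, Tame Ω (f i)) : Tame Ω (fun x => ∑ i ∈ s, f i x) := by
  classical
  induction s using Finset.induction_on with
  | empty => simpa using Tame.zero
  | insert a s ha ih => simp only [Finset.sum_insert ha]; exact (hf a).add ih

lemma Tame.congr (f : Eu n → ℝ) {g : Eu n → ℝ} (hf : Tame Ω f) (h : EqOn g f Ω) : Tame Ω g := by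
  obtain ⟨ε, hε, R, C, h'⟩ := hf.ex
  exact ⟨hf.cont.congr h, ε, hε, R, C, fun x hx => by rw [h hx]; exact h' x hx⟩

lemma Tame.scale (hΩ : OC Ω) {f : Eu n → ℝ} (hf : Tame Ω f) {c : ℝ} (hc : 0 < c) : Tame Ω (fun x => f (c • x)) := by
  obtain ⟨ε, hε, R, C, h⟩ := hf.ex
  refine ⟨hf.cont.comp (by fun_prop) (fun x hx => hΩ.smul c hc x hx), ε / c, by positivity, R / c, C, fun x hx => ?_⟩
  obtain ⟨h1, h2⟩ := h _ (hΩ.smul c hc x hx)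
  refine ⟨h1, fun h0 => ?_⟩
  have := h2 h0
  rw [norm_smul, Real.norm_of_nonneg hc.le] at this
  constructor
  · rw [div_le_iff₀ hc]; linarith [this.1]
  · rw [le_div_iff₀ hc]; linarith [this.2]

lemma annulus_bound_integrable (ε R C : ℝ) :
    Integrable ({x : Eu n | ε ≤ ‖x‖ ∧ ‖x‖ ≤ R}.indicator fun _ => C) (volume.restrict Ω) := by
  have hm : MeasurableSet {x : Eu n | ε ≤ ‖x‖ ∧ ‖x‖ ≤ R} :=
    (measurableSet_le measurable_const measurable_norm).inter (measurableSet_le measurable_norm measurable_const)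
  rw [integrable_indicator_iff hm]
  refine integrableOn_const ?_
  refine ((Measure.restrict_apply_le _ _).trans_lt ?_).ne
  refine (measure_mono (fun x hx => ?_)).trans_lt (measure_closedBall_lt_top (x := (0 : Eu n)) (r := R))
  simpa using hx.2

lemma rp_le {ε : ℝ} (hε : 0 < ε) {x : Eu n} (hx : ε ≤ ‖x‖) : ‖x‖ ^ (-(n:ℝ)) ≤ ε ^ (-(n:ℝ)) :=
  Real.rpow_le_rpow_of_nonpos hε hx (by simp)

lemma wt_cont (hΩ : OC Ω) (m : ℝ) : ContinuousOn (fun x : Eu n => ‖x‖ ^ m) Ω :=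
  continuous_norm.continuousOn.rpow_const fun x hx => Or.inl (norm_ne_zero_iff.2 (hΩ.ne hx))

lemma Tame.integrable (hΩ : OC Ω) {f : Eu n → ℝ} (hf : Tame Ω f) :
    IntegrableOn (fun x => ‖x‖ ^ (-(n:ℝ)) * f x) Ω := by
  obtain ⟨ε, hε, R, C, h⟩ := hf.ex
  refine Integrable.mono' (annulus_bound_integrable (Ω := Ω) ε R (ε ^ (-(n:ℝ)) * C)) ?_ ?_
  · exact ((wt_cont hΩ _).mul hf.cont).aestronglyMeasurable hΩ.op.measurableSet
  · refine (ae_restrict_iff' hΩ.op.measurableSet).2 (Eventually.of_forall fun x hx => ?_)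
    by_cases h0 : f x = 0
    · simp only [h0, mul_zero, norm_zero]
      refine indicator_nonneg (fun y _ => ?_) x
      exact mul_nonneg (by positivity) ((abs_nonneg _).trans (h x hx).1)
    · rw [indicator_of_mem (show x ∈ {x : Eu n | ε ≤ ‖x‖ ∧ ‖x‖ ≤ R} from (h x hx).2 h0), norm_mul, Real.norm_of_nonneg (by positivity)]
      exact mul_le_mul (rp_le hε ((h x hx).2 h0).1) (h x hx).1 (norm_nonneg _) (by positivity)

lemma I_add (hΩ : OC Ω) {f g : Eu n → ℝ} (hf : Tame Ω f) (hg : Tame Ω g) :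
    I Ω (fun x => f x + g x) = I Ω f + I Ω g := by
  unfold I
  rw [← integral_add (hf.integrable hΩ) (hg.integrable hΩ)]
  simp only [mul_add]

lemma I_sub (hΩ : OC Ω) {f g : Eu n → ℝ} (hf : Tame Ω f) (hg : Tame Ω g) :
    I Ω (fun x => f x - g x) = I Ω f - I Ω g := by
  unfold I
  rw [← integral_sub (hf.integrable hΩ) (hg.integrable hΩ)]
  simp only [mul_sub]

lemma I_const_mul (f : Eu n → ℝ) (c : ℝ) : I Ω (fun x => c * f x) = c * I Ω f := by
  unfold I
  rw [← integral_const_mul]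
  simp only [mul_left_comm]

lemma I_sum (hΩ : OC Ω) {ι : Type*} (s : Finset ι) {f : ι → Eu n → ℝ} (hf : ∀ i, Tame Ω (f i)) :
    I Ω (fun x => ∑ i ∈ s, f i x) = ∑ i ∈ s, I Ω (f i) := by
  unfold I
  rw [← integral_finsetSum s (fun i _ => (hf i).integrable hΩ)]
  simp only [Finset.mul_sum]

lemma I_nonneg (hΩ : OC Ω) {f : Eu n → ℝ} (hf : ∀ x ∈ Ω, 0 ≤ f x) : 0 ≤ I Ω f :=
  setIntegral_nonneg hΩ.op.measurableSet fun x hx => mul_nonneg (by positivity) (hf x hx)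

lemma I_mono (hΩ : OC Ω) {f g : Eu n → ℝ} (hf : Tame Ω f) (hg : Tame Ω g) (h : ∀ x ∈ Ω, f x ≤ g x) : I Ω f ≤ I Ω g :=
  setIntegral_mono_on (hf.integrable hΩ) (hg.integrable hΩ) hΩ.op.measurableSet fun x hx =>
    mul_le_mul_of_nonneg_left (h x hx) (by positivity)

lemma hasDerivAt_dil {f : Eu n → ℝ} {x : Eu n} (t : ℝ) (hf : DifferentiableAt ℝ f (Real.exp t • x)) :
    HasDerivAt (fun s : ℝ => f (Real.exp s • x)) (Ed f (Real.exp t • x)) t := by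
  have h1 : HasDerivAt (fun s : ℝ => Real.exp s • x) (Real.exp t • x) t := (Real.hasDerivAt_exp t).smul_const x
  exact hf.hasFDerivAt.comp_hasDerivAt t h1

lemma hasDerivAt_I (hΩ : OC Ω) {f g : Eu n → ℝ} (hf : ContDiffOn ℝ 1 f Ω) (hf0 : Tame Ω f) (hf1 : Tame Ω (Ed f))
    (hg : BC Ω g) (t : ℝ) : HasDerivAt (fun s : ℝ => I Ω (fun x => f (Real.exp s • x) * g x))
      (I Ω (fun x => Ed f (Real.exp t • x) * g x)) t := by
  obtain ⟨ε, hε, R, C, h⟩ := hf1.ex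
  obtain ⟨D, hD⟩ := hg.ex
  have hk : 0 < ε * Real.exp (-t-1) := by positivity
  have := hasDerivAt_integral_of_dominated_loc_of_deriv_le (μ := volume.restrict Ω)
    (F := fun s x => ‖x‖ ^ (-(n:ℝ)) * (f (Real.exp s • x) * g x))
    (F' := fun s x => ‖x‖ ^ (-(n:ℝ)) * (Ed f (Real.exp s • x) * g x))
    (x₀ := t) (s := Ioo (t-1) (t+1))
    (bound := {x : Eu n | ε * Real.exp (-t-1) ≤ ‖x‖ ∧ ‖x‖ ≤ R * Real.exp (-t+1)}.indicator fun _ =>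
      (ε * Real.exp (-t-1)) ^ (-(n:ℝ)) * (C * D))
    (Ioo_mem_nhds (by linarith) (by linarith)) ?_ ?_ ?_ ?_ ?_ ?_
  · exact this.2
  · exact Eventually.of_forall fun s => (((hf0.scale hΩ (Real.exp_pos s)).mul_bc hg).integrable hΩ).aestronglyMeasurable
  · exact ((hf0.scale hΩ (Real.exp_pos t)).mul_bc hg).integrable hΩ
  · exact (((hf1.scale hΩ (Real.exp_pos t)).mul_bc hg).integrable hΩ).aestronglyMeasurable
  · refine (ae_restrict_iff' hΩ.op.measurableSet).2 (Eventually.of_forall fun x hx s hs => ?_)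
    obtain ⟨h1, h2⟩ := h _ (hΩ.smul _ (Real.exp_pos s) x hx)
    have hC : 0 ≤ C := (abs_nonneg _).trans h1
    have hD0 : 0 ≤ D := (abs_nonneg _).trans (hD x hx)
    by_cases h0 : Ed f (Real.exp s • x) = 0
    · simp only [h0, mul_zero, zero_mul, norm_zero]
      exact indicator_nonneg (fun y _ => by positivity) x
    · have h3 := h2 h0
      rw [norm_smul, Real.norm_of_nonneg (Real.exp_pos s).le] at h3
      have hxn : ‖x‖ = (Real.exp s * ‖x‖) * Real.exp (-s) := by
        rw [mul_right_comm, ← Real.exp_add]; simp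
      have hR : 0 ≤ R := (by positivity : 0 ≤ Real.exp s * ‖x‖).trans h3.2
      have hmem : x ∈ {x : Eu n | ε * Real.exp (-t-1) ≤ ‖x‖ ∧ ‖x‖ ≤ R * Real.exp (-t+1)} := by
        constructor
        · rw [hxn]
          exact mul_le_mul h3.1 (Real.exp_le_exp.2 (by linarith [hs.2])) (Real.exp_pos _).le (by positivity)
        · rw [hxn]
          exact mul_le_mul h3.2 (Real.exp_le_exp.2 (by linarith [hs.1])) (Real.exp_pos _).le hR
      rw [indicator_of_mem hmem, norm_mul, norm_mul, Real.norm_of_nonneg (by positivity)]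
      exact mul_le_mul (rp_le hk hmem.1) (mul_le_mul h1 (hD x hx) (norm_nonneg _) hC) (by positivity) (by positivity)
  · exact annulus_bound_integrable _ _ _
  · refine (ae_restrict_iff' hΩ.op.measurableSet).2 (Eventually.of_forall fun x hx s hs => ?_)
    exact ((hasDerivAt_dil s (C1_diff hΩ.op hf (hΩ.smul _ (Real.exp_pos s) x hx))).mul_const _).const_mul _

lemma I_Ed (hΩ : OC Ω) {f : Eu n → ℝ} (hf : ContDiffOn ℝ 1 f Ω) (hf0 : Tame Ω f) (hf1 : Tame Ω (Ed f)) :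
    I Ω (Ed f) = 0 := by
  have h := hasDerivAt_I hΩ hf hf0 hf1 BC.one 0
  simp only [mul_one, Real.exp_zero, one_smul] at h
  have e : (fun s : ℝ => I Ω (fun x => f (Real.exp s • x))) = fun _ => I Ω f := by
    funext s; exact I_smul hΩ f (Real.exp_pos s)
  rw [e] at h
  exact h.unique (hasDerivAt_const _ _)
end

noncomputable section
open scoped RealInnerProductSpace Pointwise
variable {n : ℕ} {Ω : Set (Eu n)}

lemma Tame.abs {f : Eu n → ℝ} (hf : Tame Ω f) : Tame Ω (fun x => |f x|) := by
  obtain ⟨ε, hε, R, C, h⟩ := hf.ex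
  exact ⟨hf.cont.abs, ε, hε, R, C, fun x hx => ⟨by simpa using (h x hx).1, fun h0 => (h x hx).2 (abs_ne_zero.1 h0)⟩⟩

/-- Derivative of the truncation function. -/
def mcut (ε t : ℝ) : ℝ := max 0 (t^2 - ε^2) / max (t^2) (ε^2)

/-- Truncation function. -/
def cut (ε y : ℝ) : ℝ := ∫ t in (0:ℝ)..y, mcut ε t

lemma mcut_cont {ε : ℝ} (hε : 0 < ε) : Continuous (mcut ε) := by
  refine Continuous.div (by fun_prop) (by fun_prop) fun t => ?_
  have : 0 < ε^2 := by positivity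
  exact (lt_max_of_lt_right this).ne'

lemma mcut_nonneg (ε t : ℝ) : 0 ≤ mcut ε t :=
  div_nonneg (le_max_left _ _) (le_max_of_le_left (sq_nonneg _))

lemma mcut_le {ε : ℝ} (hε : 0 < ε) (t : ℝ) : mcut ε t ≤ 1 := by
  have : 0 < ε^2 := by positivity
  rw [mcut, div_le_one (lt_max_of_lt_right this)]
  refine max_le (le_max_of_le_left (sq_nonneg _)) (le_max_of_le_left (by linarith))

lemma mcut_zero {ε t : ℝ} (h : |t| ≤ ε) : mcut ε t = 0 := by
  have : t^2 ≤ ε^2 := sq_le_sq' (by linarith [neg_abs_le t]) ((le_abs_self t).trans h)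
  rw [mcut, max_eq_left (by linarith), zero_div]

lemma cut_hasDerivAt {ε : ℝ} (hε : 0 < ε) (y : ℝ) : HasDerivAt (cut ε) (mcut ε y) y :=
  ((mcut_cont hε).integral_hasStrictDerivAt 0 y).hasDerivAt

lemma cut_contDiff {ε : ℝ} (hε : 0 < ε) : ContDiff ℝ 1 (cut ε) := by
  rw [contDiff_one_iff_deriv]
  refine ⟨fun y => (cut_hasDerivAt hε y).differentiableAt, ?_⟩
  have : deriv (cut ε) = mcut ε := funext fun y => (cut_hasDerivAt hε y).deriv
  rw [this]; exact mcut_cont hε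

lemma cut_abs_le {ε : ℝ} (hε : 0 < ε) (y : ℝ) : |cut ε y| ≤ |y| := by
  have := intervalIntegral.norm_integral_le_of_norm_le_const (a := 0) (b := y) (C := 1) (f := mcut ε)
    (fun t _ => by rw [Real.norm_of_nonneg (mcut_nonneg _ _)]; exact mcut_le hε t)
  simpa [cut] using this

lemma cut_zero {ε y : ℝ} (h : |y| ≤ ε) : cut ε y = 0 := by
  unfold cut
  have : ∀ t ∈ Set.uIcc 0 y, mcut ε t = 0 := fun t ht => mcut_zero <| by
    have := Set.abs_sub_left_of_mem_uIcc ht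
    simpa using this.trans (by simpa using h)
  rw [intervalIntegral.integral_congr this]; simp

/-- The sequence of truncation parameters. -/
def ek (k : ℕ) : ℝ := 1 / ((k:ℝ) + 1)

lemma ek_pos (k : ℕ) : 0 < ek k := Nat.one_div_pos_of_nat

lemma mcut_tendsto {t : ℝ} (ht : t ≠ 0) : Tendsto (fun k => mcut (ek k) t) atTop (nhds 1) := by
  have h0 : Tendsto ek atTop (nhds 0) := tendsto_one_div_add_atTop_nhds_zero_nat
  have h1 : Tendsto (fun k => mcut (ek k) t) atTop (nhds (max 0 (t^2 - 0^2) / max (t^2) (0^2))) := by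
    unfold mcut
    have ht2 : 0 < t^2 := by positivity
    refine Tendsto.div ?_ ?_ (by simpa using ht)
    · exact tendsto_const_nhds.max (tendsto_const_nhds.sub (h0.pow 2))
    · exact tendsto_const_nhds.max (h0.pow 2)
  have ht2 : 0 < t^2 := by positivity
  have e : max 0 (t^2 - 0^2) / max (t^2) (0^2) = 1 := by
    rw [max_eq_right (by nlinarith), max_eq_left (by nlinarith)]; field_simp; ring
  rwa [e] at h1

lemma cut_tendsto (y : ℝ) : Tendsto (fun k => cut (ek k) y) atTop (nhds y) := by
  have : Tendsto (fun k => ∫ t in (0:ℝ)..y, mcut (ek k) t) atTop (nhds (∫ t in (0:ℝ)..y, (1:ℝ))) := by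
    refine intervalIntegral.tendsto_integral_filter_of_dominated_convergence (fun _ => 1) ?_ ?_ ?_ ?_
    · exact Eventually.of_forall fun k => (mcut_cont (ek_pos k)).aestronglyMeasurable
    · exact Eventually.of_forall fun k => Eventually.of_forall fun t _ => by
        rw [Real.norm_of_nonneg (mcut_nonneg _ _)]; exact mcut_le (ek_pos k) t
    · exact intervalIntegrable_const
    · have : ∀ᵐ t : ℝ, t ≠ 0 := by simp [ae_iff]
      filter_upwards [this] with t ht _ using mcut_tendsto ht
  simpa [cut] using this

lemma I_rot_compact (hΩ : OC Ω) {g : Eu n → ℝ} (hg : ContDiffOn ℝ 1 g Ω) {K : Set (Eu n)} (hK : IsCompact K)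
    (hKΩ : K ⊆ Ω) (h0 : ∀ x ∈ Ω, x ∉ K → g x = 0) (i j : Fin n) : I Ω (Dd (rot i j) g) = 0 := by
  set G : Eu n → ℝ := Ω.indicator (fun x => ‖x‖ ^ (-(n:ℝ)) * g x) with hG
  have hGΩ : EqOn G (fun x => ‖x‖ ^ (-(n:ℝ)) * g x) Ω := fun x hx => indicator_of_mem hx _
  have hGK : ∀ x ∉ K, G x = 0 := fun x hx => by
    by_cases h : x ∈ Ω
    · rw [hGΩ h]; simp [h0 x h hx]
    · exact indicator_of_notMem h _
  have hGc : ContDiff ℝ 1 G := by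
    rw [contDiff_iff_contDiffAt]
    intro x
    by_cases h : x ∈ Ω
    · have : ContDiffAt ℝ 1 (fun x => ‖x‖ ^ (-(n:ℝ)) * g x) x :=
        (contDiffAt_rp _ (hΩ.ne h)).mul (hg.contDiffAt (hΩ.op.mem_nhds h))
      exact this.congr_of_eventuallyEq (hGΩ.eventuallyEq_of_mem (hΩ.op.mem_nhds h))
    · have hx : x ∈ Kᶜ := fun hx => h (hKΩ hx)
      exact contDiffAt_const (c := (0:ℝ)) |>.congr_of_eventuallyEq
        (Filter.eventually_of_mem (hK.isClosed.isOpen_compl.mem_nhds hx) fun y hy => hGK y hy)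
  have hGs : HasCompactSupport G := HasCompactSupport.intro hK hGK
  have hdc : ∀ v, Continuous (fun x => fderiv ℝ G x v) := fun v =>
    (hGc.continuous_fderiv (by norm_num)).clm_apply continuous_const
  have hds : ∀ v, HasCompactSupport (fun x => fderiv ℝ G x v) := fun v => hGs.fderiv_apply (𝕜 := ℝ) v
  have key : ∀ (i : Fin n) (v : Eu n), Integrable (fun x : Eu n => x i * fderiv ℝ G x v) ∧
      ∫ x : Eu n, x i * fderiv ℝ G x v = - ∫ x : Eu n, v i * G x := by
    intro i v
    have hp : Continuous (fun x : Eu n => x i) := (EuclideanSpace.proj (𝕜 := ℝ) i : Eu n →L[ℝ] ℝ).continuous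
    have hpd : ∀ x : Eu n, fderiv ℝ (fun x : Eu n => x i) x v = v i := fun x => by
      have := (EuclideanSpace.proj (𝕜 := ℝ) i : Eu n →L[ℝ] ℝ).hasFDerivAt (x := x)
      have h2 : fderiv ℝ (fun x : Eu n => x i) x = (EuclideanSpace.proj (𝕜 := ℝ) i : Eu n →L[ℝ] ℝ) := this.fderiv
      rw [h2]; rfl
    have hGint : Integrable (fun x : Eu n => x i * fderiv ℝ G x v) :=
      (hp.mul (hdc v)).integrable_of_hasCompactSupport (hds v).mul_left
    refine ⟨hGint, ?_⟩
    have := integral_mul_fderiv_eq_neg_fderiv_mul_of_integrable (μ := (volume : Measure (Eu n)))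
      (f := fun x : Eu n => x i) (g := G) (v := v) ?_ hGint ?_ ?_ ?_
    · rw [this]; simp only [hpd]
    · simp only [hpd]
      exact (continuous_const.mul hGc.continuous).integrable_of_hasCompactSupport hGs.mul_left
    · exact (hp.mul hGc.continuous).integrable_of_hasCompactSupport hGs.mul_left
    · exact fun x _ => (EuclideanSpace.proj (𝕜 := ℝ) i : Eu n →L[ℝ] ℝ).differentiableAt
    · exact fun x _ => hGc.contDiffAt.differentiableAt (by norm_num)
  have hR : ∫ x, Dd (rot i j) G x = 0 := by
    have : ∀ x, Dd (rot i j) G x = x i * fderiv ℝ G x (EuclideanSpace.single j 1)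
        - x j * fderiv ℝ G x (EuclideanSpace.single i 1) := fun x => by
      unfold Dd; rw [rot_apply]; simp
    simp only [this]
    rw [integral_sub (key i _).1 (key j _).1, (key i _).2, (key j _).2]
    by_cases hij : i = j
    · subst hij; ring
    · have hij' : ¬ j = i := fun h => hij h.symm
      simp [hij, hij']
  have hI : I Ω (Dd (rot i j) g) = ∫ x in Ω, Dd (rot i j) G x := by
    unfold I
    refine setIntegral_congr_fun hΩ.op.measurableSet fun x hx => ?_
    rw [Dd_congr hΩ.op hGΩ _ hx, rot_rp_mul _ (hΩ.ne hx) (C1_diff hΩ.op hg hx)]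
  rw [hI, setIntegral_eq_integral_of_forall_compl_eq_zero, hR]
  intro x hx
  have : fderiv ℝ G x = 0 := by
    have hx' : x ∈ Kᶜ := fun h => hx (hKΩ h)
    have he : G =ᶠ[nhds x] fun _ => (0:ℝ) :=
      Filter.eventually_of_mem (hK.isClosed.isOpen_compl.mem_nhds hx') fun y hy => hGK y hy
    rw [he.fderiv_eq]; simp
  simp [Dd, this]

/-- Once differentiable functions vanishing on the boundary. -/
structure Good1 (Ω : Set (Eu n)) (B : Eu n →L[ℝ] Eu n) (v : Eu n → ℝ) : Prop where
  cd : ContDiffOn ℝ 1 v Ω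
  t0 : Tame Ω v
  t1 : Tame Ω (Dd B v)
  bd : Continuous (Ω.indicator v)

/-- Zero set of a function in `Ω`, together with the complement of `Ω`. -/
def Zs (Ω : Set (Eu n)) (v : Eu n → ℝ) : Set (Eu n) := {x | Ω.indicator v x = 0}

lemma green_cut (hΩ : OC Ω) (i j : Fin n) {v g : Eu n → ℝ} (hv : Good1 Ω (rot i j) v) (hg : ContDiffOn ℝ 1 g Ω)
    (hg0 : BC Ω g) (hg1 : BC Ω (Dd (rot i j) g)) :
    I Ω (fun x => (Zs Ω v)ᶜ.indicator (Dd (rot i j) v) x * g x + v x * Dd (rot i j) g x) = 0 := by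
  set B := rot i j with hB
  have hk : ∀ k, I Ω (fun x => mcut (ek k) (v x) * Dd B v x * g x + cut (ek k) (v x) * Dd B g x) = 0 := by
    intro k
    obtain ⟨ε, hε, R, C, h⟩ := hv.t0.ex
    have hcd : ContDiffOn ℝ 1 (fun x => cut (ek k) (v x)) Ω := (cut_contDiff (ek_pos k)).comp_contDiffOn hv.cd
    have hKc : IsCompact {x | ek k ≤ |Ω.indicator v x|} := by
      refine Metric.isCompact_of_isClosed_isBounded (isClosed_le continuous_const hv.bd.abs) ?_
      refine (Metric.isBounded_closedBall (x := (0 : Eu n)) (r := R)).subset fun x hx => ?_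
      have h1 : Ω.indicator v x ≠ 0 := fun h0 => by
        simp [h0] at hx; exact absurd (ek_pos k) (not_lt.2 hx)
      have hxΩ : x ∈ Ω := mem_of_indicator_ne_zero h1
      rw [indicator_of_mem hxΩ] at h1
      simpa using ((h x hxΩ).2 h1).2
    have hKΩ : {x | ek k ≤ |Ω.indicator v x|} ⊆ Ω := fun x hx => by
      by_contra h0
      have hx' : ek k ≤ |Ω.indicator v x| := hx
      rw [indicator_of_notMem h0, abs_zero] at hx'
      exact absurd (ek_pos k) (not_lt.2 hx')
    have := I_rot_compact hΩ (hcd.mul hg) hKc hKΩ ?_ i j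
    · rw [← this]
      refine I_congr hΩ fun x hx => ?_
      have h1 : Dd B (fun x => cut (ek k) (v x)) x = mcut (ek k) (v x) * Dd B v x := by
        unfold Dd
        have := (cut_hasDerivAt (ek_pos k) (v x)).comp_hasFDerivAt x (C1_diff hΩ.op hv.cd hx).hasFDerivAt
        have h2 : fderiv ℝ (fun x => cut (ek k) (v x)) x = _ := this.fderiv
        rw [h2]; simp
      have h3 := Dd_mul (C1_diff hΩ.op hcd hx) (C1_diff hΩ.op hg hx) B
      change _ = Dd B (fun y => cut (ek k) (v y) * g y) x
      rw [h3, h1]; ring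
    · intro x hx hxK
      have : |v x| ≤ ek k := by
        have : ¬ ek k ≤ |Ω.indicator v x| := hxK
        rw [indicator_of_mem hx] at this
        exact (not_le.1 this).le
      change cut (ek k) (v x) * g x = 0
      rw [cut_zero this, zero_mul]
  have hlim : Tendsto (fun k => I Ω (fun x => mcut (ek k) (v x) * Dd B v x * g x + cut (ek k) (v x) * Dd B g x)) atTop
      (nhds (I Ω (fun x => (Zs Ω v)ᶜ.indicator (Dd B v) x * g x + v x * Dd B g x))) := by
    unfold I
    refine tendsto_integral_of_dominated_convergence
      (fun x => ‖x‖ ^ (-(n:ℝ)) * (|Dd B v x * g x| + |v x * Dd B g x|)) ?_ ?_ ?_ ?_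
    · intro k
      refine ContinuousOn.aestronglyMeasurable ?_ hΩ.op.measurableSet
      refine (wt_cont hΩ _).mul (ContinuousOn.add (ContinuousOn.mul (ContinuousOn.mul ?_ hv.t1.cont) hg0.cont) (ContinuousOn.mul ?_ hg1.cont))
      · exact (mcut_cont (ek_pos k)).comp_continuousOn hv.t0.cont
      · exact (cut_contDiff (ek_pos k)).continuous.comp_continuousOn hv.t0.cont
    · exact ((hv.t1.mul_bc hg0).abs.add (hv.t0.mul_bc hg1).abs).integrable hΩ
    · intro k
      refine Eventually.of_forall fun x => ?_
      rw [norm_mul, Real.norm_of_nonneg (by positivity : 0 ≤ ‖x‖ ^ (-(n:ℝ)))]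
      refine mul_le_mul_of_nonneg_left ?_ (by positivity)
      refine (abs_add_le _ _).trans (add_le_add ?_ ?_)
      · rw [mul_assoc, abs_mul]
        refine mul_le_of_le_one_left (abs_nonneg _) ?_
        rw [abs_of_nonneg (mcut_nonneg _ _)]; exact mcut_le (ek_pos k) _
      · rw [abs_mul, abs_mul]
        exact mul_le_mul_of_nonneg_right (cut_abs_le (ek_pos k) _) (abs_nonneg _)
    · refine (ae_restrict_iff' hΩ.op.measurableSet).2 (Eventually.of_forall fun x hx => ?_)
      refine Tendsto.const_mul _ (Tendsto.add (Tendsto.mul_const _ ?_) ((cut_tendsto _).mul_const _))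
      by_cases h0 : v x = 0
      · have : x ∉ (Zs Ω v)ᶜ := fun h => h (by simp [Zs, h0])
        rw [indicator_of_notMem this]
        have : ∀ k, mcut (ek k) (v x) = 0 := fun k => mcut_zero (by rw [h0, abs_zero]; exact (ek_pos k).le)
        simp [this]
      · have : x ∈ (Zs Ω v)ᶜ := fun h => h0 (by
          have h' : Ω.indicator v x = 0 := h
          rwa [indicator_of_mem hx] at h')
        rw [indicator_of_mem this]
        simpa using (mcut_tendsto h0).mul_const (Dd B v x)
  simp only [hk] at hlim
  exact (tendsto_nhds_unique tendsto_const_nhds hlim).symm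

lemma Zs_meas {v : Eu n → ℝ} (hv : Continuous (Ω.indicator v)) : MeasurableSet (Zs Ω v) :=
  (isClosed_eq hv continuous_const).measurableSet

lemma int_ind (hΩ : OC Ω) {f g : Eu n → ℝ} (hf : Tame Ω f) (hg : BC Ω g) {Z : Set (Eu n)} (hZ : MeasurableSet Z) :
    IntegrableOn (fun x => ‖x‖ ^ (-(n:ℝ)) * (Z.indicator f x * g x)) Ω := by
  have := Integrable.indicator ((hf.mul_bc hg).integrable hΩ) hZ
  refine this.congr (Eventually.of_forall fun x => ?_)
  by_cases h : x ∈ Z <;> simp [h]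

lemma ae_zero (hΩ : OC Ω) (i j : Fin n) {v : Eu n → ℝ} (hv : Good1 Ω (rot i j) v) :
    ∀ᵐ x : Eu n, x ∈ Ω → (Zs Ω v).indicator (Dd (rot i j) v) x = 0 := by
  have hZ := Zs_meas hv.bd
  have hZI := int_ind hΩ hv.t1 (BC.one (Ω := Ω)) hZ
  have h := hΩ.op.ae_eq_zero_of_integral_contDiff_smul_eq_zero (μ := volume)
    (f := fun x => ‖x‖ ^ (-(n:ℝ)) * ((Zs Ω v).indicator (Dd (rot i j) v) x * 1)) hZI.locallyIntegrableOn ?_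
  · filter_upwards [h] with x hx hxΩ
    have h1 := hx hxΩ
    have : 0 < ‖x‖ := norm_pos_iff.2 (hΩ.ne hxΩ)
    have : ‖x‖ ^ (-(n:ℝ)) ≠ 0 := (Real.rpow_pos_of_pos this _).ne'
    have h2 := (mul_eq_zero.1 h1).resolve_left this
    rwa [mul_one] at h2
  · intro g hgc hgs hgΩ
    have hg1 : ContDiff ℝ 1 g := hgc.of_le (by exact_mod_cast le_top)
    have hDc : Continuous (Dd (rot i j) g) :=
      (hg1.continuous_fderiv (by norm_num)).clm_apply (rot i j).continuous
    have hDs : HasCompactSupport (Dd (rot i j) g) := by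
      refine HasCompactSupport.intro hgs fun x hx => ?_
      have := hgs.fderiv (𝕜 := ℝ)
      have h2 : fderiv ℝ g x = 0 := by
        by_contra h3
        exact hx (support_fderiv_subset ℝ h3)
      simp [Dd, h2]
    have b0 : BC Ω g := ⟨hgc.continuous.continuousOn, by
      obtain ⟨C, hC⟩ := hgc.continuous.bounded_above_of_compact_support hgs
      exact ⟨C, fun x _ => hC x⟩⟩
    have b1 : BC Ω (Dd (rot i j) g) := ⟨hDc.continuousOn, by
      obtain ⟨C, hC⟩ := hDc.bounded_above_of_compact_support hDs
      exact ⟨C, fun x _ => hC x⟩⟩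
    have e1 := green_cut hΩ i j hv hg1.contDiffOn b0 b1
    have e2 := I_rot_compact hΩ (hv.cd.mul hg1.contDiffOn) (K := tsupport g) hgs hgΩ
      (fun x _ hx => by
        change v x * g x = 0
        rw [image_eq_zero_of_notMem_tsupport hx, mul_zero]) i j
    have e3 : I Ω (Dd (rot i j) (fun x => v x * g x)) = I Ω (fun x => v x * Dd (rot i j) g x + g x * Dd (rot i j) v x) :=
      I_congr hΩ fun x hx => Dd_mul (C1_diff hΩ.op hv.cd hx) (hg1.contDiffAt.differentiableAt (by norm_num)) _
    rw [e3] at e2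
    have e4 : ∫ x in Ω, ‖x‖ ^ (-(n:ℝ)) * ((Zs Ω v).indicator (Dd (rot i j) v) x * g x) = 0 := by
      have i1 := int_ind hΩ hv.t1 b0 hZ.compl
      have i2 := (hv.t0.mul_bc b1).integrable hΩ
      have i3 := (hv.t1.mul_bc b0).integrable hΩ
      have : (fun x => ‖x‖ ^ (-(n:ℝ)) * ((Zs Ω v).indicator (Dd (rot i j) v) x * g x)) =
        fun x => ‖x‖ ^ (-(n:ℝ)) * (v x * Dd (rot i j) g x + g x * Dd (rot i j) v x) -
          ‖x‖ ^ (-(n:ℝ)) * ((Zs Ω v)ᶜ.indicator (Dd (rot i j) v) x * g x + v x * Dd (rot i j) g x) := by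
        funext x
        by_cases h : x ∈ Zs Ω v <;> simp [h] <;> ring
      rw [this, integral_sub]
      · unfold I at e1 e2
        rw [e1, e2, sub_zero]
      · refine (i2.add i3).congr (Eventually.of_forall fun x => ?_)
        simp only [Pi.add_apply]; ring
      · refine (i1.add i2).congr (Eventually.of_forall fun x => ?_)
        simp only [Pi.add_apply]; ring
    rw [setIntegral_eq_integral_of_forall_compl_eq_zero] at e4
    · rw [← e4]
      refine integral_congr_ae (Eventually.of_forall fun x => ?_)
      simp only [smul_eq_mul]; ring
    · intro x hx
      rw [image_eq_zero_of_notMem_tsupport (fun h => hx (hgΩ h))]; ring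

lemma green (hΩ : OC Ω) (i j : Fin n) {v g : Eu n → ℝ} (hv : Good1 Ω (rot i j) v) (hg : ContDiffOn ℝ 1 g Ω)
    (hg0 : BC Ω g) (hg1 : BC Ω (Dd (rot i j) g)) :
    I Ω (fun x => v x * Dd (rot i j) g x) = - I Ω (fun x => Dd (rot i j) v x * g x) := by
  have e1 := green_cut hΩ i j hv hg hg0 hg1
  have e2 : I Ω (fun x => (Zs Ω v)ᶜ.indicator (Dd (rot i j) v) x * g x + v x * Dd (rot i j) g x) =
      I Ω (fun x => Dd (rot i j) v x * g x + v x * Dd (rot i j) g x) := by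
    unfold I
    refine integral_congr_ae ?_
    rw [EventuallyEq, ae_restrict_iff' hΩ.op.measurableSet]
    filter_upwards [ae_zero hΩ i j hv] with x hx hxΩ
    have h1 := hx hxΩ
    by_cases h : x ∈ Zs Ω v
    · rw [indicator_of_mem h] at h1
      simp [h, h1]
    · simp [h]
  rw [e2, I_add hΩ (hv.t1.mul_bc hg0) (hv.t0.mul_bc hg1)] at e1
  linarith
end

noncomputable section
open scoped RealInnerProductSpace Pointwise
variable {n : ℕ} {Ω : Set (Eu n)}

/-- Twice differentiable functions with bounded derivatives, supported in an annulus, zero on the boundary. -/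
structure Good (Ω : Set (Eu n)) (w : Eu n → ℝ) : Prop where
  cd : ContDiffOn ℝ 2 w Ω
  t0 : Tame Ω w
  t1 : ∀ B, Tame Ω (Dd B w)
  t2 : ∀ B C, Tame Ω (Dd C (Dd B w))
  bd : Continuous (Ω.indicator w)

lemma Dd_scale (hΩ : OC Ω) {w : Eu n → ℝ} (hw : ContDiffOn ℝ 2 w Ω) {c : ℝ} (hc : 0 < c) (B : Eu n →L[ℝ] Eu n) :
    EqOn (Dd B (fun x => w (c • x))) (fun x => Dd B w (c • x)) Ω := by
  intro x hx
  have h1 : HasFDerivAt (fun y : Eu n => c • y) (c • ContinuousLinearMap.id ℝ (Eu n)) x :=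
    (hasFDerivAt_id x).const_smul c
  have h2 := ((C2_diff hΩ.op hw (hΩ.smul c hc x hx)).hasFDerivAt.comp x h1).fderiv
  unfold Dd
  change fderiv ℝ (w ∘ fun y : Eu n => c • y) x _ = _
  rw [h2]
  simp

lemma Good.scale (hΩ : OC Ω) {w : Eu n → ℝ} (hw : Good Ω w) {c : ℝ} (hc : 0 < c) (B : Eu n →L[ℝ] Eu n) :
    Good1 Ω B (fun x => w (c • x)) := by
  refine ⟨?_, hw.t0.scale hΩ hc, ((hw.t1 B).scale hΩ hc).congr _ (Dd_scale hΩ hw.cd hc B), ?_⟩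
  · exact (hw.cd.of_le (by norm_num)).comp (contDiff_const_smul c).contDiffOn (fun x hx => hΩ.smul c hc x hx)
  · have : Ω.indicator (fun x => w (c • x)) = fun x => Ω.indicator w (c • x) := by
      funext x
      by_cases h : x ∈ Ω
      · simp [h, hΩ.smul c hc x h]
      · have h' : c • x ∉ Ω := fun h' => h (by simpa [smul_smul, hc.ne'] using hΩ.smul c⁻¹ (inv_pos.2 hc) _ h')
        simp [h, h']
    rw [this]
    exact hw.bd.comp (continuous_const_smul c)

lemma rot_key (hΩ : OC Ω) {w : Eu n → ℝ} (hw : Good Ω w) (i j : Fin n) :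
    I Ω (fun x => Ed w x * Dd (rot i j) (Dd (rot i j) w) x) = 0 ∧
    0 ≤ I Ω (fun x => Ed (Ed w) x * Dd (rot i j) (Dd (rot i j) w) x) := by
  set R := rot i j with hR
  set g := Dd R (Dd R w) with hg
  set F : ℝ → ℝ := fun t => I Ω (fun x => w (Real.exp t • x) * g x) with hF
  have gB : BC Ω g := (hw.t2 R R).bc
  have hgreen : ∀ t, F t = - I Ω (fun x => Dd R w (Real.exp t • x) * Dd R w x) := by
    intro t
    have := green hΩ i j (hw.scale hΩ (Real.exp_pos t) (rot i j)) (Dd_C1 hΩ.op hw.cd R) (hw.t1 R).bc gB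
    refine this.trans ?_
    congr 1
    refine I_congr hΩ fun x hx => ?_
    rw [Dd_scale hΩ hw.cd (Real.exp_pos t) _ hx]
  have hmin : ∀ t, F 0 ≤ F t := by
    intro t
    rw [hgreen, hgreen]
    simp only [Real.exp_zero, one_smul]
    have ha := (hw.t1 R).scale hΩ (Real.exp_pos t)
    have hb := hw.t1 R
    have h1 := I_smul hΩ (fun x => Dd R w x * Dd R w x) (Real.exp_pos t)
    have h0 : 0 ≤ I Ω (fun x => (Dd R w (Real.exp t • x) * Dd R w (Real.exp t • x) + Dd R w x * Dd R w x)
        - 2 * (Dd R w (Real.exp t • x) * Dd R w x)) := I_nonneg hΩ fun x _ => by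
      nlinarith [sq_nonneg (Dd R w (Real.exp t • x) - Dd R w x)]
    rw [I_sub hΩ ((ha.mul ha).add (hb.mul hb)) ((ha.mul hb).const_mul 2), I_add hΩ (ha.mul ha) (hb.mul hb),
      I_const_mul, h1] at h0
    linarith
  have hd1 : ∀ t, HasDerivAt F (I Ω (fun x => Ed w (Real.exp t • x) * g x)) t := fun t =>
    hasDerivAt_I hΩ (hw.cd.of_le (by norm_num)) hw.t0 (hw.t1 _) gB t
  have hd2 : ∀ t, HasDerivAt (fun t => I Ω (fun x => Ed w (Real.exp t • x) * g x))
      (I Ω (fun x => Ed (Ed w) (Real.exp t • x) * g x)) t := fun t =>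
    hasDerivAt_I hΩ (Dd_C1 hΩ.op hw.cd _) (hw.t1 _) (hw.t2 _ _) gB t
  have hlm : IsLocalMin F 0 := Eventually.of_forall hmin
  have hz := hlm.hasDerivAt_eq_zero (hd1 0)
  have hdF : deriv F = fun t => I Ω (fun x => Ed w (Real.exp t • x) * g x) := funext fun t => (hd1 t).deriv
  have hddF : deriv (deriv F) 0 = I Ω (fun x => Ed (Ed w) x * g x) := by
    rw [hdF, (hd2 0).deriv]; simp
  refine ⟨by simpa using hz, ?_⟩
  rw [← hddF]
  by_contra hneg
  push Not at hneg
  have hmax := isLocalMax_of_deriv_deriv_neg hneg (by rw [hdF]; exact hz) (hd1 0).continuousAt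
  have hc : F =ᶠ[nhds 0] fun _ => F 0 := by
    filter_upwards [hmax] with t ht using le_antisymm ht (hmin t)
  have h1 : deriv F =ᶠ[nhds 0] deriv (fun _ => F 0) := hc.deriv
  have h2 := h1.deriv_eq
  simp at h2
  linarith

lemma Sg_tame {w : Eu n → ℝ} (hw : Good Ω w) : Tame Ω (Sg w) :=
  (Tame.sum _ fun i => Tame.sum _ fun j => hw.t2 (rot i j) (rot i j)).const_mul (1/2)

lemma I_Sg (hΩ : OC Ω) {w f : Eu n → ℝ} (hw : Good Ω w) (hf : Tame Ω f) :
    I Ω (fun x => f x * Sg w x) = (1/2) * ∑ i, ∑ j, I Ω (fun x => f x * Dd (rot i j) (Dd (rot i j) w) x) := by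
  have e : (fun x => f x * Sg w x) = fun x => (1/2) * ∑ i, ∑ j, f x * Dd (rot i j) (Dd (rot i j) w) x := by
    funext x
    unfold Sg
    simp only [Finset.mul_sum]
    exact Finset.sum_congr rfl fun i _ => Finset.sum_congr rfl fun j _ => by ring
  have ht : ∀ i j, Tame Ω (fun x => f x * Dd (rot i j) (Dd (rot i j) w) x) := fun i j => hf.mul (hw.t2 _ _)
  rw [e, I_const_mul, I_sum hΩ _ fun i => Tame.sum _ (ht i)]
  congr 1
  exact Finset.sum_congr rfl fun i _ => I_sum hΩ _ (ht i)

lemma Ed_mul_int (hΩ : OC Ω) {f g : Eu n → ℝ} (hf : ContDiffOn ℝ 1 f Ω) (hg : ContDiffOn ℝ 1 g Ω)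
    (tf : Tame Ω f) (tg : Tame Ω g) (tf' : Tame Ω (Ed f)) (tg' : Tame Ω (Ed g)) :
    I Ω (fun x => f x * Ed g x) + I Ω (fun x => g x * Ed f x) = 0 := by
  rw [← I_add hΩ (tf.mul tg') (tg.mul tf')]
  have e : EqOn (Ed (fun y => f y * g y)) (fun x => f x * Ed g x + g x * Ed f x) Ω := fun x hx =>
    Dd_mul (C1_diff hΩ.op hf hx) (C1_diff hΩ.op hg hx) _
  rw [← I_congr hΩ e]
  exact I_Ed hΩ (hf.mul hg) (tf.mul tg) (((tf.mul tg').add (tg.mul tf')).congr _ e)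

lemma main_ineq (hΩ : OC Ω) {w : Eu n → ℝ} (hw : Good Ω w) (c γ : ℝ) (hc : 0 ≤ c^2 + 2*γ) :
    I Ω (fun x => (1/4 * Ed (Ed w) x + c/2 * Ed w x + (Sg w x - γ * w x))^2) + 15/16 * I Ω (fun x => Ed (Ed w) x ^ 2)
      ≤ I Ω (fun x => (Ed (Ed w) x + c * Ed w x + (Sg w x - γ * w x))^2) := by
  have tX : Tame Ω (Ed (Ed w)) := hw.t2 _ _
  have tY : Tame Ω (Ed w) := hw.t1 _
  have tS := Sg_tame hw
  have tw := hw.t0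
  have cw : ContDiffOn ℝ 1 w Ω := hw.cd.of_le (by norm_num)
  have cY : ContDiffOn ℝ 1 (Ed w) Ω := Dd_C1 hΩ.op hw.cd _
  have hXY := Ed_mul_int hΩ cY cY tY tY tX tX
  have hYw := Ed_mul_int hΩ cw cw tw tw tY tY
  have hXw := Ed_mul_int hΩ cw cY tw tY tY tX
  have hYS : I Ω (fun x => Ed w x * Sg w x) = 0 := by
    rw [I_Sg hΩ hw tY]; simp [(rot_key hΩ hw _ _).1]
  have hXS : 0 ≤ I Ω (fun x => Ed (Ed w) x * Sg w x) := by
    rw [I_Sg hΩ hw tX]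
    exact mul_nonneg (by norm_num) (Finset.sum_nonneg fun i _ => Finset.sum_nonneg fun j _ => (rot_key hΩ hw i j).2)
  have hYY : 0 ≤ I Ω (fun x => Ed w x * Ed w x) := I_nonneg hΩ fun x _ => mul_self_nonneg _
  set X := Ed (Ed w)
  set Y := Ed w
  set S := Sg w
  have tA : Tame Ω (fun x => (1/4 * X x + c/2 * Y x + (S x - γ * w x))^2) :=
    (((tX.const_mul _).add (tY.const_mul _)).add (tS.sub (tw.const_mul _))).sq
  have tB := (((((tX.sq.const_mul (15/16)).add ((tY.mul tY).const_mul (3/4*c^2))).add ((tY.mul tX).const_mul (7/4*c))).add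
    ((tX.mul tS).const_mul (3/2))).add ((tY.mul tS).const_mul c)).add
      (((tw.mul tX).const_mul (-(3/2*γ))).add ((tw.mul tY).const_mul (-(c*γ))))
  have e1 := I_add hΩ tA tB
  have e := (I_congr hΩ (f := fun x => (X x + c * Y x + (S x - γ * w x))^2) fun x _ => by ring).trans e1
  have e2 := I_add hΩ (((((tX.sq.const_mul (15/16)).add ((tY.mul tY).const_mul (3/4*c^2))).add ((tY.mul tX).const_mul (7/4*c))).add
    ((tX.mul tS).const_mul (3/2))).add ((tY.mul tS).const_mul c))
      (((tw.mul tX).const_mul (-(3/2*γ))).add ((tw.mul tY).const_mul (-(c*γ))))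
  rw [e, e2, I_add hΩ ((((tX.sq.const_mul (15/16)).add ((tY.mul tY).const_mul (3/4*c^2))).add ((tY.mul tX).const_mul (7/4*c))).add
    ((tX.mul tS).const_mul (3/2))) ((tY.mul tS).const_mul c),
    I_add hΩ (((tX.sq.const_mul (15/16)).add ((tY.mul tY).const_mul (3/4*c^2))).add ((tY.mul tX).const_mul (7/4*c)))
    ((tX.mul tS).const_mul (3/2)), I_add hΩ ((tX.sq.const_mul (15/16)).add ((tY.mul tY).const_mul (3/4*c^2))) ((tY.mul tX).const_mul (7/4*c)),
    I_add hΩ (tX.sq.const_mul (15/16)) ((tY.mul tY).const_mul (3/4*c^2)),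
    I_add hΩ ((tw.mul tX).const_mul (-(3/2*γ))) ((tw.mul tY).const_mul (-(c*γ)))]
  simp only [I_const_mul]
  have h1 : I Ω (fun x => Y x * X x) = 0 := by linarith
  have h2 : I Ω (fun x => w x * Y x) = 0 := by linarith
  have h3 : I Ω (fun x => w x * X x) = - I Ω (fun x => Y x * Y x) := by linarith
  rw [h1, h2, h3, hYS]
  nlinarith [mul_nonneg hc hYY]
end

noncomputable section
open scoped RealInnerProductSpace Pointwise
variable {n : ℕ} {Ω : Set (Eu n)}

lemma local_bound (hΩ : IsOpen Ω) {f : Eu n → ℝ} (hf : ContDiffOn ℝ 2 f (closure Ω)) {x0 : Eu n}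
    (hx0 : x0 ∈ closure Ω) (k : ℕ) (hk : k ≤ 2) :
    ∃ V ∈ nhds x0, ∃ C : ℝ, ∀ y ∈ Ω ∩ V, ‖iteratedFDeriv ℝ k f y‖ ≤ C := by
  have h := hf x0 hx0
  obtain ⟨U, hU, p, hp⟩ := (contDiffWithinAt_nat (n := 2)).1 h
  rw [insert_eq_of_mem hx0] at hU
  have hx0U : x0 ∈ U := mem_of_mem_nhdsWithin hx0 hU
  obtain ⟨V, hVo, hxV, hVU⟩ := mem_nhdsWithin.1 hU
  have hk' : ((k : ℕ) : WithTop ℕ∞) ≤ ((2:ℕ) : WithTop ℕ∞) := by exact_mod_cast hk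
  have hc := (hp.cont k hk') x0 hx0U
  have hb : ∀ᶠ y in nhdsWithin x0 U, ‖p y k‖ < ‖p x0 k‖ + 1 :=
    hc.norm.eventually (gt_mem_nhds (by linarith))
  obtain ⟨W, hWo, hxW, hW⟩ := mem_nhdsWithin.1 hb
  refine ⟨V ∩ W, (hVo.inter hWo).mem_nhds ⟨hxV, hxW⟩, ‖p x0 k‖ + 1, ?_⟩
  rintro y ⟨hyΩ, hyV, hyW⟩
  have hyU : y ∈ U := hVU ⟨hyV, subset_closure hyΩ⟩
  have ho : IsOpen (Ω ∩ V) := hΩ.inter hVo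
  have hp' := hp.mono (show Ω ∩ V ⊆ U from fun z hz => hVU ⟨hz.2, subset_closure hz.1⟩)
  have e1 := hp'.eq_iteratedFDerivWithin_of_uniqueDiffOn hk' ho.uniqueDiffOn ⟨hyΩ, hyV⟩
  rw [iteratedFDerivWithin_of_isOpen k ho ⟨hyΩ, hyV⟩] at e1
  rw [← e1]
  exact (hW ⟨hyW, hyU⟩).le

lemma ball_bound (hΩ : IsOpen Ω) {f : Eu n → ℝ} (hf : ContDiffOn ℝ 2 f (closure Ω)) (R : ℝ) (k : ℕ) (hk : k ≤ 2) :
    ∃ C : ℝ, ∀ y ∈ Ω, ‖y‖ ≤ R → ‖iteratedFDeriv ℝ k f y‖ ≤ C := by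
  have hK : IsCompact (closure Ω ∩ closedBall 0 R) := (isCompact_closedBall 0 R).inter_left isClosed_closure
  have := hK.induction_on (p := fun t => ∃ C : ℝ, ∀ y ∈ Ω ∩ t, ‖iteratedFDeriv ℝ k f y‖ ≤ C)
    ⟨0, by simp⟩ (fun s t hst ⟨C, hC⟩ => ⟨C, fun y hy => hC y ⟨hy.1, hst hy.2⟩⟩)
    (fun s t ⟨C, hC⟩ ⟨D, hD⟩ => ⟨max C D, fun y hy => by
      rcases hy.2 with h | h
      · exact (hC y ⟨hy.1, h⟩).trans (le_max_left _ _)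
      · exact (hD y ⟨hy.1, h⟩).trans (le_max_right _ _)⟩)
    (fun x hx => by
      obtain ⟨V, hV, C, hC⟩ := local_bound hΩ hf hx.1 k hk
      exact ⟨V, mem_nhdsWithin_of_mem_nhds hV, C, hC⟩)
  obtain ⟨C, hC⟩ := this
  exact ⟨C, fun y hy hR => hC y ⟨hy, subset_closure hy, by simpa using hR⟩⟩

lemma Dd_zero_of {f : Eu n → ℝ} {x : Eu n} (h : f =ᶠ[nhds x] fun _ => 0) (B : Eu n →L[ℝ] Eu n) :
    Dd B f =ᶠ[nhds x] fun _ => 0 := by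
  filter_upwards [h.eventuallyEq_nhds] with y hy
  unfold Dd; rw [hy.fderiv_eq]; simp

lemma good_of_navier (hΩ : OC Ω) {w : Eu n → ℝ} (hw : NavierAdm Ω w) : Good Ω w := by
  obtain ⟨h1, h2, ⟨ε, hε, h3⟩, R, h4⟩ := hw
  have hcd : ContDiffOn ℝ 2 w Ω := h1.mono subset_closure
  have hz : ∀ x, (‖x‖ < ε ∨ R < ‖x‖) → w =ᶠ[nhds x] fun _ => 0 := by
    rintro x (h | h)
    · filter_upwards [(isOpen_lt continuous_norm continuous_const).mem_nhds h] with y hy using h3 y hy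
    · filter_upwards [(isOpen_lt continuous_const continuous_norm).mem_nhds h] with y hy using h4 y hy
  obtain ⟨C0, hC0⟩ := ball_bound hΩ.op h1 R 0 (by norm_num)
  obtain ⟨C1, hC1⟩ := ball_bound hΩ.op h1 R 1 (by norm_num)
  obtain ⟨C2, hC2⟩ := ball_bound hΩ.op h1 R 2 (by norm_num)
  have key : ∀ {f : Eu n → ℝ} (_ : ContinuousOn f Ω) (_ : ∀ x, (‖x‖ < ε ∨ R < ‖x‖) → f x = 0) (C : ℝ)
      (_ : ∀ x ∈ Ω, ‖x‖ ≤ R → |f x| ≤ C), Tame Ω f := by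
    intro f hf hf0 C hC
    refine ⟨hf, ε, hε, R, max C 0, fun x hx => ⟨?_, fun h0 => ?_⟩⟩
    · by_cases h : ‖x‖ ≤ R
      · exact (hC x hx h).trans (le_max_left _ _)
      · rw [hf0 x (Or.inr (not_le.1 h))]; simp
    · by_contra hn
      rw [not_and_or, not_le, not_le] at hn
      exact h0 (hf0 x hn)
  refine ⟨hcd, ?_, ?_, ?_, continuous_indicator h2 h1.continuousOn⟩
  · refine key hcd.continuousOn (fun x hx => (hz x hx).eq_of_nhds) C0 fun x hx hR => ?_
    simpa using hC0 x hx hR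
  · intro B
    refine key (Dd_C1 hΩ.op hcd B).continuousOn (fun x hx => (Dd_zero_of (hz x hx) B).eq_of_nhds) (C1 * (‖B‖ * R)) fun x hx hR => ?_
    have a1 := hC1 x hx hR
    rw [norm_iteratedFDeriv_one] at a1
    have hB := B.le_opNorm_of_le hR
    exact (ContinuousLinearMap.le_opNorm _ _).trans (mul_le_mul a1 hB (norm_nonneg _) ((norm_nonneg _).trans a1))
  · intro B C
    refine key ?_ (fun x hx => (Dd_zero_of (Dd_zero_of (hz x hx) B) C).eq_of_nhds)
      (C2 * ((‖C‖ * R) * (‖B‖ * R)) + C1 * (‖B‖ * (‖C‖ * R))) fun x hx hR => ?_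
    · exact (Dd_contDiffOn (m := 0) hΩ.op (by norm_num) (Dd_C1 hΩ.op hcd B) C).continuousOn
    rw [Dd_Dd (hcd.contDiffAt (hΩ.op.mem_nhds hx))]
    have a1 := hC1 x hx hR
    have a2 := hC2 x hx hR
    rw [norm_iteratedFDeriv_one] at a1
    have hB := B.le_opNorm_of_le hR
    have hC := C.le_opNorm_of_le hR
    refine (abs_add_le _ _).trans (add_le_add ?_ ?_)
    · have := (iteratedFDeriv ℝ 2 w x).le_opNorm ![C x, B x]
      rw [iteratedFDeriv_two_apply] at this
      simp only [Fin.prod_univ_two, Matrix.cons_val_zero, Matrix.cons_val_one] at this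
      refine this.trans (mul_le_mul a2 (mul_le_mul hC hB (norm_nonneg _) ((norm_nonneg _).trans hC)) (by positivity) ((norm_nonneg _).trans a2))
    · exact (ContinuousLinearMap.le_opNorm _ _).trans (mul_le_mul a1 (B.le_opNorm_of_le hC) (norm_nonneg _) ((norm_nonneg _).trans a1))

lemma navier_rp (m : ℝ) {u : Eu n → ℝ} (hu : NavierAdm Ω u) : NavierAdm Ω (fun x => ‖x‖ ^ m * u x) := by
  obtain ⟨h1, h2, ⟨ε, hε, h3⟩, R, h4⟩ := hu
  refine ⟨?_, fun x hx => by simp [h2 x hx], ⟨ε, hε, fun x hx => by simp [h3 x hx]⟩, R, fun x hx => by simp [h4 x hx]⟩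
  intro x hx
  by_cases h : x = 0
  · have : (fun x : Eu n => ‖x‖ ^ m * u x) =ᶠ[nhds x] fun _ => 0 := by
      have hm : ‖x‖ < ε := by simpa [h] using hε
      filter_upwards [(isOpen_lt continuous_norm continuous_const).mem_nhds hm] with y hy
      simp [h3 y hy]
    exact (contDiffAt_const.congr_of_eventuallyEq this).contDiffWithinAt
  · exact (contDiffAt_rp m h).contDiffWithinAt.mul (h1 x hx)

lemma smul_closure (hΩ : OC Ω) {c : ℝ} (hc : 0 < c) {x : Eu n} (hx : x ∈ closure Ω) : c • x ∈ closure Ω :=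
  map_mem_closure (continuous_const_smul c) hx (fun y hy => hΩ.smul c hc y hy)

lemma smul_frontier (hΩ : OC Ω) {c : ℝ} (hc : 0 < c) {x : Eu n} (hx : x ∈ frontier Ω) : c • x ∈ frontier Ω := by
  rw [hΩ.op.frontier_eq] at *
  refine ⟨smul_closure hΩ hc hx.1, fun h => hx.2 ?_⟩
  simpa [smul_smul, hc.ne'] using hΩ.smul c⁻¹ (inv_pos.2 hc) _ h

/-- Half stretch. -/
def half (m : ℝ) (u : Eu n → ℝ) (x : Eu n) : ℝ := ‖x‖ ^ (-m/2) * u (Psi x)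

lemma half_zero (m : ℝ) {u : Eu n → ℝ} {ε : ℝ} (hε : 0 < ε) (h : ∀ x, ‖x‖ < ε → u x = 0) :
    ∃ δ > 0, ∀ x : Eu n, ‖x‖ < δ → half m u x = 0 := by
  refine ⟨ε ^ 2, by positivity, fun x hx => ?_⟩
  unfold half
  by_cases h0 : x = 0
  · have : Psi x = 0 := by simp [h0, Psi]
    rw [this, h 0 (by simpa using hε), mul_zero]
  · rw [h _ ?_, mul_zero]
    rw [norm_Psi h0, ← Real.sqrt_eq_rpow]
    exact (Real.sqrt_lt' hε).2 hx

lemma half_zero' (m : ℝ) {u : Eu n → ℝ} {R : ℝ} (h : ∀ x, R < ‖x‖ → u x = 0) :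
    ∃ R' : ℝ, ∀ x : Eu n, R' < ‖x‖ → half m u x = 0 := by
  refine ⟨(max R 0) ^ 2, fun x hx => ?_⟩
  unfold half
  have h0 : x ≠ 0 := norm_pos_iff.1 (lt_of_le_of_lt (sq_nonneg _) hx)
  rw [h _ ?_, mul_zero]
  rw [norm_Psi h0, ← Real.sqrt_eq_rpow]
  exact (le_max_left _ _).trans_lt ((Real.lt_sqrt (le_max_right _ _)).2 hx)

lemma half_zero_nhds (m : ℝ) {u : Eu n → ℝ} {ε : ℝ} (hε : 0 < ε) (h : ∀ x, ‖x‖ < ε → u x = 0) :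
    half m u =ᶠ[nhds 0] fun _ => 0 := by
  obtain ⟨δ, hδ, h⟩ := half_zero m hε h
  filter_upwards [(isOpen_lt continuous_norm continuous_const).mem_nhds (show ‖(0 : Eu n)‖ < δ by simpa using hδ)] with y hy
  exact h y hy

lemma half_navier (hΩ : OC Ω) (m : ℝ) {u : Eu n → ℝ} (hu : NavierAdm Ω u) : NavierAdm Ω (half m u) := by
  obtain ⟨h1, h2, ⟨ε, hε, h3⟩, R, h4⟩ := hu
  refine ⟨?_, fun x hx => ?_, half_zero m hε h3, half_zero' m h4⟩
  · intro x hx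
    by_cases h : x = 0
    · have := half_zero_nhds m hε h3
      rw [← h] at this
      exact (contDiffAt_const.congr_of_eventuallyEq this).contDiffWithinAt
    · refine (contDiffAt_rp _ h).contDiffWithinAt.mul ?_
      have hn : ‖x‖ ^ (-(1/2) : ℝ) > 0 := Real.rpow_pos_of_pos (norm_pos_iff.2 h) _
      refine ContDiffWithinAt.comp_of_mem_nhdsWithin_image x (h1 (Psi x) (smul_closure hΩ hn hx)) (contDiffAt_Psi h).contDiffWithinAt ?_
      refine mem_of_superset self_mem_nhdsWithin ?_
      rintro _ ⟨y, hy, rfl⟩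
      by_cases hy0 : y = 0
      · rw [hy0] at hy ⊢; simpa [Psi] using hy
      · exact smul_closure hΩ (Real.rpow_pos_of_pos (norm_pos_iff.2 hy0) _) hy
  · unfold half
    by_cases h : x = 0
    · have : Psi x = 0 := by simp [h, Psi]
      rw [this, h3 0 (by simpa using hε), mul_zero]
    · rw [h2 (Psi x) (smul_frontier hΩ (Real.rpow_pos_of_pos (norm_pos_iff.2 h) _) hx), mul_zero]

lemma dir_navier (hΩ : OC Ω) {u : Eu n → ℝ} (hu : DirichletAdm Ω u) : NavierAdm Ω u := by
  obtain ⟨h1, h2, h3⟩ := hu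
  refine ⟨h1.contDiffOn, fun x hx => ?_, ?_, ?_⟩
  · rw [hΩ.op.frontier_eq] at hx
    exact image_eq_zero_of_notMem_tsupport fun h => hx.2 (h3 h)
  · have : (0 : Eu n) ∉ tsupport u := fun h => hΩ.zero (h3 h)
    obtain ⟨ε, hε, h⟩ := Metric.isOpen_iff.1 (isClosed_tsupport u).isOpen_compl 0 this
    exact ⟨ε, hε, fun x hx => image_eq_zero_of_notMem_tsupport (h (by simpa using hx))⟩
  · obtain ⟨R, hR⟩ := h2.isCompact.isBounded.subset_closedBall 0
    exact ⟨R, fun x hx => image_eq_zero_of_notMem_tsupport fun h => by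
      have := hR h; simp at this; linarith⟩

lemma half_dir (hΩ : OC Ω) (m : ℝ) {u : Eu n → ℝ} (hu : DirichletAdm Ω u) : DirichletAdm Ω (half m u) := by
  obtain ⟨-, -, ⟨ε, hε, h3⟩, -⟩ := dir_navier hΩ hu
  obtain ⟨h1, h2, h4⟩ := hu
  have hc : Continuous (fun y : Eu n => ‖y‖ • y) := by fun_prop
  have hK : IsCompact ((fun y : Eu n => ‖y‖ • y) '' tsupport u) := h2.isCompact.image hc
  have hs : Function.support (half m u) ⊆ (fun y : Eu n => ‖y‖ • y) '' tsupport u := by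
    intro x hx
    have hx' : u (Psi x) ≠ 0 := right_ne_zero_of_mul hx
    have h0 : x ≠ 0 := by
      rintro rfl
      exact hx' (h3 _ (by simpa [Psi] using hε))
    refine ⟨Psi x, subset_tsupport _ hx', ?_⟩
    have hp := norm_pos_iff.2 h0
    simp only [norm_Psi h0]
    rw [Psi, smul_smul, ← Real.rpow_add hp]
    norm_num
  have hs' : tsupport (half m u) ⊆ (fun y : Eu n => ‖y‖ • y) '' tsupport u :=
    closure_minimal hs hK.isClosed
  refine ⟨?_, HasCompactSupport.of_support_subset_isCompact hK hs, hs'.trans ?_⟩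
  · rw [contDiff_iff_contDiffAt]
    intro x
    by_cases h : x = 0
    · have := half_zero_nhds m hε h3
      rw [← h] at this
      exact contDiffAt_const.congr_of_eventuallyEq this
    · exact (contDiffAt_rp _ h).mul (h1.contDiffAt.comp x (contDiffAt_Psi h))
  · rintro _ ⟨y, hy, rfl⟩
    exact hΩ.smul _ (norm_pos_iff.2 (hΩ.ne (h4 hy))) _ (h4 hy)

lemma navier_sub {u v : Eu n → ℝ} (hu : NavierAdm Ω u) (hv : NavierAdm Ω v) : NavierAdm Ω (fun x => u x - v x) := by
  obtain ⟨h1, h2, ⟨ε, hε, h3⟩, R, h4⟩ := hu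
  obtain ⟨h1', h2', ⟨ε', hε', h3'⟩, R', h4'⟩ := hv
  refine ⟨h1.sub h1', fun x hx => by simp [h2 x hx, h2' x hx], ⟨min ε ε', lt_min hε hε', fun x hx => ?_⟩, max R R', fun x hx => ?_⟩
  · rw [lt_min_iff] at hx; simp [h3 x hx.1, h3' x hx.2]
  · rw [max_lt_iff] at hx; simp [h4 x hx.1, h4' x hx.2]

lemma dir_sub {u v : Eu n → ℝ} (hu : DirichletAdm Ω u) (hv : DirichletAdm Ω v) : DirichletAdm Ω (fun x => u x - v x) :=
  ⟨hu.1.sub hv.1, hu.2.1.sub hv.2.1, (tsupport_sub u v).trans (union_subset hu.2.2 hv.2.2)⟩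
end

noncomputable section
open scoped RealInnerProductSpace Pointwise
variable {n : ℕ} {Ω : Set (Eu n)}

lemma lap_congr {f g : Eu n → ℝ} (hΩ : IsOpen Ω) (h : EqOn f g Ω) {x : Eu n} (hx : x ∈ Ω) : lap f x = lap g x := by
  unfold lap
  rw [((h.eventuallyEq_of_mem (hΩ.mem_nhds hx)).iteratedFDeriv ℝ 2).eq_of_nhds]

/-- The exponent of the Emden-Fowler transform. -/
def emExp (n : ℕ) (α : ℝ) : ℝ := ((n:ℝ) + α - 4) / 2

lemma Q_eq (hΩ : OC Ω) {α : ℝ} {u w : Eu n → ℝ} (hw : ContDiffOn ℝ 2 w Ω)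
    (huw : EqOn u (fun x => ‖x‖ ^ (-(emExp n α)) * w x) Ω) :
    (∫ x in Ω, ‖x‖ ^ α * (lap u x) ^ 2) =
      I Ω (fun x => (Ed (Ed w) x + (2 - α) * Ed w x + (Sg w x - gam n α * w x))^2) := by
  unfold I
  refine setIntegral_congr_fun hΩ.op.measurableSet fun x hx => ?_
  have hr : 0 < ‖x‖ := norm_pos_iff.2 (hΩ.ne hx)
  have h := lap_rp_mul hΩ hw (emExp n α) hx
  rw [← lap_congr hΩ.op huw hx] at h
  have e1 : Ed (Ed w) x + ((n:ℝ) - 2 - 2 * emExp n α) * Ed w x + (emExp n α^2 - ((n:ℝ)-2) * emExp n α) * w x + Sg w x =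
      Ed (Ed w) x + (2 - α) * Ed w x + (Sg w x - gam n α * w x) := by
    unfold emExp gam; ring
  rw [e1] at h
  have e2 : lap u x = ‖x‖ ^ (-(emExp n α) - 2) * (Ed (Ed w) x + (2 - α) * Ed w x + (Sg w x - gam n α * w x)) := by
    rw [Real.rpow_sub hr, Real.rpow_two, div_mul_eq_mul_div, eq_div_iff (by positivity), ← h]; ring
  have e3 : ‖x‖ ^ α * (‖x‖ ^ (-(emExp n α) - 2))^2 = ‖x‖ ^ (-(n:ℝ)) := by
    rw [← Real.rpow_natCast, ← Real.rpow_mul hr.le, ← Real.rpow_add hr]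
    congr 1; unfold emExp; push_cast; ring
  simp only
  rw [e2, mul_pow, ← mul_assoc, e3]

lemma B_eq (hΩ : OC Ω) {α : ℝ} {u w : Eu n → ℝ} (huw : EqOn u (fun x => ‖x‖ ^ (-(emExp n α)) * w x) Ω) :
    (∫ x in Ω, ‖x‖ ^ (α - 4) * (u x) ^ 2) = I Ω (fun x => w x ^ 2) := by
  unfold I
  refine setIntegral_congr_fun hΩ.op.measurableSet fun x hx => ?_
  have hr : 0 < ‖x‖ := norm_pos_iff.2 (hΩ.ne hx)
  have e3 : ‖x‖ ^ (α - 4) * (‖x‖ ^ (-(emExp n α)))^2 = ‖x‖ ^ (-(n:ℝ)) := by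
    rw [← Real.rpow_natCast, ← Real.rpow_mul hr.le, ← Real.rpow_add hr]
    congr 1; unfold emExp; push_cast; ring
  simp only
  rw [huw hx]
  simp only
  rw [mul_pow, ← mul_assoc, e3]

lemma uw_eq (hΩ : OC Ω) (m : ℝ) (u : Eu n → ℝ) : EqOn u (fun x => ‖x‖ ^ (-m) * (‖x‖ ^ m * u x)) Ω := by
  intro x hx
  have hr : 0 < ‖x‖ := norm_pos_iff.2 (hΩ.ne hx)
  simp only
  rw [← mul_assoc, ← Real.rpow_add hr]; simp

lemma half_eq (hΩ : OC Ω) (m : ℝ) (u : Eu n → ℝ) :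
    EqOn (half m u) (fun x => ‖x‖ ^ (-m) * ((fun y => ‖y‖ ^ m * u y) (Psi x))) Ω := by
  intro x hx
  have hr : 0 < ‖x‖ := norm_pos_iff.2 (hΩ.ne hx)
  simp only [half]
  rw [norm_Psi (hΩ.ne hx), ← Real.rpow_mul hr.le, ← mul_assoc, ← Real.rpow_add hr]
  congr 2; ring

lemma star (hΩ : OC Ω) {α μ : ℝ} {u : Eu n → ℝ} (hu : NavierAdm Ω u)
    (hle : μ * (∫ x in Ω, ‖x‖ ^ (α - 4) * (half (emExp n α) u x) ^ 2) ≤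
      ∫ x in Ω, ‖x‖ ^ α * (lap (half (emExp n α) u) x) ^ 2) :
    μ * (∫ x in Ω, ‖x‖ ^ (α - 4) * (u x) ^ 2) +
      15/16 * I Ω (fun x => Ed (Ed (fun y => ‖y‖ ^ (emExp n α) * u y)) x ^ 2) ≤
      ∫ x in Ω, ‖x‖ ^ α * (lap u x) ^ 2 := by
  set w : Eu n → ℝ := fun y => ‖y‖ ^ (emExp n α) * u y with hw
  have hG : Good Ω w := good_of_navier hΩ (navier_rp _ hu)
  have huw := uw_eq hΩ (emExp n α) u
  have hhw := half_eq hΩ (emExp n α) u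
  rw [← hw] at hhw
  have hP : ContDiffOn ℝ 2 (fun x => w (Psi x)) Ω :=
    hG.cd.comp (fun x hx => (contDiffAt_Psi (hΩ.ne hx)).contDiffWithinAt) (fun x hx => Psi_mem hΩ hx)
  rw [B_eq hΩ hhw, Q_eq hΩ hP hhw, I_Psi hΩ (fun x => w x ^ 2)] at hle
  have e : I Ω (fun x => (Ed (Ed (fun x => w (Psi x))) x + (2 - α) * Ed (fun x => w (Psi x)) x +
      (Sg (fun x => w (Psi x)) x - gam n α * w (Psi x)))^2) =
      2 * I Ω (fun x => (1/4 * Ed (Ed w) x + (2-α)/2 * Ed w x + (Sg w x - gam n α * w x))^2) := by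
    rw [← I_Psi hΩ]
    refine I_congr hΩ fun x hx => ?_
    obtain ⟨h1, h2, h3⟩ := second_Psi hΩ hG.cd hx
    rw [h1, h2, h3]; ring
  rw [e] at hle
  rw [B_eq hΩ huw, Q_eq hΩ hG.cd huw]
  have := main_ineq hΩ hG (2 - α) (gam n α) (by unfold gam; nlinarith [sq_nonneg ((n:ℝ)-2), sq_nonneg (α-2)])
  linarith

lemma I_cs (hΩ : OC Ω) {f g : Eu n → ℝ} (hf : Tame Ω f) (hg : Tame Ω g) :
    (I Ω (fun x => f x * g x))^2 ≤ I Ω (fun x => f x ^ 2) * I Ω (fun x => g x ^ 2) := by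
  have h : ∀ t : ℝ, 0 ≤ I Ω (fun x => f x ^ 2) * (t * t) + (2 * I Ω (fun x => f x * g x)) * t + I Ω (fun x => g x ^ 2) := by
    intro t
    have h0 : 0 ≤ I Ω (fun x => ((t*t) * f x ^ 2 + (2 * t) * (f x * g x)) + g x ^ 2) :=
      I_nonneg hΩ fun x _ => by nlinarith [sq_nonneg (t * f x + g x)]
    rw [I_add hΩ ((hf.sq.const_mul _).add ((hf.mul hg).const_mul _)) hg.sq,
      I_add hΩ (hf.sq.const_mul _) ((hf.mul hg).const_mul _), I_const_mul, I_const_mul] at h0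
    linarith
  have := discrim_le_zero h
  unfold discrim at this
  nlinarith

lemma tz {c d : ℕ → ℝ} (h0 : ∀ k, 0 ≤ c k) (h : ∀ k, c k ^ 2 ≤ d k) (hd : Tendsto d atTop (nhds 0)) :
    Tendsto c atTop (nhds 0) := by
  have : Tendsto (fun k => Real.sqrt (d k)) atTop (nhds 0) := by
    have := (Real.continuous_sqrt.tendsto 0).comp hd
    rw [Real.sqrt_zero] at this
    exact this
  exact squeeze_zero h0 (fun k => Real.le_sqrt_of_sq_le (h k)) this

/-- Logarithmic weight. -/
def ps (M : ℝ) (x : Eu n) : ℝ := M * Real.arctan (Real.log ‖x‖ / M)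

lemma ps_contDiffAt (M : ℝ) {x : Eu n} (hx : x ≠ 0) : ContDiffAt ℝ 1 (ps M : Eu n → ℝ) x := by
  have h1 : ContDiffAt ℝ 1 (fun y : Eu n => Real.log ‖y‖) x :=
    (contDiffAt_norm ℝ hx).log (norm_ne_zero_iff.2 hx)
  exact contDiffAt_const.mul (Real.contDiff_arctan.contDiffAt.comp x (h1.div_const M))

lemma Ed_ps {M : ℝ} (hM : 0 < M) {x : Eu n} (hx : x ≠ 0) : Ed (ps M) x = 1 / (1 + (Real.log ‖x‖ / M)^2) := by
  have h1 := hasDerivAt_dil (f := (ps M : Eu n → ℝ)) (x := x) 0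
    (by simpa using (ps_contDiffAt M hx).differentiableAt (by norm_num))
  have e : (fun s : ℝ => (ps M : Eu n → ℝ) (Real.exp s • x)) = fun s => M * Real.arctan ((s + Real.log ‖x‖) / M) := by
    funext s
    rw [ps, norm_smul, Real.norm_of_nonneg (Real.exp_pos s).le, Real.log_mul (Real.exp_pos s).ne' (norm_ne_zero_iff.2 hx), Real.log_exp]
  rw [e] at h1
  have h2 : HasDerivAt (fun s : ℝ => M * Real.arctan ((s + Real.log ‖x‖) / M)) _ 0 :=
    ((((hasDerivAt_id (0:ℝ)).add_const (Real.log ‖x‖)).div_const M).arctan).const_mul M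
  have := h1.unique h2
  simp only [Real.exp_zero, one_smul, id, zero_add] at this
  rw [this]; field_simp

lemma ps_bd {M : ℝ} (hM : 0 < M) (x : Eu n) : |ps M x| ≤ 2 * M := by
  rw [ps, abs_mul, abs_of_pos hM]
  have h1 := Real.arctan_lt_pi_div_two (Real.log ‖x‖ / M)
  have h2 := Real.neg_pi_div_two_lt_arctan (Real.log ‖x‖ / M)
  have h3 := Real.pi_lt_four
  have : |Real.arctan (Real.log ‖x‖ / M)| ≤ 2 := abs_le.2 ⟨by linarith, by linarith⟩
  nlinarith

lemma ps_key (hΩ : OC Ω) {w : Eu n → ℝ} (hw : Good Ω w) {M : ℝ} (hM : 0 < M) :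
    (I Ω (fun x => w x ^ 2 * Ed (ps M) x))^2 ≤
      16 * M^2 * (I Ω (fun x => w x ^ 2) * I Ω (fun x => Ed w x ^ 2)) := by
  have cps : ContDiffOn ℝ 1 (ps M) Ω := fun x hx => (ps_contDiffAt M (hΩ.ne hx)).contDiffWithinAt
  have bps : BC Ω (ps M) := ⟨cps.continuousOn, 2 * M, fun x _ => ps_bd hM x⟩
  have bps' : BC Ω (Ed (ps M)) := by
    refine ⟨(Dd_contDiffOn (m := 0) hΩ.op (by norm_num) cps _).continuousOn, 1, fun x hx => ?_⟩
    rw [Ed_ps hM (hΩ.ne hx), abs_of_nonneg (by positivity)]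
    rw [div_le_one (by positivity)]; nlinarith [sq_nonneg (Real.log ‖x‖ / M)]
  have cw : ContDiffOn ℝ 1 w Ω := hw.cd.of_le (by norm_num)
  have tw := hw.t0
  have tY : Tame Ω (Ed w) := hw.t1 _
  have tpw : Tame Ω (fun x => w x * ps M x) := tw.mul_bc bps
  have tA := tw.sq.mul_bc bps'
  have tB := (tpw.mul tY).const_mul 2
  have e : EqOn (Ed (fun x => (w x * w x) * ps M x)) (fun x => w x ^2 * Ed (ps M) x + 2 * ((w x * ps M x) * Ed w x)) Ω := by
    intro x hx
    have d1 := C1_diff hΩ.op cw hx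
    unfold Ed
    rw [Dd_mul (d1.fun_mul d1) (C1_diff hΩ.op cps hx), Dd_mul d1 d1]; ring
  have h0 := I_Ed hΩ ((cw.mul cw).mul cps) ((tw.mul tw).mul_bc bps) ((tA.add tB).congr _ e)
  rw [I_congr hΩ e, I_add hΩ tA tB, I_const_mul] at h0
  have hcs := I_cs hΩ tpw tY
  have hb : I Ω (fun x => (w x * ps M x)^2) ≤ 4 * M^2 * I Ω (fun x => w x ^ 2) := by
    rw [← I_const_mul]
    refine I_mono hΩ tpw.sq (tw.sq.const_mul _) fun x _ => ?_
    have h1 := sq_le_sq' (abs_le.1 (ps_bd hM x)).1 (abs_le.1 (ps_bd hM x)).2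
    rw [mul_pow]
    nlinarith [sq_nonneg (w x)]
  have hy : 0 ≤ I Ω (fun x => Ed w x ^ 2) := I_nonneg hΩ fun x _ => sq_nonneg _
  have h1 : I Ω (fun x => w x ^ 2 * Ed (ps M) x) = -(2 * I Ω (fun x => (w x * ps M x) * Ed w x)) := by linarith
  rw [h1]
  nlinarith [mul_le_mul_of_nonneg_right hb hy]

theorem abstract_thm (hΩ : OC Ω) {α μ : ℝ} (hμ : 0 < μ) (P : (Eu n → ℝ) → Prop)
    (hN : ∀ u, P u → NavierAdm Ω u) (hsub : ∀ u v, P u → P v → P (fun x => u x - v x))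
    (hhalf : ∀ u, P u → P (half (emExp n α) u))
    (hle : ∀ u, P u → μ * (∫ x in Ω, ‖x‖ ^ (α - 4) * (u x) ^ 2) ≤ ∫ x in Ω, ‖x‖ ^ α * (lap u x) ^ 2)
    (u : ℕ → Eu n → ℝ) (a b : ℝ) (hu : ∀ k, P (u k))
    (hC : ∀ ε > 0, ∃ N : ℕ, ∀ j ≥ N, ∀ k ≥ N,
          (∫ x in Ω, ‖x‖ ^ α * (lap (fun y => u j y - u k y) x) ^ 2) < ε)
    (ha : Tendsto (fun k => ∫ x in Ω, ‖x‖ ^ α * (lap (u k) x) ^ 2) atTop (nhds a))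
    (hb : Tendsto (fun k => ∫ x in Ω, ‖x‖ ^ (α - 4) * (u k x) ^ 2) atTop (nhds b))
    (hb0 : b ≠ 0) (hab : a = μ * b) : False := by
  set w : ℕ → Eu n → ℝ := fun k y => ‖y‖ ^ (emExp n α) * u k y with hw
  have hG : ∀ k, Good Ω (w k) := fun k => good_of_navier hΩ (navier_rp _ (hN _ (hu k)))
  have hB : ∀ k, (∫ x in Ω, ‖x‖ ^ (α - 4) * (u k x) ^ 2) = I Ω (fun x => w k x ^ 2) := fun k =>
    B_eq hΩ (uw_eq hΩ _ _)
  have hst := fun k => star hΩ (hN _ (hu k)) (hle _ (hhalf _ (hu k)))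
  have hX0 : ∀ k, 0 ≤ I Ω (fun x => Ed (Ed (w k)) x ^ 2) := fun k => I_nonneg hΩ fun x _ => sq_nonneg _
  have hX : Tendsto (fun k => I Ω (fun x => Ed (Ed (w k)) x ^ 2)) atTop (nhds 0) := by
    have h1 : Tendsto (fun k => 16/15 * ((∫ x in Ω, ‖x‖ ^ α * (lap (u k) x) ^ 2) -
        μ * ∫ x in Ω, ‖x‖ ^ (α - 4) * (u k x) ^ 2)) atTop (nhds 0) := by
      have := (ha.sub (hb.const_mul μ)).const_mul (16/15)
      rw [hab, sub_self, mul_zero] at this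
      exact this
    refine squeeze_zero hX0 (fun k => ?_) h1
    have := hst k
    simp only [hw]
    linarith
  simp only [hB] at hb
  have hY : Tendsto (fun k => I Ω (fun x => Ed (w k) x ^ 2)) atTop (nhds 0) := by
    refine tz (d := fun k => I Ω (fun x => w k x ^ 2) * I Ω (fun x => Ed (Ed (w k)) x ^ 2))
      (fun k => I_nonneg hΩ fun x _ => sq_nonneg _) (fun k => ?_) (by simpa using hb.mul hX)
    have h1 := Ed_mul_int hΩ ((hG k).cd.of_le (by norm_num)) (Dd_C1 hΩ.op (hG k).cd _) (hG k).t0 ((hG k).t1 _)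
      ((hG k).t1 _) ((hG k).t2 (ContinuousLinearMap.id ℝ (Eu n)) (ContinuousLinearMap.id ℝ (Eu n)))
    have h2 := I_cs hΩ (hG k).t0 ((hG k).t2 (ContinuousLinearMap.id ℝ (Eu n)) (ContinuousLinearMap.id ℝ (Eu n)))
    have h3 : I Ω (fun x => Ed (w k) x ^ 2) = - I Ω (fun x => w k x * Ed (Ed (w k)) x) := by
      have e : (fun x => Ed (w k) x ^ 2) = fun x => Ed (w k) x * Ed (w k) x := by funext x; ring
      rw [e]
      unfold Ed
      unfold Ed at h1
      linarith
    rw [h3, neg_sq]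
    exact h2
  have hbn : 0 ≤ b := ge_of_tendsto' hb fun k => I_nonneg hΩ fun x _ => sq_nonneg _
  have hbpos : 0 < b := lt_of_le_of_ne hbn (Ne.symm hb0)
  obtain ⟨N, hNN⟩ := hC (μ * (b / 2)) (by positivity)
  obtain ⟨ε, hε, R, C, hsup⟩ := (hG N).t0.ex
  set M := max |Real.log ε| |Real.log R| + 1 with hM
  have hMp : 0 < M := by
    have := (abs_nonneg (Real.log ε)).trans (le_max_left _ |Real.log R|)
    linarith
  have hc : Tendsto (fun k => I Ω (fun x => w k x ^ 2 * Ed (ps M) x)) atTop (nhds 0) := by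
    refine tz (d := fun k => 16 * M^2 * (I Ω (fun x => w k x ^ 2) * I Ω (fun x => Ed (w k) x ^ 2)))
      (fun k => I_nonneg hΩ fun x hx => ?_) (fun k => ps_key hΩ (hG k) hMp)
      (by simpa using (hb.mul hY).const_mul (16 * M^2))
    rw [Ed_ps hMp (hΩ.ne hx)]; positivity
  have cps : ContDiffOn ℝ 1 (ps M) Ω := fun x hx => (ps_contDiffAt M (hΩ.ne hx)).contDiffWithinAt
  have bps' : BC Ω (Ed (ps M)) := by
    refine ⟨(Dd_contDiffOn (m := 0) hΩ.op (by norm_num) cps _).continuousOn, 1, fun x hx => ?_⟩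
    rw [Ed_ps hMp (hΩ.ne hx), abs_of_nonneg (by positivity)]
    rw [div_le_one (by positivity)]; nlinarith [sq_nonneg (Real.log ‖x‖ / M)]
  have hfin : ∀ j ≥ N, I Ω (fun x => w j x ^ 2) ≤ 2 * I Ω (fun x => w j x ^ 2 * Ed (ps M) x) + b / 2 := by
    intro j hj
    have h1 := hle _ (hsub _ _ (hu j) (hu N))
    have h2 := hNN j hj N le_rfl
    rw [B_eq hΩ (uw_eq hΩ _ _)] at h1
    have h3 : I Ω (fun x => (w j x - w N x)^2) ≤ b / 2 := by
      have e : (fun x : Eu n => (‖x‖ ^ (emExp n α) * (u j x - u N x))^2) = fun x => (w j x - w N x)^2 := by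
        funext x; simp only [hw]; ring
      rw [e] at h1
      exact le_of_mul_le_mul_left (h1.trans h2.le) hμ
    have tA := ((hG j).t0.sq.mul_bc bps').const_mul 2
    have tB := ((hG j).t0.sub (hG N).t0).sq
    have h4 := I_mono hΩ (hG j).t0.sq (tA.add tB) fun x hx => ?_
    · rw [I_add hΩ tA tB, I_const_mul] at h4
      linarith
    · have hE0 : 0 ≤ Ed (ps M) x := by rw [Ed_ps hMp (hΩ.ne hx)]; positivity
      by_cases h0 : w N x = 0
      · rw [h0, sub_zero]; nlinarith [mul_nonneg (sq_nonneg (w j x)) hE0]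
      · obtain ⟨g1, g2⟩ := (hsup x hx).2 h0
        have l1 := Real.log_le_log hε g1
        have l2 := Real.log_le_log (hε.trans_le g1) g2
        have l3 : |Real.log ‖x‖| ≤ M := by
          refine (abs_le.2 ⟨?_, ?_⟩)
          · have := neg_abs_le (Real.log ε)
            have := le_max_left |Real.log ε| |Real.log R|
            linarith
          · have := le_abs_self (Real.log R)
            have := le_max_right |Real.log ε| |Real.log R|
            linarith
        have l4 : (Real.log ‖x‖ / M)^2 ≤ 1 := by
          rw [div_pow, div_le_one (by positivity)]
          exact sq_le_sq' (abs_le.1 l3).1 (abs_le.1 l3).2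
        have l5 : 1/2 ≤ Ed (ps M) x := by
          rw [Ed_ps hMp (hΩ.ne hx)]
          exact one_div_le_one_div_of_le (by positivity) (by linarith)
        nlinarith [mul_le_mul_of_nonneg_left l5 (sq_nonneg (w j x)), sq_nonneg (w j x - w N x)]
  have hlim : Tendsto (fun j => 2 * I Ω (fun x => w j x ^ 2 * Ed (ps M) x) + b / 2) atTop (nhds (2 * 0 + b/2)) :=
    (hc.const_mul 2).add_const _
  have := le_of_tendsto_of_tendsto hb hlim (eventually_atTop.2 ⟨N, hfin⟩)
  linarith

lemma mu_le (hΩ : OC Ω) {α : ℝ} (P : (Eu n → ℝ) → Prop) (hN : ∀ u, P u → NavierAdm Ω u) {u : Eu n → ℝ} (hu : P u) :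
    sInf {q : ℝ | ∃ u, P u ∧ (∃ x ∈ Ω, u x ≠ 0) ∧
      q = (∫ x in Ω, ‖x‖ ^ α * (lap u x) ^ 2) / (∫ x in Ω, ‖x‖ ^ (α - 4) * (u x) ^ 2)} *
      (∫ x in Ω, ‖x‖ ^ (α - 4) * (u x) ^ 2) ≤ ∫ x in Ω, ‖x‖ ^ α * (lap u x) ^ 2 := by
  have hQ : ∀ v : Eu n → ℝ, 0 ≤ ∫ x in Ω, ‖x‖ ^ α * (lap v x) ^ 2 := fun v =>
    integral_nonneg fun x => by positivity
  have hB : ∀ v : Eu n → ℝ, 0 ≤ ∫ x in Ω, ‖x‖ ^ (α-4) * (v x) ^ 2 := fun v =>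
    integral_nonneg fun x => by positivity
  rcases (hB u).eq_or_lt with h | h
  · rw [← h, mul_zero]; exact hQ u
  · have hne : ∃ x ∈ Ω, u x ≠ 0 := by
      by_contra hcon
      push Not at hcon
      refine h.ne' ?_
      rw [setIntegral_congr_fun (g := fun _ => (0:ℝ)) hΩ.op.measurableSet fun x hx => by simp [hcon x hx]]
      simp
    rw [← le_div_iff₀ h]
    refine csInf_le ⟨0, ?_⟩ ⟨u, hu, hne, rfl⟩
    rintro q ⟨v, -, -, rfl⟩
    exact div_nonneg (hQ v) (hB v)
end

noncomputable section

/-- Theorem 2 of the paper: the Rellich constants on cones are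
never attained.  Attainment in the completion `N²(C_Σ;α)` (resp. `D²(C_Σ;α)`) is
expressed concretely: there is no Cauchy sequence (for the norm
`u ↦ (∫ |x|^α |Δu|²)^{1/2}`) of admissible functions whose (limit) weighted `L²`
norm is nonzero and whose limit quotient realizes the infimum. -/
theorem rellich_cone_not_attained {n : ℕ} (hn : 2 ≤ n) (α : ℝ)
    (S : Set (EuclideanSpace ℝ (Fin n))) (hS : IsC2SphDomain S) :
    (0 < muN (coneOf S) α →
      ¬ ∃ (u : ℕ → EuclideanSpace ℝ (Fin n) → ℝ) (a b : ℝ),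
        (∀ k, NavierAdm (coneOf S) (u k)) ∧
        (∀ ε > 0, ∃ N : ℕ, ∀ j ≥ N, ∀ k ≥ N,
          (∫ x in coneOf S, ‖x‖ ^ α * (lap (fun y => u j y - u k y) x) ^ 2) < ε) ∧
        Tendsto (fun k => ∫ x in coneOf S, ‖x‖ ^ α * (lap (u k) x) ^ 2)
          atTop (nhds a) ∧
        Tendsto (fun k => ∫ x in coneOf S, ‖x‖ ^ (α - 4) * (u k x) ^ 2)
          atTop (nhds b) ∧
        b ≠ 0 ∧ a = muN (coneOf S) α * b) ∧
    (0 < muD (coneOf S) α →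
      ¬ ∃ (u : ℕ → EuclideanSpace ℝ (Fin n) → ℝ) (a b : ℝ),
        (∀ k, DirichletAdm (coneOf S) (u k)) ∧
        (∀ ε > 0, ∃ N : ℕ, ∀ j ≥ N, ∀ k ≥ N,
          (∫ x in coneOf S, ‖x‖ ^ α * (lap (fun y => u j y - u k y) x) ^ 2) < ε) ∧
        Tendsto (fun k => ∫ x in coneOf S, ‖x‖ ^ α * (lap (u k) x) ^ 2)
          atTop (nhds a) ∧
        Tendsto (fun k => ∫ x in coneOf S, ‖x‖ ^ (α - 4) * (u k x) ^ 2)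
          atTop (nhds b) ∧
        b ≠ 0 ∧ a = muD (coneOf S) α * b) := by
  have hΩ := coneOf_OC hS.1
  refine ⟨?_, ?_⟩
  · rintro hμ ⟨u, a, b, hu, hC, ha, hb, hb0, hab⟩
    exact abstract_thm hΩ hμ (NavierAdm (coneOf S)) (fun _ h => h) (fun _ _ => navier_sub)
      (fun _ => half_navier hΩ _) (fun _ h => mu_le hΩ _ (fun _ h => h) h) u a b hu hC ha hb hb0 hab
  · rintro hμ ⟨u, a, b, hu, hC, ha, hb, hb0, hab⟩
    exact abstract_thm hΩ hμ (DirichletAdm (coneOf S)) (fun _ => dir_navier hΩ) (fun _ _ => dir_sub)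
      (fun _ => half_dir hΩ _) (fun _ h => mu_le hΩ _ (fun _ => dir_navier hΩ) h) u a b hu hC ha hb hb0 hab
end
end
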